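/- Let 0<α<1, 1<p<1/α, and q = p/(1−αp). There exists a constant c depending only on p and α such that for every weight w ∈ A_{p,q}^-(ℝ), the Riemann–Liouville operator R_α satisfies ‖R_α‖_{L^p_{w^p}(ℝ)→L^q_{w^q}(ℝ)} ≤ c ‖w‖_{A_{p,q}^-(ℝ)}^{(1-α)·max{1, p'/q}}. Moreover, this estimate is sharp: the exponent (1−α)max{1,p'/q} cannot be decreased. -/

import Mathlib

open MeasureTheory Set Filter
open scoped ENNReal

noncomputable section

/-- A weight on `ℝ`: an a.e. positive, locally integrable function. -/
def IsWeight (w : ℝ → ℝ) : Prop :=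
  (∀ᵐ x : ℝ, 0 < w x) ∧ MeasureTheory.LocallyIntegrable w MeasureTheory.volume

/-- `∫_a^b w` as a lower integral. -/
def lintIoc (w : ℝ → ℝ) (a b : ℝ) : ℝ≥0∞ :=
  ∫⁻ t in Set.Ioc a b, ENNReal.ofReal (w t)

/-- Average `(1/(b-a)) ∫_a^b w`. -/
def avgIoc (w : ℝ → ℝ) (a b : ℝ) : ℝ≥0∞ :=
  (ENNReal.ofReal (b - a))⁻¹ * lintIoc w a b

/-- The one-sided `A_{p,q}^-` characteristic:
`sup_{x,h>0} ((1/h)∫_x^{x+h} u^q)((1/h)∫_{x-h}^x u^{-p'})^{q/p'}`, `p' = p/(p-1)`. -/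
def apqMinusChar (p q : ℝ) (u : ℝ → ℝ) : ℝ≥0∞ :=
  ⨆ (x : ℝ) (h : ℝ) (_ : 0 < h),
    avgIoc (fun t => u t ^ q) x (x + h) *
      avgIoc (fun t => u t ^ (-(p / (p - 1)))) (x - h) x ^ (q / (p / (p - 1)))

/-- Weighted `L^p` "norm" `(∫ g^p w)^{1/p}` of an `ℝ≥0∞`-valued function. -/
def lnormW (p : ℝ) (w : ℝ → ℝ) (g : ℝ → ℝ≥0∞) : ℝ≥0∞ :=
  (∫⁻ x : ℝ, g x ^ p * ENNReal.ofReal (w x)) ^ (1 / p)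

/-- The Riemann–Liouville fractional integral (applied to `|f|`):
`R_α f(x) = ∫_{-∞}^x |f(t)| (x-t)^{α-1} dt`. -/
def Ralpha (α : ℝ) (f : ℝ → ℝ) (x : ℝ) : ℝ≥0∞ :=
  ∫⁻ t in Set.Iio x, ENNReal.ofReal (|f t| * (x - t) ^ (α - 1))

def en (p s f : ℝ) : ℝ := f ^ p * s ^ (1 - p)

lemma en_nonneg {p s f : ℝ} (hs : 0 < s) (hf : 0 ≤ f) : 0 ≤ en p s f := by
  unfold en; positivity

lemma en_eq1 {p s f : ℝ} (hs : 0 < s) (hf : 0 ≤ f) : en p s f = (f / s) ^ p * s := by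
  unfold en
  rw [Real.div_rpow hf hs.le, Real.rpow_sub hs, Real.rpow_one]
  field_simp

lemma en_eq2 {p s f : ℝ} (hp : 1 < p) (hs : 0 < s) (hf : 0 ≤ f) :
    en p s f = (f / s) ^ (p - 1) * f := by
  rcases hf.eq_or_lt with rfl | hf'
  · simp [en, Real.zero_rpow (by linarith : p ≠ 0)]
  rw [en_eq1 hs hf]
  have h : 0 < f / s := by positivity
  rw [Real.rpow_sub_one h.ne']
  field_simp

lemma en_pow {p q s f : ℝ} (hp : 1 < p) (hs : 0 < s) (hf : 0 ≤ f) :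
    (f / s) ^ q * s ^ (q / p) = en p s f ^ (q / p) := by
  rw [en_eq1 hs hf, Real.mul_rpow (by positivity) hs.le, ← Real.rpow_mul (by positivity)]
  congr 2
  field_simp

/-- Young. -/
lemma young_x {q Q : ℝ} (hc : Real.HolderConjugate q Q) {x g v T : ℝ} (hx : 0 ≤ x) (hg : 0 ≤ g)
    (hv : 0 < v) (hT : 0 < T) : x * g ≤ T ^ (1 - q) * (x ^ q * v) + T * en Q v g := by
  have hq1 := hc.lt
  have hQ1 := hc.symm.lt
  have hq0 : 0 < q := by linarith
  have hQ0 : 0 < Q := by linarith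
  have hr : q⁻¹ + Q⁻¹ = 1 := hc.inv_add_inv_eq_one
  have e1 : -(1 / Q) * q = 1 - q := by
    have : Q⁻¹ = 1 - q⁻¹ := by linarith
    rw [one_div, this]; field_simp; ring
  have e2 : -(1 / q) * Q = 1 - Q := by
    have : q⁻¹ = 1 - Q⁻¹ := by linarith
    rw [one_div, this]; field_simp; ring
  have h := Real.young_inequality_of_nonneg (a := T ^ (-(1 / Q)) * x * v ^ (1 / q))
    (b := T ^ (1 / Q) * g * v ^ (-(1 / q))) (by positivity) (by positivity) hc
  have h1 : T ^ (-(1 / Q)) * x * v ^ (1 / q) * (T ^ (1 / Q) * g * v ^ (-(1 / q))) = x * g := by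
    rw [Real.rpow_neg hT.le, Real.rpow_neg hv.le]
    have := (Real.rpow_pos_of_pos hT (1 / Q)).ne'
    have := (Real.rpow_pos_of_pos hv (1 / q)).ne'
    field_simp
  have h2 : (T ^ (-(1 / Q)) * x * v ^ (1 / q)) ^ q = T ^ (1 - q) * (x ^ q * v) := by
    rw [Real.mul_rpow (by positivity) (by positivity), Real.mul_rpow (by positivity) hx,
      ← Real.rpow_mul hT.le, ← Real.rpow_mul hv.le, e1, one_div, inv_mul_cancel₀ hq0.ne',
      Real.rpow_one]
    ring
  have h3 : (T ^ (1 / Q) * g * v ^ (-(1 / q))) ^ Q = T * en Q v g := by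
    rw [Real.mul_rpow (by positivity) (by positivity), Real.mul_rpow (by positivity) hg,
      ← Real.rpow_mul hT.le, ← Real.rpow_mul hv.le, e2, one_div, inv_mul_cancel₀ hQ0.ne',
      Real.rpow_one]
    unfold en; ring
  rw [h1, h2, h3] at h
  have p2 : 0 ≤ T ^ (1 - q) * (x ^ q * v) := by positivity
  have p3 : 0 ≤ T * en Q v g := mul_nonneg hT.le (en_nonneg hv hg)
  have := div_le_self p2 hq1.le
  have := div_le_self p3 hQ1.le
  linarith

lemma young_a {p s m f : ℝ} (hp : 1 < p) (hs : 0 < s) (hm : 0 ≤ m) (hf : 0 ≤ f) :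
    p * m ^ (p - 1) * f ≤ en p s f + (p - 1) * (s * m ^ p) := by
  have hc := Real.HolderConjugate.conjExponent hp
  have hx : 0 ≤ f / s := by positivity
  have h := Real.young_inequality_of_nonneg (a := f / s) (b := m ^ (p - 1)) hx (by positivity) hc
  have e : (m ^ (p - 1)) ^ (Real.conjExponent p) = m ^ p := by
    rw [← Real.rpow_mul hm]; congr 1; unfold Real.conjExponent
    have : p - 1 ≠ 0 := by linarith
    field_simp
  rw [e] at h
  rw [en_eq1 hs hf]
  have e3 : m ^ p / Real.conjExponent p = m ^ p * (p - 1) / p := by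
    unfold Real.conjExponent
    have : p - 1 ≠ 0 := by linarith
    field_simp
  rw [e3] at h
  have h2 := mul_le_mul_of_nonneg_left h (by positivity : 0 ≤ p * s)
  have : p * s * (f / s * m ^ (p - 1)) = p * m ^ (p - 1) * f := by field_simp
  rw [this] at h2
  have : p * s * ((f / s) ^ p / p + m ^ p * (p - 1) / p) = (f / s) ^ p * s + (p - 1) * (s * m ^ p) := by
    field_simp
  linarith

lemma young_b {p s m f Λ : ℝ} (hp : 1 < p) (hΛ : 1 ≤ Λ) (hΛp : 2 * p ≤ Λ ^ (p - 1)) (hs : 0 < s)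
    (hm : 0 ≤ m) (hf : 0 ≤ f) (h : Λ * m * s < f) :
    p * m ^ (p - 1) * f ≤ en p s f / 2 := by
  rw [en_eq2 hp hs hf]
  have h1 : Λ * m ≤ f / s := by rw [le_div_iff₀ hs]; exact h.le
  have h2 : (Λ * m) ^ (p - 1) ≤ (f / s) ^ (p - 1) :=
    Real.rpow_le_rpow (by positivity) h1 (by linarith)
  rw [Real.mul_rpow (by linarith) hm] at h2
  have h3 : 2 * p * m ^ (p - 1) ≤ (f / s) ^ (p - 1) :=
    le_trans (mul_le_mul_of_nonneg_right hΛp (by positivity)) h2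
  have := mul_le_mul_of_nonneg_right h3 hf
  linarith

inductive BT where
  | leaf (s v f g : ℝ) : BT
  | node (m : ℝ) (l r : BT) : BT

namespace BT

def sg : BT → ℝ
  | leaf s _ _ _ => s
  | node _ l r => l.sg + r.sg
def vv : BT → ℝ
  | leaf _ v _ _ => v
  | node _ l r => l.vv + r.vv
def ff : BT → ℝ
  | leaf _ _ f _ => f
  | node _ l r => l.ff + r.ff
def gg : BT → ℝ
  | leaf _ _ _ g => g
  | node _ l r => l.gg + r.gg
def Pos : BT → Prop
  | leaf s v f g => 0 < s ∧ 0 < v ∧ 0 ≤ f ∧ 0 ≤ g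
  | node m l r => 0 ≤ m ∧ l.Pos ∧ r.Pos
def mir : BT → BT
  | leaf s v f g => leaf v s g f
  | node m l r => node m r.mir l.mir
def skel : BT → BT
  | leaf s v _ _ => leaf s v 0 0
  | node m l r => node m l.skel r.skel
def EF (p : ℝ) : BT → ℝ
  | leaf s _ f _ => en p s f
  | node _ l r => l.EF p + r.EF p
def EG (Q : ℝ) : BT → ℝ
  | leaf _ v _ g => en Q v g
  | node _ l r => l.EG Q + r.EG Q
def aa (p : ℝ) (τ : BT) : ℝ := en p τ.sg τ.ff
def B : BT → ℝ
  | leaf _ _ _ _ => 0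
  | node m l r => m * l.ff * r.gg + (l.B + r.B)
def J (q : ℝ) : BT → ℝ → ℝ
  | leaf _ v _ _, t => t ^ q * v
  | node m l r, t => l.J q t + r.J q (t + m * l.sg)
def Jf (q : ℝ) : BT → ℝ → ℝ
  | leaf _ v _ _, t => t ^ q * v
  | node m l r, t => l.Jf q t + r.Jf q (t + m * l.ff)
def Test (p q T : ℝ) : BT → Prop
  | leaf _ _ _ _ => True
  | node m l r => (node m l r).J q 0 ≤ T ^ q * (node m l r).sg ^ (q / p) ∧
      m ^ q * r.vv * l.sg ^ q ≤ T ^ q * l.sg ^ (q / p) ∧ l.Test p q T ∧ r.Test p q T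
def Vs (q : ℝ) : BT → ℝ
  | leaf _ _ _ _ => 0
  | node m l r => m ^ q * r.vv * l.sg ^ q + (l.Vs q + r.Vs q)
def Em (q : ℝ) : BT → ℝ
  | leaf _ _ _ _ => 0
  | node m l r => m ^ q * r.vv * l.ff ^ q + (l.Em q + r.Em q)

open Classical in
def St (p Λ : ℝ) (h : BT → Prop) : BT → ℝ → ℝ
  | leaf s v f g, m => if h (leaf s v f g) ∧ Λ * m * s < f then en p s f else 0
  | node μ l r, m => if h (node μ l r) ∧ Λ * m * (node μ l r).sg < (node μ l r).ff
      then (node μ l r).aa p + (l.St p Λ h ((node μ l r).ff / (node μ l r).sg) +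
        r.St p Λ h ((node μ l r).ff / (node μ l r).sg))
      else l.St p Λ h m + r.St p Λ h m

open Classical in
def Jm (p Λ : ℝ) : BT → ℝ
  | leaf _ _ _ _ => 0
  | node μ l r => (if Λ * (node μ l r).ff * l.sg < l.ff * (node μ l r).sg then l.aa p else 0) +
      (l.Jm p Λ + r.Jm p Λ)

def heavy (p Q : ℝ) (τ : BT) : Prop := en Q τ.vv τ.gg ≤ en p τ.sg τ.ff

open Classical in
def Z (p Q Λ : ℝ) : BT → ℝ
  | leaf _ _ _ _ => 0
  | node m l r => (if heavy p Q (node m l r) ∧ l.ff * (node m l r).sg ≤ Λ * (node m l r).ff * l.sg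
      then m * l.ff * r.gg else 0) + (l.Z p Q Λ + r.Z p Q Λ)

open Classical in
def JumpR (Λ : ℝ) : BT → ℝ
  | leaf _ _ _ _ => 0
  | node m l r => (if Λ * (node m l r).gg * r.vv < r.gg * (node m l r).vv
      then m * l.ff * r.gg else 0) + (l.JumpR Λ + r.JumpR Λ)

lemma Pos.all {τ : BT} (h : τ.Pos) : 0 < τ.sg ∧ 0 < τ.vv ∧ 0 ≤ τ.ff ∧ 0 ≤ τ.gg := by
  induction τ with
  | leaf s v f g => exact h
  | node m l r hl hr =>
    obtain ⟨_, h1, h2⟩ := h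
    obtain ⟨a, b, c, d⟩ := hl h1
    obtain ⟨a', b', c', d'⟩ := hr h2
    refine ⟨?_, ?_, ?_, ?_⟩ <;> simp only [sg, vv, ff, gg] <;> linarith

lemma Pos.mir {τ : BT} (h : τ.Pos) : τ.mir.Pos := by
  induction τ with
  | leaf s v f g => obtain ⟨a, b, c, d⟩ := h; exact ⟨b, a, d, c⟩
  | node m l r hl hr => exact ⟨h.1, hr h.2.2, hl h.2.1⟩

lemma mir_sg (τ : BT) : τ.mir.sg = τ.vv := by
  induction τ with
  | leaf s v f g => rfl
  | node m l r hl hr => simp only [BT.mir, sg, vv, hl, hr]; ring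
lemma mir_vv (τ : BT) : τ.mir.vv = τ.sg := by
  induction τ with
  | leaf s v f g => rfl
  | node m l r hl hr => simp only [BT.mir, sg, vv, hl, hr]; ring
lemma mir_ff (τ : BT) : τ.mir.ff = τ.gg := by
  induction τ with
  | leaf s v f g => rfl
  | node m l r hl hr => simp only [BT.mir, ff, gg, hl, hr]; ring
lemma mir_gg (τ : BT) : τ.mir.gg = τ.ff := by
  induction τ with
  | leaf s v f g => rfl
  | node m l r hl hr => simp only [BT.mir, ff, gg, hl, hr]; ring
lemma mir_EF (Q : ℝ) (τ : BT) : τ.mir.EF Q = τ.EG Q := by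
  induction τ with
  | leaf s v f g => rfl
  | node m l r hl hr => simp only [BT.mir, EF, EG, hl, hr]; ring
lemma mir_EG (Q : ℝ) (τ : BT) : τ.mir.EG Q = τ.EF Q := by
  induction τ with
  | leaf s v f g => rfl
  | node m l r hl hr => simp only [BT.mir, EF, EG, hl, hr]; ring
lemma mir_mir (τ : BT) : τ.mir.mir = τ := by
  induction τ with
  | leaf s v f g => rfl
  | node m l r hl hr => simp only [BT.mir, hl, hr]

lemma EF_nonneg {p : ℝ} {τ : BT} (h : τ.Pos) : 0 ≤ τ.EF p := by
  induction τ with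
  | leaf s v f g => exact en_nonneg h.1 h.2.2.1
  | node m l r hl hr => exact add_nonneg (hl h.2.1) (hr h.2.2)

lemma EG_nonneg {p : ℝ} {τ : BT} (h : τ.Pos) : 0 ≤ τ.EG p := by
  rw [← mir_EF]; exact EF_nonneg h.mir

lemma aa_nonneg {p : ℝ} {τ : BT} (h : τ.Pos) : 0 ≤ τ.aa p := en_nonneg h.all.1 h.all.2.2.1

lemma aa_node {p : ℝ} (hp : 1 < p) {m : ℝ} {l r : BT} (h : (node m l r).Pos) :
    (node m l r).aa p ≤ l.aa p + r.aa p := by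
  obtain ⟨a, b, c, d⟩ := h.all
  obtain ⟨al, bl, cl, dl⟩ := h.2.1.all
  obtain ⟨ar, br, cr, dr⟩ := h.2.2.all
  set N := node m l r
  have hx : 0 ≤ N.ff / N.sg := by positivity
  have e1 : N.aa p = (N.ff / N.sg) ^ (p - 1) * N.ff := en_eq2 hp a c
  have e2 : N.aa p = (N.ff / N.sg) ^ p * N.sg := en_eq1 a c
  have h1 := young_a hp al hx cl
  have h2 := young_a hp ar hx cr
  have e3 : N.ff = l.ff + r.ff := rfl
  have e4 : N.sg = l.sg + r.sg := rfl
  have e5 : (p - 1) * (l.sg * (N.ff / N.sg) ^ p) + (p - 1) * (r.sg * (N.ff / N.sg) ^ p) =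
    (p - 1) * N.aa p := by
      rw [e2]; generalize (N.ff / N.sg) ^ p = X; rw [e4]; ring
  have e6 : p * (N.ff / N.sg) ^ (p - 1) * l.ff + p * (N.ff / N.sg) ^ (p - 1) * r.ff =
    p * N.aa p := by
      rw [e1]; generalize (N.ff / N.sg) ^ (p - 1) = X; rw [e3]; ring
  unfold aa at *
  linarith

lemma aa_le_EF {p : ℝ} (hp : 1 < p) {τ : BT} (h : τ.Pos) : τ.aa p ≤ τ.EF p := by
  induction τ with
  | leaf s v f g => exact le_rfl
  | node m l r hl hr =>
    have := aa_node hp h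
    have := hl h.2.1
    have := hr h.2.2
    simp only [EF]; linarith

lemma St_nonneg {p Λ : ℝ} {h : BT → Prop} {τ : BT} (hτ : τ.Pos) (m : ℝ) : 0 ≤ τ.St p Λ h m := by
  induction τ generalizing m with
  | leaf s v f g =>
    simp only [St]; split_ifs
    · exact en_nonneg hτ.1 hτ.2.2.1
    · exact le_rfl
  | node μ l r hl hr =>
    simp only [St]
    have := aa_nonneg (p := p) hτ
    split_ifs
    · linarith [hl hτ.2.1 ((node μ l r).ff / (node μ l r).sg), hr hτ.2.2 ((node μ l r).ff / (node μ l r).sg)]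
    · linarith [hl hτ.2.1 m, hr hτ.2.2 m]

/-- Carleson / stopping bound. -/
lemma St_bound {p Λ : ℝ} (hp : 1 < p) (hΛ : 1 ≤ Λ) (hΛp : 2 * p ≤ Λ ^ (p - 1)) {h : BT → Prop}
    {τ : BT} (hτ : τ.Pos) {m : ℝ} (hm : 0 ≤ m) :
    τ.St p Λ h m / 2 ≤ τ.EF p + (p - 1) * (τ.sg * m ^ p) - p * m ^ (p - 1) * τ.ff := by
  induction τ generalizing m with
  | leaf s v f g =>
    obtain ⟨a, b, c, d⟩ := hτ
    simp only [St, EF, sg, ff]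
    split_ifs with hh
    · have := young_b hp hΛ hΛp a hm c hh.2
      have : 0 ≤ (p - 1) * (s * m ^ p) := mul_nonneg (by linarith) (by positivity)
      linarith
    · have := young_a hp a hm c
      linarith
  | node μ l r hl hr =>
    obtain ⟨a, b, c, d⟩ := hτ.all
    have hx : 0 ≤ (node μ l r).ff / (node μ l r).sg := by positivity
    have hl' := hl hτ.2.1 hx
    have hr' := hr hτ.2.2 hx
    have hl'' := hl hτ.2.1 hm
    have hr'' := hr hτ.2.2 hm
    have e1 : (node μ l r).aa p = _ := en_eq2 hp a c
    have e2 : (node μ l r).aa p = _ := en_eq1 a c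
    have e3 : (node μ l r).ff = l.ff + r.ff := rfl
    have e4 : (node μ l r).sg = l.sg + r.sg := rfl
    have e5 : (node μ l r).EF p = l.EF p + r.EF p := rfl
    simp only [St]
    split_ifs with hh
    · have hb := young_b hp hΛ hΛp a hm c hh.2
      have : 0 ≤ (p - 1) * ((node μ l r).sg * m ^ p) := mul_nonneg (by linarith) (by positivity)
      set X := (node μ l r).ff / (node μ l r).sg
      have e7 : p * X ^ (p - 1) * l.ff + p * X ^ (p - 1) * r.ff = p * (node μ l r).aa p := by
        rw [e1, e3]; ring
      have e8 : (p - 1) * (l.sg * X ^ p) + (p - 1) * (r.sg * X ^ p) = (p - 1) * (node μ l r).aa p := by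
        rw [e2, e4]; ring
      have : en p (node μ l r).sg (node μ l r).ff = (node μ l r).aa p := rfl
      linarith
    · rw [e3, e4, e5]
      linarith

lemma St_root {p Λ : ℝ} (hp : 1 < p) (hΛ : 1 ≤ Λ) (hΛp : 2 * p ≤ Λ ^ (p - 1)) {h : BT → Prop}
    {τ : BT} (hτ : τ.Pos) : τ.St p Λ h 0 ≤ 2 * τ.EF p := by
  have := St_bound (h := h) hp hΛ hΛp hτ le_rfl
  rw [Real.zero_rpow (by linarith), Real.zero_rpow (by linarith)] at this
  linarith

lemma Jm_bound {p Λ : ℝ} (hp : 1 < p) (hΛ : 1 ≤ Λ) (hΛp : 2 * p ≤ Λ ^ (p - 1))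
    {τ : BT} (hτ : τ.Pos) : τ.Jm p Λ ≤ 2 * (τ.EF p - τ.aa p) := by
  induction τ with
  | leaf s v f g => simp [Jm, EF, aa, sg, ff]
  | node μ l r hl hr =>
    have h1 := hl hτ.2.1
    have h2 := hr hτ.2.2
    have e5 : (node μ l r).EF p = l.EF p + r.EF p := rfl
    have h3 := aa_node hp hτ
    simp only [Jm]
    rw [e5]
    split_ifs with hh
    · obtain ⟨a, b, c, d⟩ := hτ.all
      obtain ⟨al, bl, cl, dl⟩ := hτ.2.1.all
      obtain ⟨ar, br, cr, dr⟩ := hτ.2.2.all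
      have hx : 0 ≤ (node μ l r).ff / (node μ l r).sg := by positivity
      have e1 : (node μ l r).aa p = _ := en_eq2 hp a c
      have e2 : (node μ l r).aa p = _ := en_eq1 a c
      have e3 : (node μ l r).ff = l.ff + r.ff := rfl
      have e4 : (node μ l r).sg = l.sg + r.sg := rfl
      have hlt : Λ * ((node μ l r).ff / (node μ l r).sg) * l.sg < l.ff := by
        have : Λ * ((node μ l r).ff / (node μ l r).sg) * l.sg =
          (Λ * (node μ l r).ff * l.sg) / (node μ l r).sg := by ring
        rw [this, div_lt_iff₀ a]; exact hh
      have hb := young_b hp hΛ hΛp al hx cl hlt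
      have ha := young_a hp ar hx cr
      set X := (node μ l r).ff / (node μ l r).sg
      have e7 : p * X ^ (p - 1) * l.ff + p * X ^ (p - 1) * r.ff = p * (node μ l r).aa p := by
        rw [e1, e3]; ring
      have e8 : (p - 1) * (l.sg * X ^ p) + (p - 1) * (r.sg * X ^ p) = (p - 1) * (node μ l r).aa p := by
        rw [e2, e4]; ring
      have e9 : 0 ≤ (p - 1) * (l.sg * X ^ p) := mul_nonneg (by linarith) (by positivity)
      unfold aa at *
      linarith
    · linarith

lemma J_ge {q : ℝ} (hq : 1 < q) {τ : BT} (hτ : τ.Pos) {t : ℝ} (ht : 0 ≤ t) :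
    t ^ q * τ.vv + τ.Vs q ≤ τ.J q t := by
  induction τ generalizing t with
  | leaf s v f g => simp [J, vv, Vs]
  | node μ l r hl hr =>
    have hμ := hτ.1
    obtain ⟨al, bl, cl, dl⟩ := hτ.2.1.all
    obtain ⟨ar, br, cr, dr⟩ := hτ.2.2.all
    have h1 := hl hτ.2.1 ht
    have hms : 0 ≤ μ * l.sg := by positivity
    have h2 := hr hτ.2.2 (add_nonneg ht hms)
    simp only [J, vv, Vs]
    have h3 : t ^ q + (μ * l.sg) ^ q ≤ (t + μ * l.sg) ^ q := by
      have := NNReal.add_rpow_le_rpow_add ⟨t, ht⟩ ⟨_, hms⟩ hq.le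
      exact_mod_cast this
    rw [Real.mul_rpow hμ al.le] at h3
    have h4 := mul_le_mul_of_nonneg_right h3 br.le
    linarith

lemma Vs_nonneg {q : ℝ} {τ : BT} (hτ : τ.Pos) : 0 ≤ τ.Vs q := by
  induction τ with
  | leaf s v f g => simp [Vs]
  | node μ l r hl hr =>
    have hμ := hτ.1
    obtain ⟨al, bl, cl, dl⟩ := hτ.2.1.all
    obtain ⟨ar, br, cr, dr⟩ := hτ.2.2.all
    have := hl hτ.2.1
    have := hr hτ.2.2
    simp only [Vs]; positivity

lemma stop_est {p q T : ℝ} (hp : 1 < p) (hpq : p ≤ q) (hT : 0 < T) {s f X : ℝ} (hs : 0 < s)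
    (hf : 0 ≤ f) (h1 : en p s f ≤ 1) (hX : X ≤ T ^ q * s ^ (q / p)) :
    (f / s) ^ q * X ≤ T ^ q * en p s f := by
  have h0 : 0 ≤ (f / s) ^ q := by positivity
  have h2 := mul_le_mul_of_nonneg_left hX h0
  have h3 : (f / s) ^ q * (T ^ q * s ^ (q / p)) = T ^ q * en p s f ^ (q / p) := by
    rw [← en_pow hp hs hf]; ring
  rw [h3] at h2
  refine h2.trans (mul_le_mul_of_nonneg_left ?_ (by positivity))
  have : 1 ≤ q / p := by rw [le_div_iff₀ (by linarith)]; linarith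
  calc en p s f ^ (q / p) ≤ en p s f ^ (1 : ℝ) :=
        Real.rpow_le_rpow_of_exponent_ge_of_imp (en_nonneg hs hf) h1 this (by
          intro _ h; exfalso; linarith)
    _ = _ := Real.rpow_one _

end BT

namespace BT
open scoped Classical

lemma Z_bound {p q Q T Λ : ℝ} (hp : 1 < p) (hpq : p ≤ q) (hc : Real.HolderConjugate q Q)
    (hT : 0 < T) (hΛ : 1 ≤ Λ) {τ : BT} (hτ : τ.Pos) (hTest : τ.Test p q T) (hE : τ.EF p ≤ 1)
    {m t : ℝ} (hm : 0 ≤ m) (ht : 0 ≤ t) :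
    m * t * τ.gg + τ.Z p Q Λ / Λ ^ 2 ≤
      T ^ (1 - q) * (m ^ q * τ.J q t) + T * (τ.EG Q + 2 * τ.St p Λ (heavy p Q) m) := by
  have hq1 := hc.lt
  induction τ generalizing m t with
  | leaf s v f g =>
    have h1 := young_x hc (mul_nonneg hm ht) hτ.2.2.2 hτ.2.1 hT
    rw [Real.mul_rpow hm ht] at h1
    have h2 := mul_nonneg hT.le (St_nonneg (p := p) (Λ := Λ) (h := heavy p Q) hτ m)
    have : (leaf s v f g).Z p Q Λ = 0 := rfl
    rw [this, zero_div]
    simp only [gg, J, EG]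
    linarith
  | node μ l r hl hr =>
    have hμ := hτ.1
    obtain ⟨a, b, c, d⟩ := hτ.all
    obtain ⟨al, bl, cl, dl⟩ := hτ.2.1.all
    obtain ⟨ar, br, cr, dr⟩ := hτ.2.2.all
    have hEl := EF_nonneg (p := p) hτ.2.1
    have hEr := EF_nonneg (p := p) hτ.2.2
    have e5 : (node μ l r).EF p = l.EF p + r.EF p := rfl
    have hl' := @hl hτ.2.1 hTest.2.2.1 (by linarith)
    have hr' := @hr hτ.2.2 hTest.2.2.2 (by linarith)
    -- general step
    have step : ∀ {M u : ℝ}, 0 ≤ M → 0 ≤ u → (heavy p Q (node μ l r) →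
        (node μ l r).ff ≤ Λ * M * (node μ l r).sg) →
        M * u * (node μ l r).gg + (node μ l r).Z p Q Λ / Λ ^ 2 ≤
        T ^ (1 - q) * (M ^ q * (node μ l r).J q u) + T * ((node μ l r).EG Q +
          2 * (l.St p Λ (heavy p Q) M + r.St p Λ (heavy p Q) M)) := by
      intro M u hM hu hh
      have h1 := hl' hM hu
      have h2 := hr' hM (add_nonneg hu (mul_nonneg hμ al.le))
      have h3 : (if heavy p Q (node μ l r) ∧ l.ff * (node μ l r).sg ≤ Λ * (node μ l r).ff * l.sg
          then μ * l.ff * r.gg else 0) / Λ ^ 2 ≤ M * (μ * l.sg) * r.gg := by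
        rw [div_le_iff₀ (by positivity)]
        split_ifs with h4
        · have h5 := hh h4.1
          have h6 : l.ff * (node μ l r).sg ≤ Λ * (Λ * M * (node μ l r).sg) * l.sg :=
            h4.2.trans (by gcongr)
          have h7 : l.ff ≤ Λ ^ 2 * M * l.sg := by
            refine le_of_mul_le_mul_right ?_ a
            linarith
          have := mul_le_mul_of_nonneg_right (mul_le_mul_of_nonneg_left h7 hμ) dr
          linarith
        · positivity
      have e1 : (node μ l r).gg = l.gg + r.gg := rfl
      have e2 : (node μ l r).J q u = l.J q u + r.J q (u + μ * l.sg) := rfl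
      have e3 : (node μ l r).EG Q = l.EG Q + r.EG Q := rfl
      have e4 : (node μ l r).Z p Q Λ = (if heavy p Q (node μ l r) ∧
        l.ff * (node μ l r).sg ≤ Λ * (node μ l r).ff * l.sg
          then μ * l.ff * r.gg else 0) + (l.Z p Q Λ + r.Z p Q Λ) := rfl
      rw [e1, e2, e3, e4, add_div, add_div]
      linarith
    simp only [St]
    split_ifs with hh
    · set N := node μ l r with hN
      have hX : 0 ≤ N.ff / N.sg := by positivity
      have h1 := step hX le_rfl (by
        intro _
        have : N.ff = 1 * (N.ff / N.sg) * N.sg := by field_simp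
        rw [this]
        have : 1 * (N.ff / N.sg) * N.sg / N.sg = N.ff / N.sg := by field_simp
        rw [this]
        gcongr)
      have h2 := stop_est hp hpq hT a c ((aa_le_EF hp hτ).trans hE) hTest.1
      have h2' : T ^ (1 - q) * ((N.ff / N.sg) ^ q * N.J q 0) ≤ T * N.aa p := by
        have := mul_le_mul_of_nonneg_left h2 (Real.rpow_nonneg hT.le (1 - q))
        refine this.trans (le_of_eq ?_)
        rw [← mul_assoc, ← Real.rpow_add hT]; simp [aa]
      have h3 := young_x hc (mul_nonneg hm ht) d b hT
      rw [Real.mul_rpow hm ht] at h3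
      have h4 : T * en Q N.vv N.gg ≤ T * N.aa p := mul_le_mul_of_nonneg_left hh.1 hT.le
      have h5 := J_ge hq1 hτ ht
      have h6 := Vs_nonneg (q := q) hτ
      have h7 : T ^ (1 - q) * (m ^ q * (t ^ q * N.vv)) ≤ T ^ (1 - q) * (m ^ q * N.J q t) := by
        gcongr; linarith
      simp only [mul_zero, zero_mul] at h1
      have h8 : T ^ (1 - q) * (m ^ q * t ^ q * N.vv) = T ^ (1 - q) * (m ^ q * (t ^ q * N.vv)) := by ring
      linarith
    · refine step hm ht ?_
      intro hhv
      by_contra hcon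
      exact hh ⟨hhv, not_le.mp hcon⟩

lemma Em_bound {p q T Λ : ℝ} (hp : 1 < p) (hpq : p ≤ q)
    (hT : 0 < T) (hΛ : 1 ≤ Λ) {τ : BT} (hτ : τ.Pos) (hTest : τ.Test p q T) (hE : τ.EF p ≤ 1)
    {m : ℝ} (hm : 0 ≤ m) :
    τ.Em q ≤ (Λ * m) ^ q * τ.Vs q + (Λ ^ q + 1) * T ^ q * τ.St p Λ (fun _ => True) m ∧
    (Λ * m * τ.sg < τ.ff → τ.Em q + T ^ q * τ.aa p ≤
      (Λ * m) ^ q * τ.Vs q + (Λ ^ q + 1) * T ^ q * τ.St p Λ (fun _ => True) m) := by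
  have hq1 : 1 < q := by linarith
  have hΛ0 : 0 < Λ := by linarith
  induction τ generalizing m with
  | leaf s v f g =>
    have h0 := St_nonneg (p := p) (Λ := Λ) (h := fun _ => True) hτ m
    simp only [Em, Vs]
    refine ⟨by positivity, fun h => ?_⟩
    have h1 : (leaf s v f g).St p Λ (fun _ => True) m = (leaf s v f g).aa p := by
      simp only [St, sg, ff, true_and, aa] at *
      rw [if_pos h]
    rw [h1]
    have := aa_nonneg (p := p) hτ
    have : 0 ≤ Λ ^ q * T ^ q * (leaf s v f g).aa p := by positivity
    linarith
  | node μ l r hl hr =>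
    have hμ := hτ.1
    obtain ⟨a, b, c, d⟩ := hτ.all
    obtain ⟨al, bl, cl, dl⟩ := hτ.2.1.all
    obtain ⟨ar, br, cr, dr⟩ := hτ.2.2.all
    have hEl := EF_nonneg (p := p) hτ.2.1
    have hEr := EF_nonneg (p := p) hτ.2.2
    have e5 : (node μ l r).EF p = l.EF p + r.EF p := rfl
    have hl' := @hl hτ.2.1 hTest.2.2.1 (by linarith)
    have hr' := @hr hτ.2.2 hTest.2.2.2 (by linarith)
    have step : ∀ {M : ℝ}, 0 ≤ M → (node μ l r).Em q ≤ (Λ * M) ^ q * (node μ l r).Vs q +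
        (Λ ^ q + 1) * T ^ q * (l.St p Λ (fun _ => True) M + r.St p Λ (fun _ => True) M) := by
      intro M hM
      obtain ⟨h1, h1'⟩ := hl' hM
      obtain ⟨h2, -⟩ := hr' hM
      simp only [Em, Vs]
      by_cases hs : Λ * M * l.sg < l.ff
      · have h3 := h1' hs
        have h4 := stop_est hp hpq hT al cl ((aa_le_EF hp hτ.2.1).trans (by linarith)) hTest.2.1
        have e : (l.ff / l.sg) ^ q * (μ ^ q * r.vv * l.sg ^ q) = μ ^ q * r.vv * l.ff ^ q := by
          rw [Real.div_rpow cl al.le]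
          have := (Real.rpow_pos_of_pos al q).ne'
          field_simp
        rw [e] at h4
        have : 0 ≤ (Λ * M) ^ q * (μ ^ q * r.vv * l.sg ^ q) := by positivity
        unfold aa at *
        linarith
      · have h3 : l.ff ^ q ≤ (Λ * M * l.sg) ^ q :=
          Real.rpow_le_rpow cl (not_lt.mp hs) (by linarith)
        rw [Real.mul_rpow (by positivity) al.le] at h3
        have h4 := mul_le_mul_of_nonneg_left h3 (by positivity : 0 ≤ μ ^ q * r.vv)
        linarith
    by_cases hs : Λ * m * (node μ l r).sg < (node μ l r).ff
    · have hX : 0 ≤ (node μ l r).ff / (node μ l r).sg := by positivity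
      have h1 := step hX
      have e1 : (node μ l r).St p Λ (fun _ => True) m = (node μ l r).aa p +
        (l.St p Λ (fun _ => True) ((node μ l r).ff / (node μ l r).sg) +
          r.St p Λ (fun _ => True) ((node μ l r).ff / (node μ l r).sg)) := by
        simp only [St, true_and]; rw [if_pos hs]
      rw [e1]
      have h2 := stop_est hp hpq hT a c ((aa_le_EF hp hτ).trans hE) hTest.1
      have h3 := J_ge hq1 hτ le_rfl
      rw [Real.zero_rpow (by linarith), zero_mul, zero_add] at h3
      have h4 : (Λ * ((node μ l r).ff / (node μ l r).sg)) ^ q * (node μ l r).Vs q ≤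
          Λ ^ q * (T ^ q * (node μ l r).aa p) := by
        rw [Real.mul_rpow hΛ0.le hX, mul_assoc]
        refine mul_le_mul_of_nonneg_left (le_trans ?_ h2) (by positivity)
        gcongr
      have h5 : 0 ≤ (Λ * m) ^ q * (node μ l r).Vs q :=
        mul_nonneg (by positivity) (Vs_nonneg hτ)
      have h6 : 0 ≤ T ^ q * (node μ l r).aa p := mul_nonneg (by positivity) (aa_nonneg hτ)
      have key : (node μ l r).Em q + T ^ q * (node μ l r).aa p ≤ (Λ * m) ^ q * (node μ l r).Vs q +
        (Λ ^ q + 1) * T ^ q * ((node μ l r).aa p +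
        (l.St p Λ (fun _ => True) ((node μ l r).ff / (node μ l r).sg) +
          r.St p Λ (fun _ => True) ((node μ l r).ff / (node μ l r).sg))) := by
        linarith
      exact ⟨by linarith, fun _ => key⟩
    · have e1 : (node μ l r).St p Λ (fun _ => True) m = 
        (l.St p Λ (fun _ => True) m + r.St p Λ (fun _ => True) m) := by
        simp only [St, true_and]; rw [if_neg hs]
      rw [e1]
      exact ⟨step hm, fun h => absurd h hs⟩

lemma JumpR_bound {q Q T Λ : ℝ} (hc : Real.HolderConjugate q Q) (hT : 0 < T) {τ : BT} (hτ : τ.Pos) :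
    τ.JumpR Λ ≤ T * τ.mir.Jm Q Λ + T ^ (1 - q) * τ.Em q := by
  induction τ with
  | leaf s v f g => simp [JumpR, BT.mir, Jm, Em]
  | node μ l r hl hr =>
    have hμ := hτ.1
    obtain ⟨al, bl, cl, dl⟩ := hτ.2.1.all
    obtain ⟨ar, br, cr, dr⟩ := hτ.2.2.all
    have h1 := hl hτ.2.1
    have h2 := hr hτ.2.2
    have h3 := young_x hc (mul_nonneg hμ cl) dr br hT
    rw [Real.mul_rpow hμ cl] at h3
    have e : (node μ l r).mir.Jm Q Λ = (if Λ * (node μ l r).gg * r.vv < r.gg * (node μ l r).vv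
      then en Q r.vv r.gg else 0) + (r.mir.Jm Q Λ + l.mir.Jm Q Λ) := by
      simp only [BT.mir, Jm, aa, mir_sg, mir_ff]
      have e1 : (node μ r.mir l.mir).ff = (node μ l r).gg := mir_ff (node μ l r)
      have e2 : (node μ r.mir l.mir).sg = (node μ l r).vv := mir_sg (node μ l r)
      rw [e1, e2]
    rw [e]
    simp only [JumpR, Em]
    have h4 : 0 ≤ T ^ (1 - q) * (μ ^ q * r.vv * l.ff ^ q) := by positivity
    split_ifs with hh <;> linarith

lemma B_split {p Q Λ : ℝ} {τ : BT} (hτ : τ.Pos) :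
    τ.B ≤ (τ.Z p Q Λ + τ.JumpR Λ) + (τ.mir.Z Q p Λ + τ.mir.JumpR Λ) := by
  induction τ with
  | leaf s v f g => simp [B, JumpR, BT.mir, Z]
  | node μ l r hl hr =>
    have hμ := hτ.1
    obtain ⟨al, bl, cl, dl⟩ := hτ.2.1.all
    obtain ⟨ar, br, cr, dr⟩ := hτ.2.2.all
    have h1 := hl hτ.2.1
    have h2 := hr hτ.2.2
    have hx : 0 ≤ μ * l.ff * r.gg := by positivity
    have ef : (node μ r.mir l.mir).ff = (node μ l r).gg := mir_ff (node μ l r)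
    have es : (node μ r.mir l.mir).sg = (node μ l r).vv := mir_sg (node μ l r)
    have eg : (node μ r.mir l.mir).gg = (node μ l r).ff := mir_gg (node μ l r)
    have ev : (node μ r.mir l.mir).vv = (node μ l r).sg := mir_vv (node μ l r)
    have e1 : (node μ l r).mir.Z Q p Λ = (if en p (node μ l r).sg (node μ l r).ff ≤
        en Q (node μ l r).vv (node μ l r).gg ∧
        r.gg * (node μ l r).vv ≤ Λ * (node μ l r).gg * r.vv then μ * l.ff * r.gg else 0) +
        (r.mir.Z Q p Λ + l.mir.Z Q p Λ) := by
      simp only [BT.mir, Z, heavy, mir_sg, mir_ff, mir_gg, ef, es, eg, ev]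
      congr 2; ring
    have e2 : (node μ l r).mir.JumpR Λ = (if Λ * (node μ l r).ff * l.sg < l.ff * (node μ l r).sg
        then μ * l.ff * r.gg else 0) + (r.mir.JumpR Λ + l.mir.JumpR Λ) := by
      simp only [BT.mir, JumpR, mir_vv, mir_ff, mir_gg, eg, ev]
      congr 2; ring
    rw [e1, e2]
    simp only [B, Z, JumpR]
    have key : μ * l.ff * r.gg ≤ (if heavy p Q (node μ l r) ∧ l.ff * (node μ l r).sg ≤ Λ * (node μ l r).ff * l.sg
        then μ * l.ff * r.gg else 0) + (if Λ * (node μ l r).gg * r.vv < r.gg * (node μ l r).vv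
        then μ * l.ff * r.gg else 0) + (if en p (node μ l r).sg (node μ l r).ff ≤
        en Q (node μ l r).vv (node μ l r).gg ∧
        r.gg * (node μ l r).vv ≤ Λ * (node μ l r).gg * r.vv then μ * l.ff * r.gg else 0) +
        (if Λ * (node μ l r).ff * l.sg < l.ff * (node μ l r).sg
        then μ * l.ff * r.gg else 0) := by
      rcases le_total (en Q (node μ l r).vv (node μ l r).gg) (en p (node μ l r).sg (node μ l r).ff)
        with h | h
      · rcases le_or_gt (l.ff * (node μ l r).sg) (Λ * (node μ l r).ff * l.sg) with h' | h'
        · rw [if_pos (⟨h, h'⟩ : heavy p Q (node μ l r) ∧ _)]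
          split_ifs <;> linarith
        · rw [if_pos h']
          split_ifs <;> linarith
      · rcases le_or_gt (r.gg * (node μ l r).vv) (Λ * (node μ l r).gg * r.vv) with h' | h'
        · rw [if_pos (⟨h, h'⟩ : en p (node μ l r).sg (node μ l r).ff ≤
            en Q (node μ l r).vv (node μ l r).gg ∧ _)]
          split_ifs <;> linarith
        · rw [if_pos h']
          split_ifs <;> linarith
    linarith

lemma half_bound {p q Q T Λ : ℝ} (hp : 1 < p) (hpq : p ≤ q) (hc : Real.HolderConjugate q Q)
    (hT : 0 < T) (hΛ : 1 ≤ Λ) (hΛp : 2 * p ≤ Λ ^ (p - 1)) (hΛQ : 2 * Q ≤ Λ ^ (Q - 1))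
    {τ : BT} (hτ : τ.Pos) (hTest : τ.Test p q T)
    (hE : τ.EF p ≤ 1) (hG : τ.EG Q ≤ 1) :
    τ.Z p Q Λ + τ.JumpR Λ ≤ (5 * Λ ^ 2 + 2 * Λ ^ q + 4) * T := by
  have hq1 := hc.lt
  have h1 := Z_bound hp hpq hc hT hΛ hτ hTest hE le_rfl le_rfl
  have h2 := St_root (h := heavy p Q) hp hΛ hΛp hτ
  have h3 := (Em_bound hp hpq hT hΛ hτ hTest hE le_rfl).1
  have h4 := St_root (h := fun _ => True) hp hΛ hΛp hτ
  have h5 := JumpR_bound (Λ := Λ) hc hT hτ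
  have h6 := Jm_bound hc.symm.lt hΛ hΛQ hτ.mir
  rw [mir_EF] at h6
  have h7 := aa_nonneg (p := Q) hτ.mir
  simp only [mul_zero, zero_mul, Real.zero_rpow (by linarith : q ≠ 0), zero_add] at h1 h3
  rw [div_le_iff₀ (by positivity)] at h1
  have h8 : T * (τ.EG Q + 2 * τ.St p Λ (heavy p Q) 0) ≤ T * 5 := by
    gcongr; linarith
  have h9 := mul_le_mul_of_nonneg_right h8 (by positivity : 0 ≤ Λ ^ 2)
  have h10 : T * τ.mir.Jm Q Λ ≤ T * 2 := by gcongr; linarith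
  have h11 : T ^ (1 - q) * τ.Em q ≤ T ^ (1 - q) * ((Λ ^ q + 1) * T ^ q * 2) := by
    gcongr
    refine h3.trans ?_
    gcongr; linarith
  have h12 : T ^ (1 - q) * ((Λ ^ q + 1) * T ^ q * 2) = (Λ ^ q + 1) * 2 * T := by
    have : T ^ (1 - q) * T ^ q = T := by rw [← Real.rpow_add hT]; simp
    calc _ = (Λ ^ q + 1) * 2 * (T ^ (1 - q) * T ^ q) := by ring
      _ = _ := by rw [this]
  linarith

def sc (a b : ℝ) : BT → BT
  | leaf s v f g => leaf s v (a * f) (b * g)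
  | node m l r => node m (l.sc a b) (r.sc a b)

def tag (q : ℝ) : BT → ℝ → BT
  | leaf s v f _, t => leaf s v f (v * t ^ (q - 1))
  | node m l r, t => node m (l.tag q t) (r.tag q (t + m * l.ff))

lemma sg_skel (τ : BT) : τ.skel.sg = τ.sg := by
  induction τ with
  | leaf s v f g => rfl
  | node m l r hl hr => simp only [skel, sg, hl, hr]
lemma vv_skel (τ : BT) : τ.skel.vv = τ.vv := by
  induction τ with
  | leaf s v f g => rfl
  | node m l r hl hr => simp only [skel, vv, hl, hr]
lemma J_skel (q : ℝ) (τ : BT) (t : ℝ) : τ.skel.J q t = τ.J q t := by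
  induction τ generalizing t with
  | leaf s v f g => rfl
  | node m l r hl hr => simp only [skel, J, hl, hr, sg_skel]
lemma Test_skel (p q T : ℝ) (τ : BT) : τ.skel.Test p q T ↔ τ.Test p q T := by
  induction τ with
  | leaf s v f g => rfl
  | node m l r hl hr =>
    have h1 := J_skel q (node m l r) 0
    have h2 := sg_skel (node m l r)
    simp only [skel] at h1 h2
    simp only [skel, Test, hl, hr, sg_skel, vv_skel, h1, h2]
lemma mir_skel (τ : BT) : τ.mir.skel = τ.skel.mir := by
  induction τ with
  | leaf s v f g => rfl
  | node m l r hl hr => simp only [skel, BT.mir, hl, hr]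
lemma tag_skel (q : ℝ) (τ : BT) (t : ℝ) : (τ.tag q t).skel = τ.skel := by
  induction τ generalizing t with
  | leaf s v f g => rfl
  | node m l r hl hr => simp only [skel, tag, hl, hr]
lemma sc_skel (a b : ℝ) (τ : BT) : (τ.sc a b).skel = τ.skel := by
  induction τ with
  | leaf s v f g => rfl
  | node m l r hl hr => simp only [skel, sc, hl, hr]

lemma tag_ff (q : ℝ) (τ : BT) (t : ℝ) : (τ.tag q t).ff = τ.ff := by
  induction τ generalizing t with
  | leaf s v f g => rfl
  | node m l r hl hr => simp only [ff, tag, hl, hr]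
lemma tag_EF (p q : ℝ) (τ : BT) (t : ℝ) : (τ.tag q t).EF p = τ.EF p := by
  induction τ generalizing t with
  | leaf s v f g => rfl
  | node m l r hl hr => simp only [EF, tag, hl, hr]
lemma tag_pos (q : ℝ) {τ : BT} (hτ : τ.Pos) {t : ℝ} (ht : 0 ≤ t) : (τ.tag q t).Pos := by
  induction τ generalizing t with
  | leaf s v f g => exact ⟨hτ.1, hτ.2.1, hτ.2.2.1, mul_nonneg hτ.2.1.le (by positivity)⟩
  | node m l r hl hr =>
    exact ⟨hτ.1, hl hτ.2.1 ht, hr hτ.2.2 (add_nonneg ht (mul_nonneg hτ.1 hτ.2.1.all.2.2.1))⟩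
lemma sc_pos {a b : ℝ} (ha : 0 ≤ a) (hb : 0 ≤ b) {τ : BT} (hτ : τ.Pos) : (τ.sc a b).Pos := by
  induction τ with
  | leaf s v f g => exact ⟨hτ.1, hτ.2.1, mul_nonneg ha hτ.2.2.1, mul_nonneg hb hτ.2.2.2⟩
  | node m l r hl hr => exact ⟨hτ.1, hl hτ.2.1, hr hτ.2.2⟩
lemma sc_ff (a b : ℝ) (τ : BT) : (τ.sc a b).ff = a * τ.ff := by
  induction τ with
  | leaf s v f g => rfl
  | node m l r hl hr => simp only [sc, ff, hl, hr]; ring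
lemma sc_gg (a b : ℝ) (τ : BT) : (τ.sc a b).gg = b * τ.gg := by
  induction τ with
  | leaf s v f g => rfl
  | node m l r hl hr => simp only [sc, gg, hl, hr]; ring
lemma sc_B (a b : ℝ) (τ : BT) : (τ.sc a b).B = a * b * τ.B := by
  induction τ with
  | leaf s v f g => simp [sc, B]
  | node m l r hl hr => simp only [sc, B, hl, hr, sc_ff, sc_gg]; ring
lemma sc_EF (p : ℝ) {a b : ℝ} (ha : 0 ≤ a) {τ : BT} (hτ : τ.Pos) : (τ.sc a b).EF p = a ^ p * τ.EF p := by
  induction τ with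
  | leaf s v f g => simp only [sc, EF, en]; rw [Real.mul_rpow ha hτ.2.2.1]; ring
  | node m l r hl hr => simp only [sc, EF, hl hτ.2.1, hr hτ.2.2]; ring
lemma sc_EG (p : ℝ) {a b : ℝ} (hb : 0 ≤ b) {τ : BT} (hτ : τ.Pos) : (τ.sc a b).EG p = b ^ p * τ.EG p := by
  induction τ with
  | leaf s v f g => simp only [sc, EG, en]; rw [Real.mul_rpow hb hτ.2.2.2]; ring
  | node m l r hl hr => simp only [sc, EG, hl hτ.2.1, hr hτ.2.2]; ring

lemma tag_B {q : ℝ} (hq : 1 < q) {τ : BT} (hτ : τ.Pos) {t : ℝ} (ht : 0 ≤ t) :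
    (τ.tag q t).B + t * (τ.tag q t).gg = τ.Jf q t := by
  induction τ generalizing t with
  | leaf s v f g =>
    simp only [tag, B, gg, Jf]
    rcases ht.eq_or_lt with rfl | h
    · simp [Real.zero_rpow (by linarith : q ≠ 0)]
    · rw [Real.rpow_sub_one h.ne']; field_simp; simp
  | node m l r hl hr =>
    have h1 := hl hτ.2.1 ht
    have h2 := hr hτ.2.2 (add_nonneg ht (mul_nonneg hτ.1 hτ.2.1.all.2.2.1))
    simp only [tag, B, gg, Jf, tag_ff]
    rw [← h1, ← h2]; ring

lemma tag_EG {q Q : ℝ} (hc : Real.HolderConjugate q Q) {τ : BT} (hτ : τ.Pos) {t : ℝ} (ht : 0 ≤ t) :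
    (τ.tag q t).EG Q = τ.Jf q t := by
  induction τ generalizing t with
  | leaf s v f g =>
    simp only [tag, EG, Jf, en]
    rw [Real.mul_rpow hτ.2.1.le (by positivity), ← Real.rpow_mul ht]
    have : (q - 1) * Q = q := hc.sub_one_mul_conj
    rw [this, Real.rpow_sub hτ.2.1, Real.rpow_one]
    have := (Real.rpow_pos_of_pos hτ.2.1 Q).ne'
    field_simp
  | node m l r hl hr =>
    have h1 := hl hτ.2.1 ht
    have h2 := hr hτ.2.2 (add_nonneg ht (mul_nonneg hτ.1 hτ.2.1.all.2.2.1))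
    simp only [tag, EG, Jf, h1, h2]

/-- Main tree theorem. -/
theorem main {p q P Q : ℝ} (hcp : Real.HolderConjugate p P) (hcq : Real.HolderConjugate q Q)
    (hpq : p ≤ q) : ∃ C : ℝ, 0 < C ∧ ∀ (T : ℝ) (τ : BT) (E : ℝ), 0 < T → τ.Pos → τ.Test p q T →
      τ.mir.Test Q P T → 0 < E → τ.EF p ≤ E → τ.Jf q 0 ≤ (C * T) ^ q * E ^ (q / p) := by
  have hp1 := hcp.lt
  have hq1 := hcq.lt
  have hP1 := hcp.symm.lt
  have hQ1 := hcq.symm.lt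
  have hQP : Q ≤ P := by
    have h1 := hcp.inv_add_inv_eq_one
    have h2 := hcq.inv_add_inv_eq_one
    have h3 : q⁻¹ ≤ p⁻¹ := inv_anti₀ (by linarith) hpq
    have h4 : P⁻¹ ≤ Q⁻¹ := by linarith
    exact (inv_le_inv₀ (by linarith) (by linarith)).mp h4
  obtain ⟨Λ, hΛ, hΛp, hΛQ⟩ : ∃ Λ : ℝ, 1 ≤ Λ ∧ 2 * p ≤ Λ ^ (p - 1) ∧ 2 * Q ≤ Λ ^ (Q - 1) := by
    have h1 := tendsto_rpow_atTop (show 0 < p - 1 by linarith)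
    have h2 := tendsto_rpow_atTop (show 0 < Q - 1 by linarith)
    obtain ⟨x, hx⟩ := ((eventually_ge_atTop 1).and ((h1.eventually_ge_atTop (2 * p)).and
      (h2.eventually_ge_atTop (2 * Q)))).exists
    exact ⟨x, hx⟩
  have hΛ0 : 0 < Λ := by linarith
  refine ⟨(5 * Λ ^ 2 + 2 * Λ ^ q + 4) + (5 * Λ ^ 2 + 2 * Λ ^ P + 4), by positivity, ?_⟩
  set C := (5 * Λ ^ 2 + 2 * Λ ^ q + 4) + (5 * Λ ^ 2 + 2 * Λ ^ P + 4) with hC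
  have hC0 : 0 < C := by positivity
  intro T τ E hT hτ h1 h2 hE hEF
  rcases le_or_gt (τ.Jf q 0) 0 with hJ | hJ
  · exact hJ.trans (by positivity)
  set X := τ.Jf q 0 with hX
  set a := E ^ (-(1 / p)) with ha
  set b := X ^ (-(1 / Q)) with hb
  have ha0 : 0 < a := by positivity
  have hb0 : 0 < b := by positivity
  set ρ := (τ.tag q 0).sc a b with hρ
  have htp := tag_pos q hτ le_rfl
  have hρp : ρ.Pos := sc_pos ha0.le hb0.le htp
  have hsk : ρ.skel = τ.skel := by rw [hρ, sc_skel, tag_skel]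
  have hT1 : ρ.Test p q T := by rw [← Test_skel, hsk, Test_skel]; exact h1
  have hT2 : ρ.mir.Test Q P T := by
    rw [← Test_skel, mir_skel, hsk, ← mir_skel, Test_skel]; exact h2
  have hF : ρ.EF p ≤ 1 := by
    rw [hρ, sc_EF p ha0.le htp, tag_EF, ha, ← Real.rpow_mul hE.le]
    have : -(1 / p) * p = -1 := by field_simp
    rw [this, Real.rpow_neg_one, inv_mul_le_iff₀ hE, mul_one]; exact hEF
  have hG : ρ.EG Q ≤ 1 := by
    rw [hρ, sc_EG Q hb0.le htp, tag_EG hcq hτ le_rfl, hb, ← Real.rpow_mul hJ.le]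
    have : -(1 / Q) * Q = -1 := by field_simp
    rw [this, Real.rpow_neg_one, inv_mul_cancel₀ hJ.ne']
  have hB : ρ.B = a * b * X := by
    have := tag_B hq1 hτ le_rfl
    rw [zero_mul, add_zero] at this
    rw [hρ, sc_B, this]
  have k1 := half_bound hp1 hpq hcq hT hΛ hΛp hΛQ hρp hT1 hF hG
  have k2 := half_bound hQ1 hQP hcp.symm hT hΛ hΛQ hΛp hρp.mir hT2 (by rw [mir_EF]; exact hG)
    (by rw [mir_EG]; exact hF)
  have k3 := B_split (p := p) (Q := Q) (Λ := Λ) hρp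
  have k4 : a * b * X ≤ C * T := by rw [← hB, hC]; linarith
  have k5 : b * X = X ^ (1 / q) := by
    have : b * X = X ^ (-(1 / Q) + 1) := by rw [Real.rpow_add hJ, Real.rpow_one]
    rw [this]; congr 1
    have := hcq.inv_add_inv_eq_one
    rw [one_div, one_div]; linarith
  have k6 : X ^ (1 / q) ≤ C * T * E ^ (1 / p) := by
    rw [mul_assoc, k5, ha, Real.rpow_neg hE.le, inv_mul_le_iff₀ (by positivity)] at k4
    linarith
  have k7 := Real.rpow_le_rpow (by positivity) k6 (by linarith : 0 ≤ q)
  rw [← Real.rpow_mul hJ.le, Real.mul_rpow (by positivity) (by positivity), ← Real.rpow_mul hE.le] at k7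
  have e1 : 1 / q * q = 1 := by field_simp
  have e2 : 1 / p * q = q / p := by ring
  rw [e1, e2, Real.rpow_one] at k7
  exact k7

end BT

structure Dat (κ s K : ℝ) (F G : ℤ → ℝ) : Prop where
  hF : StrictMono F
  hG : StrictMono G
  hK : 1 ≤ K
  h1 : ∀ (x : ℤ) (n : ℕ), 0 < n → (G (x + n) - G x) * (F x - F (x - n)) ^ κ ≤ K * (n : ℝ) ^ s
  h2 : ∀ (x : ℤ) (n : ℕ), 0 < n → (n : ℝ) ^ s ≤ (G (x + n) - G x) * (F (x + n) - F x) ^ κ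

def mF (G : ℤ → ℝ) : ℤ → ℝ := fun a => -G (-a)

lemma Dat.mir {κ s K : ℝ} {F G : ℤ → ℝ} (hκ : 0 < κ) (d : Dat κ s K F G) :
    Dat (1 / κ) (s / κ) (K ^ (1 / κ)) (mF G) (mF F) := by
  have hK0 : 0 < K := by linarith [d.hK]
  refine ⟨?_, ?_, Real.one_le_rpow d.hK (by positivity), ?_, ?_⟩
  · intro a b hab; have := d.hG (neg_lt_neg hab); simp only [mF]; linarith
  · intro a b hab; have := d.hF (neg_lt_neg hab); simp only [mF]; linarith
  · intro x n hn
    have hn' : (0 : ℤ) < n := by exact_mod_cast hn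
    have h := d.h1 (-x) n hn
    have a1 : 0 < G (-x + n) - G (-x) := sub_pos.mpr (d.hG (by linarith))
    have a2 : 0 < F (-x) - F (-x - n) := sub_pos.mpr (d.hF (by linarith))
    have h' := Real.rpow_le_rpow (by positivity) h (by positivity : 0 ≤ 1 / κ)
    rw [Real.mul_rpow (by positivity) (by positivity), Real.mul_rpow hK0.le (by positivity),
      ← Real.rpow_mul a2.le, ← Real.rpow_mul (by positivity), mul_one_div_cancel hκ.ne',
      Real.rpow_one, mul_one_div] at h'
    simp only [mF]
    have e1 : -(x + (n : ℤ)) = -x - n := by ring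
    have e2 : -(x - (n : ℤ)) = -x + n := by ring
    rw [e1, e2]
    calc _ = (G (-x + n) - G (-x)) ^ (1 / κ) * (F (-x) - F (-x - n)) := by ring_nf
      _ ≤ _ := h'
  · intro x n hn
    have hn' : (0 : ℤ) < n := by exact_mod_cast hn
    have h := d.h2 (-x - n) n hn
    rw [sub_add_cancel] at h
    have a1 : 0 < G (-x) - G (-x - n) := sub_pos.mpr (d.hG (by linarith))
    have a2 : 0 < F (-x) - F (-x - n) := sub_pos.mpr (d.hF (by linarith))
    have h' := Real.rpow_le_rpow (by positivity) h (by positivity : 0 ≤ 1 / κ)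
    rw [Real.mul_rpow (by positivity) (by positivity), 
      ← Real.rpow_mul a2.le, ← Real.rpow_mul (by positivity), mul_one_div_cancel hκ.ne',
      Real.rpow_one, mul_one_div] at h'
    simp only [mF]
    have e1 : -(x + (n : ℤ)) = -x - n := by ring
    rw [e1]
    calc _ ≤ _ := h'
      _ = _ := by ring_nf

lemma Dat.growth {κ s K : ℝ} {F G : ℤ → ℝ} (hκ : 0 < κ) (d : Dat κ s K F G) (x : ℤ) (n : ℕ)
    (hn : 0 < n) : F x - F (x - n) ≤ K ^ (1 / κ) * (F (x + n) - F x) := by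
  have hK0 : 0 < K := by linarith [d.hK]
  have hn' : (0 : ℤ) < n := by exact_mod_cast hn
  have a1 : 0 < G (x + n) - G x := sub_pos.mpr (d.hG (by linarith))
  have a2 : 0 < F x - F (x - n) := sub_pos.mpr (d.hF (by linarith))
  have a3 : 0 < F (x + n) - F x := sub_pos.mpr (d.hF (by linarith))
  have h1 := d.h1 x n hn
  have h2 := mul_le_mul_of_nonneg_left (d.h2 x n hn) hK0.le
  have h3 : (F x - F (x - n)) ^ κ ≤ K * (F (x + n) - F x) ^ κ := by
    refine le_of_mul_le_mul_left ?_ a1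
    linarith
  have h4 := Real.rpow_le_rpow (by positivity) h3 (by positivity : 0 ≤ 1 / κ)
  rwa [Real.mul_rpow hK0.le (by positivity), ← Real.rpow_mul a2.le, ← Real.rpow_mul a3.le,
    mul_one_div_cancel hκ.ne', Real.rpow_one, Real.rpow_one] at h4

lemma one_add_rpow_neg_le {κ y : ℝ} (hκ : 0 < κ) (hy : 0 ≤ y) (hy1 : y ≤ 1) :
    (1 + y) ^ (-κ) ≤ 1 - (1 - 2 ^ (-κ)) * y := by
  have am : ∀ b : ℝ, 0 ≤ b → b ^ y ≤ (1 - y) + y * b := by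
    intro b hb
    have := Real.geom_mean_le_arith_mean2_weighted (w₁ := 1 - y) (w₂ := y) (p₁ := 1) (p₂ := b)
      (by linarith) hy zero_le_one hb (by ring)
    simpa using this
  have h1 := am 2 (by norm_num)
  have h2 := am (2 ^ (-κ)) (by positivity)
  have h3 : (1 + y) ^ (-κ) ≤ (2 ^ y) ^ (-κ) :=
    Real.rpow_le_rpow_of_nonpos (by positivity) (by linarith) (by linarith)
  rw [← Real.rpow_mul (by norm_num), mul_comm, Real.rpow_mul (by norm_num)] at h3
  linarith

lemma sum_Ico_tele (G : ℤ → ℝ) (i : ℤ) {n N : ℕ} (h : n ≤ N) :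
    ∑ j ∈ Finset.Ico n N, (G (i + j + 1) - G (i + j)) = G (i + N) - G (i + n) := by
  induction N, h using Nat.le_induction with
  | base => simp
  | succ N hN ih => 
    rw [Finset.sum_Ico_succ_top hN, ih]; push_cast
    rw [add_assoc]; ring

lemma Dat.tail_aux {κ s K : ℝ} {F G : ℤ → ℝ} (hκ : 0 < κ) (hs : 0 < s) (d : Dat κ s K F G) (i : ℤ)
    (m : ℕ) : ∀ (n : ℕ), 0 < n →
    ∑ j ∈ Finset.Ico n (2 ^ m * n), (G (i + j + 1) - G (i + j)) * ((j : ℝ) + 1) ^ (-s) ≤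
      (K * K ^ (1 / κ) / (1 - 2 ^ (-κ))) * (F (i + n) - F i) ^ (-κ) := by
  have hK0 : 0 < K := by linarith [d.hK]
  have hc : (0:ℝ) < 1 - 2 ^ (-κ) := by
    have : (2:ℝ) ^ (-κ) < 1 := Real.rpow_lt_one_of_one_lt_of_neg (by norm_num) (by linarith)
    linarith
  set c := (1:ℝ) - 2 ^ (-κ)
  set k := K ^ (1 / κ) with hk
  have hk1 : 1 ≤ k := Real.one_le_rpow d.hK (by positivity)
  induction m with
  | zero =>
    intro n hn
    have hn' : (0 : ℤ) < n := by exact_mod_cast hn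
    have a3 : 0 < F (i + n) - F i := sub_pos.mpr (d.hF (by linarith))
    simp; positivity
  | succ m ih =>
    intro n hn
    have hn' : (0 : ℤ) < n := by exact_mod_cast hn
    have a3 : 0 < F (i + n) - F i := sub_pos.mpr (d.hF (by linarith))
    have h2 := ih (2 * n) (by omega)
    have e : 2 ^ m * (2 * n) = 2 ^ (m + 1) * n := by ring
    rw [e] at h2
    rw [← Finset.sum_Ico_consecutive _ (show n ≤ 2 * n by omega)
      (show 2 * n ≤ 2 ^ (m + 1) * n from Nat.mul_le_mul_right _ (by
        rw [pow_succ]; have := Nat.one_le_two_pow (n := m); omega))]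
    have h3 : ∑ j ∈ Finset.Ico n (2 * n), (G (i + j + 1) - G (i + j)) * ((j : ℝ) + 1) ^ (-s) ≤
        K * (F (i + n) - F i) ^ (-κ) := by
      calc _ ≤ ∑ j ∈ Finset.Ico n (2 * n), (G (i + j + 1) - G (i + j)) * (n : ℝ) ^ (-s) := by
            refine Finset.sum_le_sum fun j hj => ?_
            rw [Finset.mem_Ico] at hj
            refine mul_le_mul_of_nonneg_left ?_ (sub_nonneg.mpr (d.hG.monotone (by linarith)))
            refine Real.rpow_le_rpow_of_nonpos (by exact_mod_cast hn) ?_ (by linarith)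
            have : (n : ℝ) ≤ j := by exact_mod_cast hj.1
            linarith
        _ = (G (i + n + n) - G (i + n)) * (n : ℝ) ^ (-s) := by
            rw [← Finset.sum_mul, sum_Ico_tele G i (by omega)]
            push_cast; rw [two_mul, add_assoc]
        _ ≤ _ := by
            have h := d.h1 (i + n) n hn
            rw [add_sub_cancel_right] at h
            rw [Real.rpow_neg (by positivity), Real.rpow_neg a3.le]
            have : (0:ℝ) < (n:ℝ) ^ s := by
              have : (0:ℝ) < n := by exact_mod_cast hn
              positivity
            rw [← div_eq_mul_inv, ← div_eq_mul_inv, div_le_div_iff₀ this (by positivity)]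
            exact h
    have h4 : (F (i + (2 * n : ℕ)) - F i) ^ (-κ) ≤ (F (i + n) - F i) ^ (-κ) * (1 - c * (1 / k)) := by
      have g := d.growth hκ (i + n) n hn
      rw [add_sub_cancel_right] at g
      have h5 : (F (i + n) - F i) * (1 + 1 / k) ≤ F (i + (2 * n : ℕ)) - F i := by
        have e2 : i + ((2 * n : ℕ) : ℤ) = i + n + n := by push_cast; ring
        rw [e2]
        have : (F (i + n) - F i) * (1 / k) ≤ F (i + n + n) - F (i + n) := by
          rw [mul_one_div, div_le_iff₀ (by positivity)]; linarith
        linarith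
      calc _ ≤ ((F (i + n) - F i) * (1 + 1 / k)) ^ (-κ) :=
            Real.rpow_le_rpow_of_nonpos (by positivity) h5 (by linarith)
        _ = (F (i + n) - F i) ^ (-κ) * (1 + 1 / k) ^ (-κ) := Real.mul_rpow a3.le (by positivity)
        _ ≤ _ := by
          gcongr
          exact one_add_rpow_neg_le hκ (by positivity) (by rw [div_le_one (by positivity)]; exact hk1)
    have h5 : (K * k / c) * (F (i + (2 * n : ℕ)) - F i) ^ (-κ) ≤
        (K * k / c) * ((F (i + n) - F i) ^ (-κ) * (1 - c * (1 / k))) := by gcongr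
    have h6 : K * (F (i + n) - F i) ^ (-κ) + (K * k / c) * ((F (i + n) - F i) ^ (-κ) * (1 - c * (1 / k)))
       = (K * k / c) * (F (i + n) - F i) ^ (-κ) := by
      field_simp; ring
    linarith

lemma Dat.tail {κ s K : ℝ} {F G : ℤ → ℝ} (hκ : 0 < κ) (hs : 0 < s) (d : Dat κ s K F G) (i : ℤ)
    (n N : ℕ) (hn : 0 < n) :
    ∑ j ∈ Finset.Ico n N, (G (i + j + 1) - G (i + j)) * ((j : ℝ) + 1) ^ (-s) ≤
      (K * K ^ (1 / κ) / (1 - 2 ^ (-κ))) * (F (i + n) - F i) ^ (-κ) := by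
  refine le_trans ?_ (d.tail_aux hκ hs i N n hn)
  refine Finset.sum_le_sum_of_subset_of_nonneg (Finset.Ico_subset_Ico_right ?_) ?_
  · calc N ≤ 2 ^ N := Nat.lt_two_pow_self.le
      _ ≤ 2 ^ N * n := Nat.le_mul_of_pos_right _ hn
  · intro j _ _
    exact mul_nonneg (sub_nonneg.mpr (d.hG.monotone (by linarith))) (by positivity)

/-- Abel summation. -/
lemma abel_step {γ κ x y : ℝ} (hκ : 0 < κ) (hγ : κ < γ) (hx : 0 < x) (hxy : x ≤ y) :
    y ^ (-κ) * (y ^ γ - x ^ γ) ≤ γ / (γ - κ) * (y ^ (γ - κ) - x ^ (γ - κ)) := by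
  have hy : 0 < y := by linarith
  have hg : 0 < γ - κ := by linarith
  have hz : 0 < x / y := by positivity
  have hz1 : x / y ≤ 1 := by rw [div_le_one hy]; exact hxy
  have h := one_add_mul_self_le_rpow_one_add (s := (x / y) ^ (γ - κ) - 1) (p := γ / (γ - κ))
    (by linarith [Real.rpow_nonneg hz.le (γ - κ)]) (by rw [le_div_iff₀ hg]; linarith)
  rw [add_sub_cancel, ← Real.rpow_mul hz.le, mul_div_cancel₀ _ hg.ne', Real.div_rpow hx.le hy.le,
    Real.div_rpow hx.le hy.le] at h
  have e1 : y ^ (-κ) * y ^ γ = y ^ (γ - κ) := by rw [← Real.rpow_add hy]; ring_nf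
  have p1 : 0 < y ^ (γ - κ) := by positivity
  have p2 : 0 < y ^ γ := by positivity
  have h2 := mul_le_mul_of_nonneg_left h p1.le
  have e2 : y ^ (γ - κ) * (x ^ γ / y ^ γ) = y ^ (-κ) * x ^ γ := by
    rw [← e1]; field_simp
  have e3 : y ^ (γ - κ) * (1 + γ / (γ - κ) * (x ^ (γ - κ) / y ^ (γ - κ) - 1)) =
     y ^ (γ - κ) + γ / (γ - κ) * (x ^ (γ - κ) - y ^ (γ - κ)) := by field_simp
  rw [e2, e3] at h2
  rw [mul_sub, e1]
  linarith

lemma abel_sum {γ κ A : ℝ} (hκ : 0 < κ) (hγ : κ < γ) (n : ℕ) : ∀ (c M : ℕ → ℝ),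
    (∀ k, 0 < M k) → Monotone M →
    (∀ k, ∑ j ∈ Finset.range (n - k), c (k + j) ≤ A * M k ^ (-κ)) → 0 ≤ A →
    ∑ j ∈ Finset.range n, c j * M j ^ γ ≤ (∑ j ∈ Finset.range n, c j) * M 0 ^ γ +
      A * (γ / (γ - κ)) * (M n ^ (γ - κ) - M 0 ^ (γ - κ)) := by
  induction n with
  | zero => intro c M _ _ _ _; simp
  | succ n ih =>
    intro c M hM hmono htail hA
    have h := ih (fun k => c (k + 1)) (fun k => M (k + 1)) (fun k => hM _)
      (fun a b hab => hmono (by omega)) (by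
        intro k
        have := htail (k + 1)
        rw [Nat.add_sub_add_right] at this
        refine le_trans (le_of_eq ?_) this
        refine Finset.sum_congr rfl fun j _ => ?_
        congr 1; ring) hA
    rw [Finset.sum_range_succ', Finset.sum_range_succ' (fun j => c j)]
    have h2 := htail 1
    rw [Nat.add_sub_cancel] at h2
    have h3 : ∑ j ∈ Finset.range n, c (1 + j) = ∑ j ∈ Finset.range n, c (j + 1) :=
      Finset.sum_congr rfl fun j _ => by rw [add_comm]
    rw [h3] at h2
    have h4 := abel_step hκ hγ (hM 0) (hmono (Nat.zero_le 1))
    have h5 : 0 ≤ M 1 ^ γ - M 0 ^ γ := sub_nonneg.mpr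
      (Real.rpow_le_rpow (hM 0).le (hmono (Nat.zero_le 1)) (by linarith))
    have h6 := mul_le_mul_of_nonneg_right h2 h5
    have h7 := mul_le_mul_of_nonneg_left h4 hA
    simp only [zero_add] at h ⊢
    linarith

lemma abel_final {γ κ A : ℝ} (hκ : 0 < κ) (hγ : κ < γ) (n : ℕ) (c M : ℕ → ℝ)
    (hM : ∀ k, 0 < M k) (hm : Monotone M)
    (ht : ∀ k, ∑ j ∈ Finset.range (n - k), c (k + j) ≤ A * M k ^ (-κ)) (hA : 0 ≤ A) :
    ∑ j ∈ Finset.range n, c j * M j ^ γ ≤ A * (γ / (γ - κ)) * M n ^ (γ - κ) := by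
  have h := abel_sum hκ hγ n c M hM hm ht hA
  have h0 := ht 0
  simp only [Nat.sub_zero, zero_add] at h0
  have h1 := mul_le_mul_of_nonneg_right h0 (Real.rpow_nonneg (hM 0).le γ)
  have e : A * M 0 ^ (-κ) * M 0 ^ γ = A * M 0 ^ (γ - κ) := by
    rw [mul_assoc, ← Real.rpow_add (hM 0)]; ring_nf
  have h2 : 1 ≤ γ / (γ - κ) := by rw [le_div_iff₀ (by linarith)]; linarith
  have h3 : 0 ≤ A * M 0 ^ (γ - κ) := mul_nonneg hA (Real.rpow_nonneg (hM 0).le _)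
  have h4 := mul_le_mul_of_nonneg_right h2 h3
  linarith

lemma conc_step {η x y : ℝ} (hη : 0 < η) (hη1 : η < 1) (hx : 0 ≤ x) (hxy : x < y) :
    y ^ (-η) * (y - x) ≤ (1 / (1 - η)) * (y ^ (1 - η) - x ^ (1 - η)) := by
  have hy : 0 < y := by linarith
  have h := rpow_one_add_le_one_add_mul_self (s := x / y - 1) (p := 1 - η)
    (by linarith [div_nonneg hx hy.le]) (by linarith) (by linarith)
  rw [add_sub_cancel, Real.div_rpow hx hy.le] at h
  have p1 : 0 < y ^ (1 - η) := by positivity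
  have h2 := mul_le_mul_of_nonneg_left h p1.le
  have e1 : y ^ (1 - η) = y ^ (-η) * y := by
    rw [show 1 - η = -η + 1 by ring, Real.rpow_add hy, Real.rpow_one]
  have e2 : y ^ (1 - η) * (x ^ (1 - η) / y ^ (1 - η)) = x ^ (1 - η) := by field_simp
  have e3 : y ^ (1 - η) * (1 + (1 - η) * (x / y - 1)) =
     y ^ (1 - η) - (1 - η) * (y ^ (-η) * (y - x)) := by rw [e1]; field_simp; ring
  rw [e2, e3] at h2
  rw [one_div, le_inv_mul_iff₀ (by linarith)]
  linarith

lemma conc_sum {η : ℝ} (hη : 0 < η) (hη1 : η < 1) {F : ℤ → ℝ} (hF : StrictMono F) (a : ℤ) (n : ℕ) :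
    ∑ i ∈ Finset.range n, (F (a + n) - F (a + i)) ^ (-η) * (F (a + i + 1) - F (a + i)) ≤
      (1 / (1 - η)) * (F (a + n) - F a) ^ (1 - η) := by
  have h : ∀ m ≤ n, ∑ i ∈ Finset.range m, (F (a + n) - F (a + i)) ^ (-η) * (F (a + i + 1) - F (a + i)) ≤
      (1 / (1 - η)) * ((F (a + n) - F a) ^ (1 - η) - (F (a + n) - F (a + m)) ^ (1 - η)) := by
    intro m
    induction m with
    | zero => intro _; simp
    | succ m ih =>
      intro hm
      rw [Finset.sum_range_succ]
      have h1 := ih (by omega)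
      have hmn : (m : ℤ) + 1 ≤ n := by exact_mod_cast hm
      have h2 := conc_step hη hη1 (x := F (a + n) - F (a + m + 1)) (y := F (a + n) - F (a + m))
        (sub_nonneg.mpr (hF.monotone (by linarith))) (by linarith [hF (show a + m < a + m + 1 by linarith)])
      have e : F (a + n) - F (a + m) - (F (a + n) - F (a + m + 1)) = F (a + m + 1) - F (a + m) := by ring
      rw [e] at h2
      push_cast
      rw [← add_assoc]
      linarith
  have h1 := h n le_rfl
  rw [sub_self, Real.zero_rpow (by linarith), sub_zero] at h1
  exact h1

lemma Dat.inner_sum {κ s K γ : ℝ} {F G : ℤ → ℝ} (hκ : 0 < κ) (hs : 0 < s) (hγ : κ < γ)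
    (d : Dat κ s K F G) (I : ℤ) (n : ℕ) :
    ∑ k ∈ Finset.range n, (G (I + (1 + k : ℕ) + 1) - G (I + (1 + k : ℕ))) * (((1 + k : ℕ) : ℝ) + 1) ^ (-s) *
      (F (I + (1 + k : ℕ)) - F I) ^ γ ≤
      (K * K ^ (1 / κ) / (1 - 2 ^ (-κ))) * (γ / (γ - κ)) * (F (I + (1 + n : ℕ)) - F I) ^ (γ - κ) := by
  have hK0 : 0 < K := by linarith [d.hK]
  have hc : (0:ℝ) < 1 - 2 ^ (-κ) := by
    have : (2:ℝ) ^ (-κ) < 1 := Real.rpow_lt_one_of_one_lt_of_neg (by norm_num) (by linarith)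
    linarith
  refine abel_final hκ hγ n
    (fun k : ℕ => (G (I + (1 + k : ℕ) + 1) - G (I + (1 + k : ℕ))) * (((1 + k : ℕ) : ℝ) + 1) ^ (-s))
    (fun k : ℕ => F (I + (1 + k : ℕ)) - F I) ?_ ?_ ?_ (by positivity)
  · intro k; exact sub_pos.mpr (d.hF (by push_cast; linarith [Int.natCast_nonneg k]))
  · intro k k' hk
    have : (k : ℤ) ≤ k' := by exact_mod_cast hk
    exact sub_le_sub_right (d.hF.monotone (by push_cast; linarith)) _
  · intro k
    have := d.tail hκ hs I (1 + k) (1 + k + (n - k)) (by omega)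
    rw [Finset.sum_Ico_eq_sum_range] at this
    rw [Nat.add_sub_cancel_left] at this
    refine le_trans (le_of_eq ?_) this
    refine Finset.sum_congr rfl fun j _ => ?_
    simp only [add_assoc]

lemma holder_pow {q Q : ℝ} (hc : Real.HolderConjugate q Q) {ι : Type*} (t : Finset ι)
    (k M σ : ι → ℝ) (δ : ℝ) (hk : ∀ i ∈ t, 0 ≤ k i) (hM : ∀ i ∈ t, 0 < M i) (hσ : ∀ i ∈ t, 0 ≤ σ i) :
    (∑ i ∈ t, k i * σ i) ^ q ≤ (∑ i ∈ t, k i ^ q * M i ^ (δ * q) * σ i) *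
      (∑ i ∈ t, M i ^ (-(δ * Q)) * σ i) ^ (q / Q) := by
  have hq1 := hc.lt
  have hQ1 := hc.symm.lt
  have hq0 : 0 < q := by linarith
  have hQ0 : 0 < Q := by linarith
  have hr : q⁻¹ + Q⁻¹ = 1 := hc.inv_add_inv_eq_one
  have h := Real.inner_le_Lp_mul_Lq_of_nonneg t hc (f := fun i => k i * M i ^ δ * σ i ^ (1 / q))
    (g := fun i => M i ^ (-δ) * σ i ^ (1 / Q)) (by
      intro i hi; have := hk i hi; have := hM i hi; have := hσ i hi; positivity) (by
      intro i hi; have := hM i hi; have := hσ i hi; positivity)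
  have e1 : ∑ i ∈ t, k i * M i ^ δ * σ i ^ (1 / q) * (M i ^ (-δ) * σ i ^ (1 / Q)) = ∑ i ∈ t, k i * σ i := by
    refine Finset.sum_congr rfl fun i hi => ?_
    have h1 := hM i hi
    have : σ i ^ (1 / q) * σ i ^ (1 / Q) = σ i := by
      rw [← Real.rpow_add_of_nonneg (hσ i hi) (by positivity) (by positivity), one_div, one_div, hr,
        Real.rpow_one]
    have h2 : M i ^ δ * M i ^ (-δ) = 1 := by rw [← Real.rpow_add h1]; simp
    calc _ = k i * (M i ^ δ * M i ^ (-δ)) * (σ i ^ (1 / q) * σ i ^ (1 / Q)) := by ring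
      _ = _ := by rw [this, h2, mul_one]
  have e2 : ∑ i ∈ t, (k i * M i ^ δ * σ i ^ (1 / q)) ^ q = ∑ i ∈ t, k i ^ q * M i ^ (δ * q) * σ i := by
    refine Finset.sum_congr rfl fun i hi => ?_
    have h1 := hM i hi
    have h2 := hk i hi
    have h3 := hσ i hi
    rw [Real.mul_rpow (by positivity) (by positivity), Real.mul_rpow h2 (by positivity),
      ← Real.rpow_mul h1.le, ← Real.rpow_mul h3, one_div_mul_cancel hq0.ne', Real.rpow_one]
  have e3 : ∑ i ∈ t, (M i ^ (-δ) * σ i ^ (1 / Q)) ^ Q = ∑ i ∈ t, M i ^ (-(δ * Q)) * σ i := by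
    refine Finset.sum_congr rfl fun i hi => ?_
    have h1 := hM i hi
    have h3 := hσ i hi
    rw [Real.mul_rpow (by positivity) (by positivity), 
      ← Real.rpow_mul h1.le, ← Real.rpow_mul h3, one_div_mul_cancel hQ0.ne', Real.rpow_one, neg_mul]
  rw [e1, e2, e3] at h
  have p1 : 0 ≤ ∑ i ∈ t, k i ^ q * M i ^ (δ * q) * σ i := Finset.sum_nonneg fun i hi => by
    have := hk i hi; have := hM i hi; have := hσ i hi; positivity
  have p2 : 0 ≤ ∑ i ∈ t, M i ^ (-(δ * Q)) * σ i := Finset.sum_nonneg fun i hi => by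
    have := hM i hi; have := hσ i hi; positivity
  have p3 : 0 ≤ ∑ i ∈ t, k i * σ i := Finset.sum_nonneg fun i hi => by
    have := hk i hi; have := hσ i hi; positivity
  have h' := Real.rpow_le_rpow p3 h hq0.le
  rw [Real.mul_rpow (by positivity) (by positivity), ← Real.rpow_mul p1, ← Real.rpow_mul p2,
    one_div_mul_cancel hq0.ne', Real.rpow_one, one_div_mul_eq_div] at h'
  exact h'

lemma Dat.testing {p q P Q b κ s : ℝ} (hcp : Real.HolderConjugate p P)
    (hcq : Real.HolderConjugate q Q) (hpq : p < q) (hκ : κ = q / P) (hs : s = 1 + κ)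
    (hb : b * q = -s) : ∃ C : ℝ, 1 ≤ C ∧ ∀ (K : ℝ) (F G : ℤ → ℝ), Dat κ s K F G → ∀ (a : ℤ) (n : ℕ),
    ∑ j ∈ Finset.range n, (G (a + j + 1) - G (a + j)) *
      (∑ i ∈ Finset.range j, ((j : ℝ) - i + 1) ^ b * (F (a + i + 1) - F (a + i))) ^ q ≤
      C * (K * K ^ (1 / κ)) * (F (a + n) - F a) ^ (q / p) := by
  have hp1 := hcp.lt
  have hq1 := hcq.lt
  have hP1 := hcp.symm.lt
  have hQ1 := hcq.symm.lt
  have hκ0 : 0 < κ := by rw [hκ]; apply div_pos <;> linarith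
  have hs0 : 0 < s := by linarith
  have hPQ : 1 / P < 1 / Q := by
    have h1 := hcp.inv_add_inv_eq_one
    have h2 := hcq.inv_add_inv_eq_one
    have h3 : q⁻¹ < p⁻¹ := inv_strictAnti₀ (by linarith) hpq
    rw [one_div, one_div]; linarith
  obtain ⟨δ, hδ1, hδ2⟩ := exists_between hPQ
  have hδ0 : 0 < δ := lt_trans (by positivity) hδ1
  set η := δ * Q with hη
  have hη0 : 0 < η := by positivity
  have hη1 : η < 1 := by rw [lt_div_iff₀ (by linarith)] at hδ2; exact hδ2
  set γ := δ * q with hγ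
  have hγκ : κ < γ := by
    rw [hκ, hγ]
    have := mul_lt_mul_of_pos_right hδ1 (show 0 < q by linarith)
    rwa [one_div_mul_eq_div] at this
  have hc : (0:ℝ) < 1 - 2 ^ (-κ) := by
    have : (2:ℝ) ^ (-κ) < 1 := Real.rpow_lt_one_of_one_lt_of_neg (by norm_num) (by linarith)
    linarith
  set c1 := (1 / (1 - η)) ^ (q / Q) with hc1
  have hη' : 0 < 1 - η := by linarith
  have hγ' : 0 < γ - κ := by linarith
  have hγ0 : 0 < γ := by linarith
  have hc10 : 0 < c1 := by positivity
  refine ⟨max 1 (c1 * (γ / (γ - κ)) / (1 - 2 ^ (-κ))), le_max_left _ _, ?_⟩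
  intro K F G d a n
  have hK0 : 0 < K := by linarith [d.hK]
  rcases Nat.eq_zero_or_pos n with rfl | hn
  · simp [Real.zero_rpow (show q / p ≠ 0 by positivity)]
  have hn' : (0 : ℤ) < n := by exact_mod_cast hn
  set S := F (a + n) - F a with hS
  have hS0 : 0 < S := sub_pos.mpr (d.hF (by linarith))
  have hv : ∀ j : ℕ, 0 ≤ G (a + j + 1) - G (a + j) := fun j =>
    sub_nonneg.mpr (d.hG.monotone (by linarith))
  have hσ : ∀ j : ℕ, 0 ≤ F (a + j + 1) - F (a + j) := fun j =>
    sub_nonneg.mpr (d.hF.monotone (by linarith))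
  have step1 : ∀ j ∈ Finset.range n, (G (a + j + 1) - G (a + j)) *
      (∑ i ∈ Finset.range j, ((j : ℝ) - i + 1) ^ b * (F (a + i + 1) - F (a + i))) ^ q ≤
      c1 * S ^ ((1 - η) * (q / Q)) * ∑ i ∈ Finset.range j, (F (a + i + 1) - F (a + i)) *
        ((G (a + j + 1) - G (a + j)) * ((j : ℝ) - i + 1) ^ (-s) * (F (a + j) - F (a + i)) ^ γ) := by
    intro j hj
    rw [Finset.mem_range] at hj
    have hjn : (j : ℤ) ≤ n := by exact_mod_cast hj.le
    have hlt : ∀ i ∈ Finset.range j, (i : ℝ) + 1 ≤ j := fun i hi => by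
      exact_mod_cast Finset.mem_range.mp hi
    have hltz : ∀ i ∈ Finset.range j, (i : ℤ) + 1 ≤ j := fun i hi => by
      exact_mod_cast Finset.mem_range.mp hi
    have h := holder_pow hcq (Finset.range j) (fun i : ℕ => ((j : ℝ) - i + 1) ^ b)
      (fun i : ℕ => F (a + j) - F (a + i)) (fun i : ℕ => F (a + i + 1) - F (a + i)) δ
      (fun i hi => Real.rpow_nonneg (by linarith [hlt i hi]) _)
      (fun i hi => sub_pos.mpr (d.hF (by linarith [hltz i hi])))
      (fun i hi => hσ i)
    have h2 := conc_sum hη0 hη1 d.hF a j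
    have h3 : (1 / (1 - η)) * (F (a + j) - F a) ^ (1 - η) ≤ (1 / (1 - η)) * S ^ (1 - η) := by
      gcongr
      · exact sub_nonneg.mpr (d.hF.monotone (by linarith [Int.natCast_nonneg j]))
      · exact sub_le_sub_right (d.hF.monotone (by linarith)) _
    have h4 : (∑ i ∈ Finset.range j, (F (a + j) - F (a + i)) ^ (-(δ * Q)) *
        (F (a + i + 1) - F (a + i))) ^ (q / Q) ≤ c1 * S ^ ((1 - η) * (q / Q)) := by
      have := Real.rpow_le_rpow (Finset.sum_nonneg fun i hi => mul_nonneg (Real.rpow_nonneg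
        (sub_nonneg.mpr (d.hF.monotone (by linarith [hltz i hi]))) _) (hσ i))
        (h2.trans h3) (show 0 ≤ q / Q by positivity)
      rwa [Real.mul_rpow (by positivity) (by positivity), ← Real.rpow_mul hS0.le] at this
    have e : ∑ i ∈ Finset.range j, (((j : ℝ) - i + 1) ^ b) ^ q * (F (a + j) - F (a + i)) ^ (δ * q) *
        (F (a + i + 1) - F (a + i)) = ∑ i ∈ Finset.range j, ((j : ℝ) - i + 1) ^ (-s) *
        (F (a + j) - F (a + i)) ^ γ * (F (a + i + 1) - F (a + i)) := by
      refine Finset.sum_congr rfl fun i hi => ?_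
      rw [← Real.rpow_mul (by linarith [hlt i hi]), hb]
    rw [e] at h
    have p1 : 0 ≤ ∑ i ∈ Finset.range j, ((j : ℝ) - i + 1) ^ (-s) *
        (F (a + j) - F (a + i)) ^ γ * (F (a + i + 1) - F (a + i)) :=
      Finset.sum_nonneg fun i hi => mul_nonneg (mul_nonneg (Real.rpow_nonneg (by linarith [hlt i hi]) _)
        (Real.rpow_nonneg (sub_nonneg.mpr (d.hF.monotone (by linarith [hltz i hi]))) _)) (hσ i)
    have h5 := mul_le_mul_of_nonneg_left (h.trans (mul_le_mul_of_nonneg_left h4 p1)) (hv j)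
    refine h5.trans (le_of_eq ?_)
    rw [mul_comm (∑ i ∈ Finset.range j, _), mul_left_comm, Finset.mul_sum]
    congr 1
    refine Finset.sum_congr rfl fun i hi => ?_
    ring
  have step2 : ∀ i ∈ Finset.range n, ∑ j ∈ Finset.Ico (i + 1) n, (F (a + i + 1) - F (a + i)) *
        ((G (a + j + 1) - G (a + j)) * ((j : ℝ) - i + 1) ^ (-s) * (F (a + j) - F (a + i)) ^ γ) ≤
      (F (a + i + 1) - F (a + i)) *
      ((K * K ^ (1 / κ) / (1 - 2 ^ (-κ))) * (γ / (γ - κ)) * S ^ (γ - κ)) := by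
    intro i hi
    rw [Finset.mem_range] at hi
    rw [← Finset.mul_sum]
    refine mul_le_mul_of_nonneg_left ?_ (hσ i)
    have h := d.inner_sum hκ0 hs0 hγκ (a + i) (n - (i + 1))
    rw [Finset.sum_Ico_eq_sum_range]
    have e2 : a + i + ((1 + (n - (i + 1)) : ℕ) : ℤ) = a + n := by
      have : 1 + (n - (i + 1)) = n - i := by omega
      rw [this, Nat.cast_sub hi.le]; ring
    rw [e2] at h
    have h2 : (F (a + n) - F (a + i)) ^ (γ - κ) ≤ S ^ (γ - κ) := by
      have hi' : (i : ℤ) < n := by exact_mod_cast hi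
      refine Real.rpow_le_rpow (sub_nonneg.mpr (d.hF.monotone (by linarith))) ?_ hγ'.le
      exact sub_le_sub_left (d.hF.monotone (by linarith [Int.natCast_nonneg i])) _
    refine le_trans (le_trans (le_of_eq ?_) h) (by gcongr)
    refine Finset.sum_congr rfl fun k _ => ?_
    have e3 : a + ((i + 1 + k : ℕ) : ℤ) = a + i + ((1 + k : ℕ) : ℤ) := by push_cast; ring
    have e4 : ((i + 1 + k : ℕ) : ℝ) - i + 1 = ((1 + k : ℕ) : ℝ) + 1 := by push_cast; ring
    rw [e3, e4]
  have step3 : ∑ i ∈ Finset.range n, (F (a + i + 1) - F (a + i)) = S := by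
    have := sum_Ico_tele F a (Nat.zero_le n)
    simpa using this
  calc _ ≤ ∑ j ∈ Finset.range n, c1 * S ^ ((1 - η) * (q / Q)) * ∑ i ∈ Finset.range j, (F (a + i + 1) - F (a + i)) *
        ((G (a + j + 1) - G (a + j)) * ((j : ℝ) - i + 1) ^ (-s) * (F (a + j) - F (a + i)) ^ γ) :=
        Finset.sum_le_sum step1
    _ = c1 * S ^ ((1 - η) * (q / Q)) * ∑ i ∈ Finset.range n, ∑ j ∈ Finset.Ico (i + 1) n, (F (a + i + 1) - F (a + i)) *
        ((G (a + j + 1) - G (a + j)) * ((j : ℝ) - i + 1) ^ (-s) * (F (a + j) - F (a + i)) ^ γ) := by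
        rw [← Finset.mul_sum]
        congr 1
        refine Finset.sum_comm' ?_
        intro x y
        simp only [Finset.mem_range, Finset.mem_Ico]
        omega
    _ ≤ c1 * S ^ ((1 - η) * (q / Q)) * (S *
      ((K * K ^ (1 / κ) / (1 - 2 ^ (-κ))) * (γ / (γ - κ)) * S ^ (γ - κ))) := by
        gcongr
        refine (Finset.sum_le_sum step2).trans (le_of_eq ?_)
        rw [← Finset.sum_mul, step3]
    _ = (c1 * (γ / (γ - κ)) / (1 - 2 ^ (-κ))) * (K * K ^ (1 / κ)) *
        (S ^ ((1 - η) * (q / Q)) * (S ^ (1:ℝ) * S ^ (γ - κ))) := by rw [Real.rpow_one]; ring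
    _ = (c1 * (γ / (γ - κ)) / (1 - 2 ^ (-κ))) * (K * K ^ (1 / κ)) * S ^ (q / p) := by
        rw [← Real.rpow_add hS0, ← Real.rpow_add hS0]
        congr 2
        rw [hη, hγ, hκ]
        have h1 := hcp.inv_add_inv_eq_one
        have h2 := hcq.inv_add_inv_eq_one
        have e5 : Q⁻¹ = 1 - q⁻¹ := by linarith
        have e6 : P⁻¹ = 1 - p⁻¹ := by linarith
        have : (1 - δ * Q) * (q / Q) = q * Q⁻¹ - δ * q := by field_simp
        rw [this, div_eq_mul_inv q P, e5, e6]
        field_simp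
        ring
    _ ≤ _ := by
        gcongr
        exact le_max_right _ _

def build (b : ℝ) (F G f : ℤ → ℝ) : ℕ → ℤ → BT
  | 0, a => BT.leaf (F (a + 1) - F a) (G (a + 1) - G a) (f a) 0
  | D + 1, a => BT.node (((2 : ℝ) ^ (D + 1)) ^ b) (build b F G f D a) (build b F G f D (a + 2 ^ D))

lemma build_sg (b : ℝ) (F G f : ℤ → ℝ) (D : ℕ) (a : ℤ) :
    (build b F G f D a).sg = F (a + 2 ^ D) - F a := by
  induction D generalizing a with
  | zero => simp [build, BT.sg]
  | succ D ih =>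
    simp only [build, BT.sg, ih]
    have : a + 2 ^ D + 2 ^ D = a + 2 ^ (D + 1) := by ring
    rw [this]; ring

lemma build_vv (b : ℝ) (F G f : ℤ → ℝ) (D : ℕ) (a : ℤ) :
    (build b F G f D a).vv = G (a + 2 ^ D) - G a := by
  induction D generalizing a with
  | zero => simp [build, BT.vv]
  | succ D ih =>
    simp only [build, BT.vv, ih]
    have : a + 2 ^ D + 2 ^ D = a + 2 ^ (D + 1) := by ring
    rw [this]; ring

lemma build_pos (b : ℝ) {F G f : ℤ → ℝ} (hF : StrictMono F) (hG : StrictMono G) (hf : ∀ a, 0 ≤ f a)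
    (D : ℕ) (a : ℤ) : (build b F G f D a).Pos := by
  induction D generalizing a with
  | zero => exact ⟨sub_pos.mpr (hF (by linarith)), sub_pos.mpr (hG (by linarith)), hf a, le_rfl⟩
  | succ D ih => exact ⟨by positivity, ih _, ih _⟩

lemma build_mir (b : ℝ) (F G f : ℤ → ℝ) (D : ℕ) (a : ℤ) :
    (build b F G f D a).mir.skel = (build b (mF G) (mF F) 0 D (-a - 2 ^ D)).skel := by
  induction D generalizing a with
  | zero =>
    simp only [build, BT.mir, BT.skel, mF]
    have e1 : -(-a - 2 ^ 0 + 1) = a := by ring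
    have e2 : -(-a - 2 ^ 0) = a + 1 := by ring
    rw [e1, e2]; congr 1 <;> ring
  | succ D ih =>
    simp only [build, BT.mir, BT.skel, ih]
    have e1 : -(a + 2 ^ D) - 2 ^ D = -a - 2 ^ (D + 1) := by ring
    have e2 : -a - 2 ^ (D + 1) + 2 ^ D = -a - 2 ^ D := by ring
    rw [e1, e2]

lemma build_J {b q : ℝ} (hb : b ≤ 0) (hq : 0 ≤ q) {F G : ℤ → ℝ} (f : ℤ → ℝ) (hF : StrictMono F)
    (hG : StrictMono G) (D : ℕ) (a : ℤ) {t : ℝ} (ht : 0 ≤ t) :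
    (build b F G f D a).J q t ≤ ∑ j ∈ Finset.range (2 ^ D), (G (a + j + 1) - G (a + j)) *
      (t + ∑ i ∈ Finset.range j, ((j : ℝ) - i + 1) ^ b * (F (a + i + 1) - F (a + i))) ^ q := by
  induction D generalizing a t with
  | zero => simp [build, BT.J, mul_comm]
  | succ D ih =>
    have hsg : 0 ≤ F (a + 2 ^ D) - F a := sub_nonneg.mpr (hF.monotone (by
      have : (0:ℤ) ≤ 2 ^ D := by positivity
      linarith))
    have hm : 0 ≤ ((2 : ℝ) ^ (D + 1)) ^ b * (F (a + 2 ^ D) - F a) := mul_nonneg (by positivity) hsg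
    have h1 := ih a ht
    have h2 := ih (a + 2 ^ D) (add_nonneg ht hm)
    have hσ : ∀ j : ℕ, 0 ≤ F (a + j + 1) - F (a + j) := fun j =>
      sub_nonneg.mpr (hF.monotone (by linarith))
    simp only [build, BT.J, build_sg]
    rw [show (2:ℕ) ^ (D + 1) = 2 ^ D + 2 ^ D by ring, Finset.sum_range_add]
    refine add_le_add h1 (h2.trans ?_)
    refine Finset.sum_le_sum fun j hj => ?_
    rw [Finset.mem_range] at hj
    have ej : a + ((2 ^ D + j : ℕ) : ℤ) = a + 2 ^ D + j := by push_cast; ring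
    rw [ej]
    refine mul_le_mul_of_nonneg_left ?_ (sub_nonneg.mpr (hG.monotone (by linarith)))
    have hs2 : ∑ i ∈ Finset.range j, ((j : ℝ) - i + 1) ^ b * (F (a + 2 ^ D + i + 1) - F (a + 2 ^ D + i)) =
       ∑ i ∈ Finset.range j, (((2 ^ D + j : ℕ) : ℝ) - (2 ^ D + i : ℕ) + 1) ^ b *
        (F (a + (2 ^ D + i : ℕ) + 1) - F (a + (2 ^ D + i : ℕ))) := by
      refine Finset.sum_congr rfl fun i _ => ?_
      have e1 : a + ((2 ^ D + i : ℕ) : ℤ) = a + 2 ^ D + i := by push_cast; ring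
      have e2 : ((2 ^ D + j : ℕ) : ℝ) - (2 ^ D + i : ℕ) + 1 = j - i + 1 := by push_cast; ring
      rw [e1, e2]
    have hs1 : ((2 : ℝ) ^ (D + 1)) ^ b * (F (a + 2 ^ D) - F a) ≤
        ∑ i ∈ Finset.range (2 ^ D), (((2 ^ D + j : ℕ) : ℝ) - i + 1) ^ b * (F (a + i + 1) - F (a + i)) := by
      have h3 := sum_Ico_tele F a (Nat.zero_le (2 ^ D))
      simp only [Nat.Ico_zero_eq_range] at h3
      push_cast at h3
      rw [add_zero] at h3
      rw [← h3, Finset.mul_sum]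
      refine Finset.sum_le_sum fun i hi => ?_
      refine mul_le_mul_of_nonneg_right ?_ (hσ i)
      have hi' : (i : ℝ) + 1 ≤ 2 ^ D := by exact_mod_cast Finset.mem_range.mp hi
      have hj' : (j : ℝ) + 1 ≤ 2 ^ D := by exact_mod_cast hj
      have : (0:ℝ) ≤ j := by positivity
      have : (0:ℝ) ≤ i := by positivity
      refine Real.rpow_le_rpow_of_nonpos ?_ ?_ hb
      · push_cast; linarith
      · push_cast; rw [pow_succ]; linarith
    have hnn : 0 ≤ ∑ i ∈ Finset.range j, ((j : ℝ) - i + 1) ^ b * (F (a + 2 ^ D + i + 1) - F (a + 2 ^ D + i)) := by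
      refine Finset.sum_nonneg fun i hi => ?_
      have hi' : (i : ℝ) + 1 ≤ j := by exact_mod_cast Finset.mem_range.mp hi
      exact mul_nonneg (Real.rpow_nonneg (by linarith) _) (sub_nonneg.mpr (hF.monotone (by linarith)))
    refine Real.rpow_le_rpow (by positivity) ?_ hq
    rw [Finset.sum_range_add, ← hs2]
    linarith

lemma build_Test {p q P Q b κ s : ℝ} (hcp : Real.HolderConjugate p P)
    (hcq : Real.HolderConjugate q Q) (hpq : p < q) (hκ : κ = q / P) (hs : s = 1 + κ)
    (hb : b * q = -s) : ∃ C : ℝ, 1 ≤ C ∧ ∀ (K : ℝ) (F G : ℤ → ℝ), Dat κ s K F G →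
    ∀ (f : ℤ → ℝ) (T : ℝ), 0 ≤ T → C * (K * K ^ (1 / κ)) ≤ T ^ q → ∀ D a,
    (build b F G f D a).Test p q T := by
  obtain ⟨C, hC, h⟩ := Dat.testing hcp hcq hpq hκ hs hb
  have hp1 := hcp.lt
  have hq1 := hcq.lt
  have hP1 := hcp.symm.lt
  have hκ0 : 0 < κ := by rw [hκ]; apply div_pos <;> linarith
  have hs0 : 0 < s := by linarith
  have hb0 : b ≤ 0 := by
    by_contra hcon
    have : 0 < b * q := mul_pos (not_le.mp hcon) (by linarith)
    linarith
  refine ⟨C, hC, ?_⟩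
  intro K F G d f T hT hCT D
  have hK0 : 0 < K := by linarith [d.hK]
  induction D with
  | zero => intro a; trivial
  | succ D ih =>
    intro a
    have hpos : (0:ℤ) < 2 ^ D := by positivity
    have hpos' : (0:ℤ) < 2 ^ (D + 1) := by positivity
    refine ⟨?_, ?_, ih _, ih _⟩
    · have h1 := build_J hb0 (by linarith : 0 ≤ q) f d.hF d.hG (D + 1) a le_rfl
      have h2 := h K F G d a (2 ^ (D + 1))
      simp only [zero_add] at h1
      have h3 := h1.trans h2
      have e : (BT.node (((2 : ℝ) ^ (D + 1)) ^ b) (build b F G f D a) (build b F G f D (a + 2 ^ D))).sg =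
        F (a + 2 ^ (D + 1)) - F a := build_sg b F G f (D + 1) a
      rw [e]
      have hp0 : 0 ≤ F (a + 2 ^ (D + 1)) - F a := sub_nonneg.mpr (d.hF.monotone (by linarith))
      refine h3.trans ?_
      push_cast
      gcongr
    · rw [build_vv, build_sg]
      have a1 : 0 < F (a + 2 ^ D) - F a := sub_pos.mpr (d.hF (by linarith))
      have a2 : 0 < G (a + 2 ^ D + 2 ^ D) - G (a + 2 ^ D) := sub_pos.mpr (d.hG (by linarith))
      have h1 := d.h1 (a + 2 ^ D) (2 ^ D) (by positivity)
      push_cast at h1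
      rw [add_sub_cancel_right] at h1
      have e1 : (((2 : ℝ) ^ (D + 1)) ^ b) ^ q = ((2 : ℝ) ^ (D + 1)) ^ (-s) := by
        rw [← Real.rpow_mul (by positivity), hb]
      have e2 : (F (a + 2 ^ D) - F a) ^ q = (F (a + 2 ^ D) - F a) ^ κ * (F (a + 2 ^ D) - F a) ^ (q / p) := by
        rw [← Real.rpow_add a1]; congr 1
        rw [hκ, div_eq_mul_inv, div_eq_mul_inv, ← mul_add, add_comm, hcp.inv_add_inv_eq_one, mul_one]
      rw [e1, e2]
      have h3 : ((2 : ℝ) ^ (D + 1)) ^ (-s) * ((2:ℝ) ^ D) ^ s ≤ 1 := by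
        rw [Real.rpow_neg (by positivity), inv_mul_le_iff₀ (by positivity), mul_one]
        refine Real.rpow_le_rpow (by positivity) ?_ hs0.le
        exact pow_le_pow_right₀ (by norm_num) (by omega)
      have h4 : K ≤ T ^ q := by
        refine le_trans ?_ hCT
        have hk : 1 ≤ K ^ (1 / κ) := Real.one_le_rpow d.hK (by positivity)
        have : K * 1 ≤ K * K ^ (1 / κ) := by gcongr
        have : 1 * (K * K ^ (1 / κ)) ≤ C * (K * K ^ (1 / κ)) := by gcongr
        linarith
      calc _ = ((2 : ℝ) ^ (D + 1)) ^ (-s) * ((G (a + 2 ^ D + 2 ^ D) - G (a + 2 ^ D)) *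
            (F (a + 2 ^ D) - F a) ^ κ) * (F (a + 2 ^ D) - F a) ^ (q / p) := by ring
        _ ≤ ((2 : ℝ) ^ (D + 1)) ^ (-s) * (K * ((2:ℝ) ^ D) ^ s) * (F (a + 2 ^ D) - F a) ^ (q / p) := by
            gcongr
        _ = K * (((2 : ℝ) ^ (D + 1)) ^ (-s) * ((2:ℝ) ^ D) ^ s) * (F (a + 2 ^ D) - F a) ^ (q / p) := by ring
        _ ≤ T ^ q * 1 * (F (a + 2 ^ D) - F a) ^ (q / p) := by gcongr
        _ = _ := by ring

/-- Discrete theorem. -/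
theorem discrete_main {p q P Q b κ s : ℝ} (hcp : Real.HolderConjugate p P)
    (hcq : Real.HolderConjugate q Q) (hpq : p < q) (hκ : κ = q / P) (hs : s = 1 + κ)
    (hb : b * q = -s) : ∃ C : ℝ, 0 < C ∧ ∀ (K : ℝ) (F G : ℤ → ℝ), Dat κ s K F G →
    ∀ (f : ℤ → ℝ), (∀ a, 0 ≤ f a) → ∀ (D : ℕ) (a : ℤ) (E : ℝ), 0 < E →
      (build b F G f D a).EF p ≤ E →
      (build b F G f D a).Jf q 0 ≤ (C * K ^ (-b * max 1 (P / q))) ^ q * E ^ (q / p) := by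
  have hp1 := hcp.lt
  have hq1 := hcq.lt
  have hP1 := hcp.symm.lt
  have hQ1 := hcq.symm.lt
  have hκ0 : 0 < κ := by rw [hκ]; apply div_pos <;> linarith
  have ip := hcp.inv_add_inv_eq_one
  have iq := hcq.inv_add_inv_eq_one
  have hQP : Q < P := by
    have h3 : q⁻¹ < p⁻¹ := inv_strictAnti₀ (by linarith) hpq
    have h4 : P⁻¹ < Q⁻¹ := by linarith
    exact (inv_lt_inv₀ (by linarith) (by linarith)).mp h4
  have hb' : b = -(q⁻¹ + P⁻¹) := by
    have : b * q = -(q⁻¹ + P⁻¹) * q := by rw [hb, hs, hκ]; field_simp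
    exact mul_right_cancel₀ (by linarith) this
  obtain ⟨C0, hC0, hmain⟩ := BT.main hcp hcq hpq.le
  obtain ⟨C1, hC1, ht1⟩ := build_Test hcp hcq hpq hκ hs hb
  obtain ⟨C2, hC2, ht2⟩ := build_Test (b := b) (κ := 1 / κ) (s := s / κ) hcq.symm hcp.symm hQP
    (by rw [hκ]; field_simp) (by rw [hs]; field_simp; ring) (by
      rw [hb', hs, hκ]; field_simp)
  set C := max C1 C2 with hC
  have hC1' : C1 ≤ C := le_max_left _ _
  have hC2' : C2 ≤ C := le_max_right _ _
  have hCone : 1 ≤ C := hC1.trans hC1'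
  refine ⟨C0 * C, by positivity, ?_⟩
  intro K F G d f hf D a E hE hEF
  have hK1 := d.hK
  have hK0 : 0 < K := by linarith
  set e := -b * max 1 (P / q) with he
  have hbn : 0 < -b := by rw [hb']; simp; positivity
  set T := C * K ^ e with hT
  have hT0 : 0 < T := by positivity
  have hCq : ∀ r : ℝ, 1 < r → C ≤ C ^ r := fun r hr => by
    calc C = C ^ (1:ℝ) := (Real.rpow_one _).symm
      _ ≤ _ := Real.rpow_le_rpow_of_exponent_le hCone hr.le
  have T1 : C1 * (K * K ^ (1 / κ)) ≤ T ^ q := by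
    rw [hT, Real.mul_rpow (by positivity) (by positivity), ← Real.rpow_mul hK0.le]
    refine mul_le_mul (hC1'.trans (hCq q hq1)) ?_ (by positivity) (by positivity)
    have : K * K ^ (1 / κ) = K ^ (1 + 1 / κ) := by rw [Real.rpow_add hK0, Real.rpow_one]
    rw [this]
    refine Real.rpow_le_rpow_of_exponent_le hK1 ?_
    have h1 : -b * (P / q) ≤ e := mul_le_mul_of_nonneg_left (le_max_right _ _) hbn.le
    have h2 := mul_le_mul_of_nonneg_right h1 (show 0 ≤ q by linarith)
    refine le_trans (le_of_eq ?_) h2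
    rw [hb', hκ]; field_simp; ring
  have T2 : C2 * (K ^ (1 / κ) * (K ^ (1 / κ)) ^ (1 / (1 / κ))) ≤ T ^ P := by
    rw [hT, Real.mul_rpow (by positivity) (by positivity), ← Real.rpow_mul hK0.le, ← Real.rpow_mul hK0.le]
    refine mul_le_mul (hC2'.trans (hCq P hP1)) ?_ (by positivity) (by positivity)
    rw [← Real.rpow_add hK0]
    refine Real.rpow_le_rpow_of_exponent_le hK1 ?_
    have h1 : -b * 1 ≤ e := mul_le_mul_of_nonneg_left (le_max_left _ _) hbn.le
    have h2 := mul_le_mul_of_nonneg_right h1 (show 0 ≤ P by linarith)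
    refine le_trans (le_of_eq ?_) h2
    rw [hb', hκ]; field_simp
  have h1 := ht1 K F G d f T hT0.le T1 D a
  have h2 := ht2 _ _ _ (d.mir hκ0) 0 T hT0.le T2 D (-a - 2 ^ D)
  have h3 : (build b F G f D a).mir.Test Q P T := by
    rw [← BT.Test_skel, build_mir, BT.Test_skel]; exact h2
  have h4 := hmain T _ E hT0 (build_pos b d.hF d.hG hf D a) h1 h3 hE hEF
  rw [mul_assoc]
  exact h4

def kern (b : ℝ) (pt : ℤ → ℝ) : ℕ → ℤ → ℝ → ℝ → ℝ≥0∞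
  | 0, _, _, _ => 0
  | D + 1, a, x, t => if x ≤ pt (a + 2 ^ D) then kern b pt D a x t else
      (Set.Ioc (pt a) (pt (a + 2 ^ D))).indicator (fun _ => ENNReal.ofReal (((2 : ℝ) ^ (D + 1)) ^ b)) t +
        kern b pt D (a + 2 ^ D) x t

lemma kern_low (b : ℝ) {pt : ℤ → ℝ} (hpt : StrictMono pt) (h j : ℕ) : ∀ (k : ℕ) (a : ℤ) (x t : ℝ),
    k < 2 ^ j → pt (a + k * 2 ^ (h + 1)) < t → t ≤ pt (a + k * 2 ^ (h + 1) + 2 ^ h) →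
    pt (a + k * 2 ^ (h + 1) + 2 ^ h) < x → x ≤ pt (a + k * 2 ^ (h + 1) + 2 ^ (h + 1)) →
    ENNReal.ofReal (((2 : ℝ) ^ (h + 1)) ^ b) ≤ kern b pt (h + 1 + j) a x t := by
  induction j with
  | zero =>
    intro k a x t hk h1 h2 h3 h4
    have hk0 : k = 0 := by simpa using hk
    subst hk0
    simp only [Nat.cast_zero, zero_mul, add_zero] at h1 h2 h3 h4 ⊢
    simp only [kern]
    rw [if_neg (not_le.mpr h3), Set.indicator_of_mem (show t ∈ Set.Ioc (pt a) (pt (a + 2 ^ h)) from ⟨h1, h2⟩)]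
    exact le_self_add
  | succ j ih =>
    intro k a x t hk h1 h2 h3 h4
    have e : h + 1 + (j + 1) = (h + 1 + j) + 1 := by ring
    rw [e]
    simp only [kern]
    have hpow : (2:ℤ) ^ (h + 1 + j) = 2 ^ j * 2 ^ (h + 1) := by ring
    rcases lt_or_ge k (2 ^ j) with hkj | hkj
    · have hz : (k : ℤ) + 1 ≤ 2 ^ j := by exact_mod_cast hkj
      have hx : x ≤ pt (a + 2 ^ (h + 1 + j)) := by
        refine h4.trans (hpt.monotone ?_)
        rw [hpow]
        have := mul_le_mul_of_nonneg_right hz (show (0:ℤ) ≤ 2 ^ (h + 1) by positivity)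
        linarith
      rw [if_pos hx]
      exact ih k a x t hkj h1 h2 h3 h4
    · have hz : (2:ℤ) ^ j ≤ k := by exact_mod_cast hkj
      have hx : pt (a + 2 ^ (h + 1 + j)) < x := by
        refine lt_of_le_of_lt (hpt.monotone ?_) h3
        rw [hpow]
        have := mul_le_mul_of_nonneg_right hz (show (0:ℤ) ≤ 2 ^ (h + 1) by positivity)
        have : (0:ℤ) ≤ 2 ^ h := by positivity
        linarith
      rw [if_neg (not_le.mpr hx)]
      refine le_trans ?_ le_add_self
      have e2 : a + 2 ^ (h + 1 + j) + ((k - 2 ^ j : ℕ) : ℤ) * 2 ^ (h + 1) = a + k * 2 ^ (h + 1) := by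
        rw [Nat.cast_sub hkj, hpow]; push_cast; ring
      refine ih (k - 2 ^ j) (a + 2 ^ (h + 1 + j)) x t (by rw [pow_succ] at hk; omega) ?_ ?_ ?_ ?_ <;>
        rw [e2] <;> assumption

lemma build_ff {b : ℝ} {F G f : ℤ → ℝ} {pt : ℤ → ℝ} (hpt : StrictMono pt) {g : ℝ → ℝ≥0∞}
    (hf0 : ∀ a, 0 ≤ f a)
    (hf : ∀ a, ENNReal.ofReal (f a) = ∫⁻ t in Set.Ioc (pt a) (pt (a + 1)), g t) (D : ℕ) (a : ℤ) :
    0 ≤ (build b F G f D a).ff ∧ 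
    ENNReal.ofReal (build b F G f D a).ff = ∫⁻ t in Set.Ioc (pt a) (pt (a + 2 ^ D)), g t := by
  induction D generalizing a with
  | zero => simpa [build, BT.ff] using ⟨hf0 a, hf a⟩
  | succ D ih =>
    simp only [build, BT.ff]
    obtain ⟨h1, h2⟩ := ih a
    obtain ⟨h3, h4⟩ := ih (a + 2 ^ D)
    refine ⟨by positivity, ?_⟩
    have hp : (0:ℤ) < 2 ^ D := by positivity
    rw [ENNReal.ofReal_add h1 h3, h2, h4]
    have e : a + 2 ^ D + 2 ^ D = a + 2 ^ (D + 1) := by ring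
    rw [e, ← Set.Ioc_union_Ioc_eq_Ioc (hpt.monotone (show a ≤ a + 2 ^ D by linarith))
      (hpt.monotone (show a + 2 ^ D ≤ a + 2 ^ (D + 1) by rw [← e]; linarith)),
      lintegral_union measurableSet_Ioc (Set.Ioc_disjoint_Ioc_of_le le_rfl)]

lemma kern_int {b q ε : ℝ} (hq : 0 < q) (hε : 0 < ε) {F G f : ℤ → ℝ} {pt : ℤ → ℝ} (hpt : StrictMono pt)
    {g v : ℝ → ℝ≥0∞} (hg : Measurable g) (hv : Measurable v)
    (hf0 : ∀ a, 0 ≤ f a) (hG : Monotone G)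
    (hf : ∀ a, ENNReal.ofReal (f a) = ∫⁻ t in Set.Ioc (pt a) (pt (a + 1)), g t)
    (hGv : ∀ a, ENNReal.ofReal (ε * (G (a + 1) - G a)) = ∫⁻ t in Set.Ioc (pt a) (pt (a + 1)), v t)
    (D : ℕ) : ∀ (a : ℤ) (t0 : ℝ), 0 ≤ t0 → 0 ≤ (build b F G f D a).Jf q t0 ∧
    ∫⁻ x in Set.Ioc (pt a) (pt (a + 2 ^ D)), (ENNReal.ofReal t0 + ∫⁻ t, kern b pt D a x t * g t) ^ q * v x =
      ENNReal.ofReal (ε * (build b F G f D a).Jf q t0) := by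
  induction D with
  | zero =>
    intro a t0 ht0
    have hnn : 0 ≤ G (a + 1) - G a := sub_nonneg.mpr (hG (by linarith))
    simp only [build, BT.Jf, kern, zero_mul, lintegral_zero, add_zero, pow_zero]
    refine ⟨by positivity, ?_⟩
    rw [lintegral_const_mul _ hv, ← hGv a, ENNReal.ofReal_rpow_of_nonneg ht0 hq.le,
      ← ENNReal.ofReal_mul (by positivity)]
    congr 1; ring
  | succ D ih =>
    intro a t0 ht0
    obtain ⟨hff, hff'⟩ := build_ff (b := b) (F := F) (G := G) hpt hf0 hf D a
    have hμ : 0 ≤ ((2:ℝ) ^ (D + 1)) ^ b := by positivity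
    obtain ⟨h1, h2⟩ := ih a t0 ht0
    obtain ⟨h3, h4⟩ := ih (a + 2 ^ D) (t0 + ((2:ℝ) ^ (D + 1)) ^ b * (build b F G f D a).ff) (by positivity)
    have hp : (0:ℤ) < 2 ^ D := by positivity
    have e : a + 2 ^ D + 2 ^ D = a + 2 ^ (D + 1) := by ring
    simp only [build, BT.Jf]
    refine ⟨by positivity, ?_⟩
    rw [mul_add, ENNReal.ofReal_add (by positivity) (by positivity), ← h2, ← h4, e,
      ← Set.Ioc_union_Ioc_eq_Ioc (hpt.monotone (show a ≤ a + 2 ^ D by linarith))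
      (hpt.monotone (show a + 2 ^ D ≤ a + 2 ^ (D + 1) by rw [← e]; linarith)),
      lintegral_union measurableSet_Ioc (Set.Ioc_disjoint_Ioc_of_le le_rfl)]
    congr 1
    · refine setLIntegral_congr_fun measurableSet_Ioc fun x hx => ?_
      simp only [kern, if_pos hx.2]
    · refine setLIntegral_congr_fun measurableSet_Ioc fun x hx => ?_
      simp only [kern, if_neg (not_le.mpr hx.1)]
      congr 2
      have e3 : ∀ t, ((Set.Ioc (pt a) (pt (a + 2 ^ D))).indicator
          (fun _ => ENNReal.ofReal (((2 : ℝ) ^ (D + 1)) ^ b)) t + kern b pt D (a + 2 ^ D) x t) * g t =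
          (Set.Ioc (pt a) (pt (a + 2 ^ D))).indicator
          (fun t => ENNReal.ofReal (((2 : ℝ) ^ (D + 1)) ^ b) * g t) t + kern b pt D (a + 2 ^ D) x t * g t := by
        intro t
        rw [add_mul]; congr 1
        by_cases ht : t ∈ Set.Ioc (pt a) (pt (a + 2 ^ D))
        · rw [Set.indicator_of_mem ht, Set.indicator_of_mem ht]
        · rw [Set.indicator_of_notMem ht, Set.indicator_of_notMem ht, zero_mul]
      simp_rw [e3]
      rw [lintegral_add_left ((hg.const_mul _).indicator measurableSet_Ioc),
        lintegral_indicator measurableSet_Ioc, lintegral_const_mul _ hg, ← hff',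
        ← ENNReal.ofReal_mul hμ, ENNReal.ofReal_add ht0 (by positivity), add_assoc]

lemma five_res (n : ℕ) (z : ℤ) : ∃ i : ℕ, i < 5 ∧ ∃ k : ℤ, z = 2 ^ n * i + 5 * k := by
  have h : (2:ℤ) ^ n % 5 = 1 ∨ (2:ℤ) ^ n % 5 = 2 ∨ (2:ℤ) ^ n % 5 = 3 ∨ (2:ℤ) ^ n % 5 = 4 := by
    induction n with
    | zero => left; norm_num
    | succ n ih => rw [pow_succ]; omega
  generalize (2:ℤ) ^ n = u at h
  have hz : z % 5 = 0 ∨ z % 5 = 1 ∨ z % 5 = 2 ∨ z % 5 = 3 ∨ z % 5 = 4 := by omega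
  have key : (z - u * 0) % 5 = 0 ∨ (z - u * 1) % 5 = 0 ∨ (z - u * 2) % 5 = 0 ∨ (z - u * 3) % 5 = 0 ∨
    (z - u * 4) % 5 = 0 := by omega
  rcases key with h | h | h | h | h
  · exact ⟨0, by norm_num, z / 5, by push_cast; omega⟩
  · exact ⟨1, by norm_num, (z - u * 1) / 5, by push_cast; omega⟩
  · exact ⟨2, by norm_num, (z - u * 2) / 5, by push_cast; omega⟩
  · exact ⟨3, by norm_num, (z - u * 3) / 5, by push_cast; omega⟩
  · exact ⟨4, by norm_num, (z - u * 4) / 5, by push_cast; omega⟩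

/-- the five grids -/
def gp (R : ℝ) (D : ℕ) (i : ℕ) (a : ℤ) : ℝ :=
  -(5 * R) + ((i : ℝ) - 2) * (2 * R) + (10 * R / 2 ^ D) * a

lemma gp_mono {R : ℝ} (hR : 0 < R) (D i : ℕ) : StrictMono (gp R D i) := by
  intro a b hab
  have : (a : ℝ) < b := by exact_mod_cast hab
  unfold gp
  gcongr

lemma kern_dom {b R : ℝ} (hb : b ≤ 0) (hR : 0 < R) (D : ℕ) {x t : ℝ} (ht : -R < t) (hx : x < R)
    (hd : 2 * (10 * R / 2 ^ D) ≤ 4 * (x - t)) :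
    ENNReal.ofReal ((x - t) ^ b) ≤ ENNReal.ofReal ((4:ℝ) ^ (-b) * (10 * R / 2 ^ D) ^ b) *
      ∑ i ∈ Finset.range 5, kern b (gp R D i) D 0 x t := by
  set ε := 10 * R / 2 ^ D with hε
  have hε0 : 0 < ε := by positivity
  set d := x - t with hdd
  have hd0 : 0 < d := by linarith
  have hRε : 10 * R = ε * 2 ^ D := by rw [hε]; field_simp
  obtain ⟨m, hm1, hm2⟩ := exists_nat_pow_near (x := 4 * d / ε) (y := 2) (by
    rw [le_div_iff₀ hε0]; linarith) (by norm_num)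
  rw [le_div_iff₀ hε0] at hm1
  rw [div_lt_iff₀ hε0] at hm2
  have hm0 : m ≠ 0 := by
    rintro rfl
    norm_num at hm2; linarith
  obtain ⟨h, rfl⟩ := Nat.exists_eq_succ_of_ne_zero hm0
  simp only [Nat.succ_eq_add_one] at *
  have hmD : h + 1 < D := by
    have : (2:ℝ) ^ (h + 1) * ε < 2 ^ D * ε := by
      refine lt_of_le_of_lt hm1 ?_
      have : d < 2 * R := by linarith
      linarith
    have := lt_of_mul_lt_mul_right this hε0.le
    exact (pow_lt_pow_iff_right₀ (by norm_num)).mp this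
  obtain ⟨n, rfl⟩ := Nat.exists_eq_add_of_lt hmD
  set ℓ := ε * 2 ^ (h + 1) with hℓ
  have hℓ0 : 0 < ℓ := by positivity
  have hℓ1 : ℓ ≤ 4 * d := by rw [hℓ]; linarith
  have hℓ2 : 2 * d < ℓ := by rw [hℓ]; rw [pow_succ] at hm2; linarith
  set n' := n + 1 with hn'
  have hD : h + 1 + n + 1 = h + 1 + n' := by rw [hn']; ring
  rw [hD] at *
  have hL : 10 * R = ℓ * 2 ^ n' := by rw [hRε, hℓ, pow_add]; ring
  set base := -(5 * R) - 4 * R + ℓ / 2 with hbase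
  set z := round (((t + x) / 2 - base) / (ℓ / 5)) with hz
  have hround := abs_sub_round (((t + x) / 2 - base) / (ℓ / 5))
  rw [← hz] at hround
  obtain ⟨i, hi5, k, hk⟩ := five_res n' z
  set mid := base + (ℓ / 5) * z with hmid
  have hmidd : |(t + x) / 2 - mid| ≤ ℓ / 10 := by
    have : (t + x) / 2 - mid = (((t + x) / 2 - base) / (ℓ / 5) - z) * (ℓ / 5) := by
      rw [hmid]; field_simp; ring
    rw [this, abs_mul, abs_of_pos (show 0 < ℓ / 5 by positivity)]
    have := mul_le_mul_of_nonneg_right hround (show 0 ≤ ℓ / 5 by positivity)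
    linarith
  rw [abs_le] at hmidd
  have hmeq : mid = gp R (h + 1 + n') i 0 + ℓ * ((k:ℝ) + 1 / 2) := by
    rw [hmid, hbase, hk]; unfold gp; push_cast
    have : ℓ / 5 * (2 ^ n' * (i:ℝ) + 5 * k) = (ℓ * 2 ^ n') * i / 5 + ℓ * k := by ring
    rw [this, ← hL]; ring
  have hi5' : (i : ℝ) ≤ 4 := by
    have : i ≤ 4 := by omega
    exact_mod_cast this
  have hi0 : (0:ℝ) ≤ i := by positivity
  have hg0 : gp R (h + 1 + n') i 0 = -(5 * R) + ((i : ℝ) - 2) * (2 * R) := by unfold gp; simp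
  have hg1 : gp R (h + 1 + n') i 0 ≤ -R := by rw [hg0]; nlinarith
  have hg2 : -(9 * R) ≤ gp R (h + 1 + n') i 0 := by rw [hg0]; nlinarith
  have hk0 : 0 ≤ k := by
    by_contra hcon
    have : (k:ℝ) ≤ -1 := by exact_mod_cast (by omega : k ≤ -1)
    nlinarith
  have hk1 : k < 2 ^ n' := by
    by_contra hcon
    have : (2:ℝ) ^ n' ≤ k := by exact_mod_cast (not_lt.mp hcon)
    have := mul_le_mul_of_nonneg_left this hℓ0.le
    rw [← hL] at this
    linarith
  obtain ⟨k', rfl⟩ := Int.eq_ofNat_of_zero_le hk0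
  have hgp : ∀ c : ℤ, gp R (h + 1 + n') i c = gp R (h + 1 + n') i 0 + ε * c := by
    intro c; unfold gp
    have hε' : 10 * R / 2 ^ (h + 1 + n') = ε := hε.symm
    rw [hε']; simp
  have hε2 : ℓ = 2 * (ε * 2 ^ h) := by rw [hℓ, pow_succ]; ring
  have e1 : gp R (h + 1 + n') i (0 + (k':ℤ) * 2 ^ (h + 1)) = mid - ℓ / 2 := by
    rw [hgp, hmeq]; push_cast; rw [hℓ]; ring
  have e2 : gp R (h + 1 + n') i (0 + (k':ℤ) * 2 ^ (h + 1) + 2 ^ h) = mid := by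
    rw [hgp, hmeq]; push_cast; rw [hℓ]; ring
  have e3 : gp R (h + 1 + n') i (0 + (k':ℤ) * 2 ^ (h + 1) + 2 ^ (h + 1)) = mid + ℓ / 2 := by
    rw [hgp, hmeq]; push_cast; rw [hℓ]; ring
  have hlow := kern_low b (gp_mono hR (h + 1 + n') i) h n' k' 0 x t (by exact_mod_cast hk1)
    (by rw [e1]; linarith) (by rw [e2]; linarith) (by rw [e2]; linarith) (by rw [e3]; linarith)
  have hsum : kern b (gp R (h + 1 + n') i) (h + 1 + n') 0 x t ≤
      ∑ i ∈ Finset.range 5, kern b (gp R (h + 1 + n') i) (h + 1 + n') 0 x t :=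
    Finset.single_le_sum (f := fun i => kern b (gp R (h + 1 + n') i) (h + 1 + n') 0 x t)
      (fun _ _ => zero_le) (Finset.mem_range.mpr hi5)
  refine le_trans ?_ (mul_le_mul_right (hlow.trans hsum) _)
  rw [← ENNReal.ofReal_mul (by positivity)]
  refine ENNReal.ofReal_le_ofReal ?_
  rw [mul_assoc, ← Real.mul_rpow hε0.le (by positivity), ← hℓ]
  have : (4:ℝ) ^ (-b) * ℓ ^ b = (ℓ / 4) ^ b := by
    rw [Real.div_rpow hℓ0.le (by norm_num), Real.rpow_neg (by norm_num)]; field_simp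
  rw [this]
  exact Real.rpow_le_rpow_of_nonpos (by positivity) (by linarith) hb

structure CW (P q κ s K : ℝ) (w : ℝ → ℝ) : Prop where
  meas : Measurable w
  pos : ∀ t, 0 < w t
  hK : 1 ≤ K
  isg : ∀ x y, IntervalIntegrable (fun t => w t ^ (-P)) volume x y
  iv : ∀ x y, IntervalIntegrable (fun t => w t ^ q) volume x y
  h1 : ∀ x h, 0 < h → (∫ t in x..x + h, w t ^ q) * (∫ t in (x - h)..x, w t ^ (-P)) ^ κ ≤ K * h ^ s
  h2 : ∀ x h, 0 < h → h ^ s ≤ (∫ t in x..x + h, w t ^ q) * (∫ t in x..x + h, w t ^ (-P)) ^ κ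

lemma ofReal_ii {φ : ℝ → ℝ} (h0 : ∀ t, 0 ≤ φ t) {x y : ℝ} (hxy : x ≤ y)
    (hi : IntervalIntegrable φ volume x y) :
    ENNReal.ofReal (∫ t in x..y, φ t) = ∫⁻ t in Set.Ioc x y, ENNReal.ofReal (φ t) := by
  rw [intervalIntegral.integral_of_le hxy]
  exact ofReal_integral_eq_lintegral_ofReal hi.1 (Eventually.of_forall h0)

lemma leaf_holder {p P : ℝ} (hcp : Real.HolderConjugate p P) {w : ℝ → ℝ} (hw : Measurable w)
    (hpos : ∀ t, 0 < w t) {g : ℝ → ℝ≥0∞} (hg : Measurable g) (S : Set ℝ) :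
    ∫⁻ t in S, g t ≤ (∫⁻ t in S, g t ^ p * ENNReal.ofReal (w t ^ p)) ^ (1 / p) *
      (∫⁻ t in S, ENNReal.ofReal (w t ^ (-P))) ^ (1 / P) := by
  have h := ENNReal.lintegral_mul_le_Lp_mul_Lq (volume.restrict S) hcp
    (f := fun t => g t * ENNReal.ofReal (w t)) (g := fun t => ENNReal.ofReal ((w t)⁻¹))
    (by fun_prop) (by fun_prop)
  have e1 : ∀ t, ((fun t => g t * ENNReal.ofReal (w t)) * (fun t => ENNReal.ofReal ((w t)⁻¹))) t = g t := by
    intro t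
    simp only [Pi.mul_apply]
    rw [mul_assoc, ← ENNReal.ofReal_mul (hpos t).le, mul_inv_cancel₀ (hpos t).ne']; simp
  have e2 : ∀ t, (g t * ENNReal.ofReal (w t)) ^ p = g t ^ p * ENNReal.ofReal (w t ^ p) := by
    intro t
    rw [ENNReal.mul_rpow_of_nonneg _ _ hcp.nonneg, ENNReal.ofReal_rpow_of_pos (hpos t)]
  have e3 : ∀ t, ENNReal.ofReal ((w t)⁻¹) ^ P = ENNReal.ofReal (w t ^ (-P)) := by
    intro t
    rw [ENNReal.ofReal_rpow_of_pos (inv_pos.mpr (hpos t)), Real.inv_rpow (hpos t).le, Real.rpow_neg (hpos t).le]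
  simp only [e1, e2, e3] at h
  exact h

section
variable {p q P κ s K b : ℝ} {w : ℝ → ℝ}

lemma CW.dat (h : CW P q κ s K w) (hκ : 0 < κ) (hs : s = 1 + κ) {x0 ε : ℝ} (hε : 0 < ε) :
    Dat κ s K (fun a => ε⁻¹ * ∫ t in x0..(x0 + ε * a), w t ^ (-P))
      (fun a => ε⁻¹ * ∫ t in x0..(x0 + ε * a), w t ^ q) := by
  have key : ∀ (φ : ℝ → ℝ) (_ : ∀ x y, IntervalIntegrable φ volume x y) (a c : ℤ),
      ε⁻¹ * (∫ t in x0..(x0 + ε * a), φ t) - ε⁻¹ * (∫ t in x0..(x0 + ε * c), φ t) =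
       ε⁻¹ * ∫ t in (x0 + ε * c)..(x0 + ε * a), φ t := by
    intro φ hφ a c
    rw [← mul_sub, intervalIntegral.integral_interval_sub_left (hφ _ _) (hφ _ _)]
  have mono : ∀ (φ : ℝ → ℝ) (_ : ∀ x y, IntervalIntegrable φ volume x y) (_ : ∀ t, 0 < φ t),
      StrictMono (fun a : ℤ => ε⁻¹ * ∫ t in x0..(x0 + ε * a), φ t) := by
    intro φ hφ hp a c hac
    have : (a:ℝ) < c := by exact_mod_cast hac
    have := intervalIntegral.intervalIntegral_pos_of_pos (hφ (x0 + ε * a) (x0 + ε * c)) hp (by gcongr)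
    have h2 := key φ hφ c a
    have : 0 < ε⁻¹ * ∫ t in (x0 + ε * a)..(x0 + ε * c), φ t := by positivity
    simp only
    linarith
  have sc : ∀ (A B n : ℝ), 0 ≤ A → 0 ≤ B → 0 < n → (ε⁻¹ * A) * (ε⁻¹ * B) ^ κ = A * B ^ κ * (ε ^ s)⁻¹ := by
    intro A B n hA hB hn
    rw [Real.mul_rpow (by positivity) hB, Real.inv_rpow hε.le, hs, Real.rpow_add hε, Real.rpow_one, mul_inv]
    ring
  have nn : ∀ (φ : ℝ → ℝ) (_ : ∀ t, 0 < φ t) (x y : ℝ), x ≤ y → 0 ≤ ∫ t in x..y, φ t := fun φ hφ x y hxy =>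
    intervalIntegral.integral_nonneg hxy (fun t _ => (hφ t).le)
  have hsg : ∀ t, 0 < w t ^ (-P) := fun t => Real.rpow_pos_of_pos (h.pos t) _
  have hv : ∀ t, 0 < w t ^ q := fun t => Real.rpow_pos_of_pos (h.pos t) _
  have hεs : 0 < ε ^ s := Real.rpow_pos_of_pos hε _
  refine ⟨mono _ h.isg hsg, mono _ h.iv hv, h.hK, ?_, ?_⟩
  · intro x n hn
    have hn' : (0:ℝ) < n := by exact_mod_cast hn
    rw [key _ h.isg, key _ h.iv, sc _ _ n (nn _ hv _ _ (by push_cast; nlinarith))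
      (nn _ hsg _ _ (by push_cast; nlinarith)) hn', mul_inv_le_iff₀ hεs, mul_assoc,
      ← Real.mul_rpow hn'.le hε.le]
    have := h.h1 (x0 + ε * x) (n * ε) (by positivity)
    have e1 : x0 + ε * ((x + n : ℤ) : ℝ) = x0 + ε * x + n * ε := by push_cast; ring
    have e2 : x0 + ε * ((x - n : ℤ) : ℝ) = x0 + ε * x - n * ε := by push_cast; ring
    rw [e1, e2]; exact this
  · intro x n hn
    have hn' : (0:ℝ) < n := by exact_mod_cast hn
    rw [key _ h.isg, key _ h.iv, sc _ _ n (nn _ hv _ _ (by push_cast; nlinarith))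
      (nn _ hsg _ _ (by push_cast; nlinarith)) hn', le_mul_inv_iff₀ hεs,
      ← Real.mul_rpow hn'.le hε.le]
    have := h.h2 (x0 + ε * x) (n * ε) (by positivity)
    have e1 : x0 + ε * ((x + n : ℤ) : ℝ) = x0 + ε * x + n * ε := by push_cast; ring
    rw [e1]; exact this

lemma EF_build {b p ε : ℝ} {F G f : ℤ → ℝ} {pt : ℤ → ℝ} (hpt : StrictMono pt) {e : ℝ → ℝ≥0∞}
    (hε : 0 ≤ ε)
    (he : ∀ a, ENNReal.ofReal (en p (F (a + 1) - F a) (f a)) ≤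
      ENNReal.ofReal ε * ∫⁻ t in Set.Ioc (pt a) (pt (a + 1)), e t) (D : ℕ) (a : ℤ) :
    ENNReal.ofReal ((build b F G f D a).EF p) ≤
      ENNReal.ofReal ε * ∫⁻ t in Set.Ioc (pt a) (pt (a + 2 ^ D)), e t := by
  induction D generalizing a with
  | zero => simpa [build, BT.EF] using he a
  | succ D ih =>
    simp only [build, BT.EF]
    refine ENNReal.ofReal_add_le.trans ((add_le_add (ih a) (ih (a + 2 ^ D))).trans ?_)
    have e1 : a + 2 ^ D + 2 ^ D = a + 2 ^ (D + 1) := by ring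
    rw [e1, ← mul_add, ← lintegral_union measurableSet_Ioc, Set.Ioc_union_Ioc_eq_Ioc]
    · exact hpt.monotone (by have : (0:ℤ) < 2 ^ D := by positivity
                             omega)
    · rw [← e1]; exact hpt.monotone (by have : (0:ℤ) < 2 ^ D := by positivity
                                        omega)
    · rw [Set.Ioc_disjoint_Ioc]
      exact (min_le_left _ _).trans (le_max_right _ _)

theorem grid_bound {Q : ℝ} (hcp : Real.HolderConjugate p P)
    (hcq : Real.HolderConjugate q Q) (hpq : p < q) (hκ : κ = q / P) (hs : s = 1 + κ)
    (hb : b * q = -s) : ∃ C : ℝ, 0 < C ∧ ∀ (K : ℝ) (w : ℝ → ℝ), CW P q κ s K w →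
    ∀ (g : ℝ → ℝ≥0∞), Measurable g → ∀ E : ℝ, 0 < E →
      ∫⁻ t, g t ^ p * ENNReal.ofReal (w t ^ p) ≤ ENNReal.ofReal E →
      ∀ (x0 ε : ℝ), 0 < ε → ∀ D : ℕ,
        ∫⁻ x in Set.Ioc x0 (x0 + ε * 2 ^ D),
          (ENNReal.ofReal (ε ^ b) * ∫⁻ t, kern b (fun a : ℤ => x0 + ε * a) D 0 x t * g t) ^ q *
            ENNReal.ofReal (w x ^ q) ≤
          ENNReal.ofReal ((C * K ^ (-b * max 1 (P / q))) ^ q * E ^ (q / p)) := by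
  obtain ⟨C, hC, H⟩ := discrete_main hcp hcq hpq hκ hs hb
  refine ⟨C, hC, fun K w h g hg E hE hgE x0 ε hε D => ?_⟩
  have hp0 := hcp.pos
  have hP0 := hcp.symm.pos
  have hq0 := hcq.pos
  have hκ0 : 0 < κ := by rw [hκ]; positivity
  have hsg : ∀ t, 0 < w t ^ (-P) := fun t => Real.rpow_pos_of_pos (h.pos t) _
  have hv : ∀ t, 0 < w t ^ q := fun t => Real.rpow_pos_of_pos (h.pos t) _
  have d := h.dat hκ0 hs (x0 := x0) hε
  set F : ℤ → ℝ := (fun a => ε⁻¹ * ∫ t in x0..(x0 + ε * a), w t ^ (-P)) with hF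
  set G : ℤ → ℝ := (fun a => ε⁻¹ * ∫ t in x0..(x0 + ε * a), w t ^ q) with hG
  set pt : ℤ → ℝ := fun a : ℤ => x0 + ε * a with hptd
  have hpt : StrictMono pt := by
    intro a c hac
    have : (a : ℝ) < c := by exact_mod_cast hac
    simp only [hptd]; gcongr
  have key : ∀ (φ : ℝ → ℝ) (_ : ∀ x y, IntervalIntegrable φ volume x y) (a c : ℤ),
      ε⁻¹ * (∫ t in x0..(x0 + ε * a), φ t) - ε⁻¹ * (∫ t in x0..(x0 + ε * c), φ t) =
       ε⁻¹ * ∫ t in (pt c)..(pt a), φ t := by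
    intro φ hφ a c
    rw [← mul_sub, intervalIntegral.integral_interval_sub_left (hφ _ _) (hφ _ _)]
  have hle : ∀ a, pt a ≤ pt (a + 1) := fun a => hpt.monotone (by omega)
  -- leaf masses
  have hA : ∀ a, ENNReal.ofReal (ε * (F (a + 1) - F a)) =
      ∫⁻ t in Set.Ioc (pt a) (pt (a + 1)), ENNReal.ofReal (w t ^ (-P)) := by
    intro a
    rw [← ofReal_ii (fun t => (hsg t).le) (hle a) (h.isg _ _)]
    simp only [hF]
    rw [key _ h.isg]
    congr 1; field_simp
  have hV : ∀ a, ENNReal.ofReal (ε * (G (a + 1) - G a)) =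
      ∫⁻ t in Set.Ioc (pt a) (pt (a + 1)), ENNReal.ofReal (w t ^ q) := by
    intro a
    rw [← ofReal_ii (fun t => (hv t).le) (hle a) (h.iv _ _)]
    simp only [hG]
    rw [key _ h.iv]
    congr 1; field_simp
  have hFpos : ∀ a, 0 < F (a + 1) - F a := fun a => sub_pos.mpr (d.hF (by omega))
  have hEfin : ∀ S : Set ℝ, ∫⁻ t in S, g t ^ p * ENNReal.ofReal (w t ^ p) ≠ ∞ := fun S =>
    ne_top_of_le_ne_top ENNReal.ofReal_ne_top ((setLIntegral_le_lintegral S _).trans hgE)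
  have hhol := fun a => leaf_holder hcp h.meas h.pos hg (Set.Ioc (pt a) (pt (a + 1)))
  have hgfin : ∀ a, ∫⁻ t in Set.Ioc (pt a) (pt (a + 1)), g t ≠ ∞ := by
    intro a
    refine ne_top_of_le_ne_top ?_ (hhol a)
    rw [← hA]
    exact ENNReal.mul_ne_top (ENNReal.rpow_ne_top_of_nonneg (by positivity) (hEfin _))
      (ENNReal.rpow_ne_top_of_nonneg (by positivity) ENNReal.ofReal_ne_top)
  set f : ℤ → ℝ := fun a => (∫⁻ t in Set.Ioc (pt a) (pt (a + 1)), g t).toReal with hfd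
  have hf0 : ∀ a, 0 ≤ f a := fun a => ENNReal.toReal_nonneg
  have hf : ∀ a, ENNReal.ofReal (f a) = ∫⁻ t in Set.Ioc (pt a) (pt (a + 1)), g t := fun a =>
    ENNReal.ofReal_toReal (hgfin a)
  have hPp : p / P = p - 1 := by
    have := hcp.sub_one_mul_conj
    field_simp; linarith
  have hleaf : ∀ a, ENNReal.ofReal (en p (F (a + 1) - F a) (f a)) ≤
      ENNReal.ofReal (ε ^ (p - 1)) * ∫⁻ t in Set.Ioc (pt a) (pt (a + 1)), g t ^ p * ENNReal.ofReal (w t ^ p) := by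
    intro a
    have h1 := hhol a
    rw [← hf, ← hA] at h1
    have h2 := ENNReal.rpow_le_rpow h1 hp0.le
    rw [ENNReal.mul_rpow_of_nonneg _ _ hp0.le, ← ENNReal.rpow_mul, ← ENNReal.rpow_mul,
      one_div_mul_cancel hp0.ne', ENNReal.rpow_one, one_div_mul_eq_div, hPp,
      ENNReal.ofReal_rpow_of_nonneg (hf0 a) hp0.le,
      ENNReal.ofReal_rpow_of_pos (mul_pos hε (hFpos a))] at h2
    unfold en
    rw [ENNReal.ofReal_mul (by have := hf0 a; positivity)]
    refine (mul_le_mul_left h2 _).trans ?_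
    rw [mul_assoc, ← ENNReal.ofReal_mul (by have := hFpos a; positivity), mul_comm]
    refine mul_le_mul_left (ENNReal.ofReal_le_ofReal (le_of_eq ?_)) _
    rw [Real.mul_rpow hε.le (hFpos a).le, mul_assoc, ← Real.rpow_add (hFpos a)]
    simp
  have hEF := EF_build (b := b) (G := G) hpt (Real.rpow_nonneg hε.le _) hleaf D 0
  have hEF2 : (build b F G f D 0).EF p ≤ ε ^ (p - 1) * E := by
    rw [← ENNReal.ofReal_le_ofReal_iff (by positivity)]
    refine hEF.trans ?_
    rw [ENNReal.ofReal_mul (by positivity)]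
    exact mul_le_mul_right ((setLIntegral_le_lintegral _ _).trans hgE) _
  have hJ := H K F G d f hf0 D 0 (ε ^ (p - 1) * E) (by positivity) hEF2
  have hI := (kern_int (b := b) hq0 hε (F := F) hpt hg (v := fun t => ENNReal.ofReal (w t ^ q))
    (by have := h.meas; fun_prop) hf0 d.hG.monotone hf hV D 0 0 le_rfl).2
  have hset : Set.Ioc (pt 0) (pt (0 + 2 ^ D)) = Set.Ioc x0 (x0 + ε * 2 ^ D) := by
    simp [hptd]
  rw [hset] at hI
  simp only [ENNReal.ofReal_zero, zero_add] at hI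
  have hεb : 0 < ε ^ b := Real.rpow_pos_of_pos hε _
  simp only [ENNReal.mul_rpow_of_nonneg _ _ hq0.le, mul_assoc]
  rw [lintegral_const_mul' _ _ (ENNReal.rpow_ne_top_of_nonneg hq0.le ENNReal.ofReal_ne_top), hI,
    ENNReal.ofReal_rpow_of_pos hεb, ← ENNReal.ofReal_mul (by positivity)]
  refine ENNReal.ofReal_le_ofReal ?_
  have hK0 : 0 < K := by linarith [h.hK]
  calc (ε ^ b) ^ q * (ε * (build b F G f D 0).Jf q 0)
      ≤ (ε ^ b) ^ q * (ε * ((C * K ^ (-b * max 1 (P / q))) ^ q * (ε ^ (p - 1) * E) ^ (q / p))) := by gcongr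
    _ = ((ε ^ b) ^ q * ε * (ε ^ (p - 1)) ^ (q / p)) * ((C * K ^ (-b * max 1 (P / q))) ^ q * E ^ (q / p)) := by
        rw [Real.mul_rpow (by positivity) hE.le]; ring
    _ = _ := by
        have : (ε ^ b) ^ q * ε * (ε ^ (p - 1)) ^ (q / p) = 1 := by
          rw [← Real.rpow_mul hε.le, ← Real.rpow_mul hε.le]
          nth_rewrite 2 [← Real.rpow_one ε]
          rw [← Real.rpow_add hε, ← Real.rpow_add hε, hb, hs, hκ, ← hPp]
          have : -(1 + q / P) + 1 + p / P * (q / p) = 0 := by field_simp; ring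
          rw [this, Real.rpow_zero]
        rw [this, one_mul]
end

lemma kern_meas (b : ℝ) (pt : ℤ → ℝ) (D : ℕ) : ∀ a : ℤ, Measurable (fun z : ℝ × ℝ => kern b pt D a z.1 z.2) := by
  induction D with
  | zero => intro a; simp only [kern]; exact measurable_const
  | succ D ih =>
    intro a
    simp only [kern]
    refine Measurable.ite (measurableSet_le measurable_fst measurable_const) (ih a) (Measurable.add ?_ (ih _))
    exact (measurable_const.indicator measurableSet_Ioc).comp measurable_snd

def kt (b : ℝ) (g : ℝ → ℝ≥0∞) (R η x t : ℝ) : ℝ≥0∞ :=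
  if -R < x ∧ x < R ∧ -R < t ∧ t < x - η then g t * ENNReal.ofReal ((x - t) ^ b) else 0

lemma kt_meas (b : ℝ) {g : ℝ → ℝ≥0∞} (hg : Measurable g) (R η : ℝ) :
    Measurable (fun z : ℝ × ℝ => kt b g R η z.1 z.2) := by
  unfold kt
  refine Measurable.ite ?_ (by fun_prop) measurable_const
  refine MeasurableSet.inter (measurableSet_lt measurable_const measurable_fst) ?_
  refine MeasurableSet.inter (measurableSet_lt measurable_fst measurable_const) ?_
  refine MeasurableSet.inter (measurableSet_lt measurable_const measurable_snd) ?_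
  exact measurableSet_lt measurable_snd (by fun_prop)

section
variable {p q P κ s K b : ℝ} {w : ℝ → ℝ}

theorem trunc_bound {Q : ℝ} (hcp : Real.HolderConjugate p P)
    (hcq : Real.HolderConjugate q Q) (hpq : p < q) (hκ : κ = q / P) (hs : s = 1 + κ)
    (hb : b * q = -s) (hb0 : b ≤ 0) : ∃ C : ℝ, 0 < C ∧ ∀ (K : ℝ) (w : ℝ → ℝ), CW P q κ s K w →
    ∀ (g : ℝ → ℝ≥0∞), Measurable g → ∀ E : ℝ, 0 < E →
      ∫⁻ t, g t ^ p * ENNReal.ofReal (w t ^ p) ≤ ENNReal.ofReal E →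
      ∀ (R η : ℝ), 0 < R → 0 < η → 
        ∫⁻ x, (∫⁻ t, kt b g R η x t) ^ q * ENNReal.ofReal (w x ^ q) ≤
          ENNReal.ofReal ((C * K ^ (-b * max 1 (P / q))) ^ q * E ^ (q / p)) := by
  obtain ⟨C, hC, H⟩ := grid_bound hcp hcq hpq hκ hs hb
  have hq0 := hcq.pos
  have hq1 := hcq.lt
  refine ⟨(4:ℝ) ^ (-b) * 5 * C, by positivity, fun K w h g hg E hE hgE R η hR hη => ?_⟩
  have hK0 : 0 < K := by linarith [h.hK]
  obtain ⟨D, hD⟩ : ∃ D : ℕ, 10 * R / (2 * η) < 2 ^ D := pow_unbounded_of_one_lt _ (by norm_num)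
  have hD' : 10 * R / 2 ^ D ≤ 2 * η := by
    rw [div_lt_iff₀ (by positivity)] at hD
    rw [div_le_iff₀ (by positivity)]; linarith
  set ε := 10 * R / 2 ^ D with hε
  have hε0 : 0 < ε := by positivity
  set Y : ℕ → ℝ → ℝ≥0∞ := fun i x => ENNReal.ofReal (ε ^ b) * ∫⁻ t, kern b (gp R D i) D 0 x t * g t with hY
  have hYm : ∀ i, Measurable (Y i) := by
    intro i
    refine Measurable.const_mul ?_ _
    exact Measurable.lintegral_prod_right' (f := fun z : ℝ × ℝ => kern b (gp R D i) D 0 z.1 z.2 * g z.2)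
      ((kern_meas b _ D 0).mul (hg.comp measurable_snd))
  have hpt : ∀ x, ∫⁻ t, kt b g R η x t ≤ (Set.Ioo (-R) R).indicator (fun x => ENNReal.ofReal ((4:ℝ) ^ (-b)) *
      ∑ i ∈ Finset.range 5, Y i x) x := by
    intro x
    by_cases hx : x ∈ Set.Ioo (-R) R
    · rw [Set.indicator_of_mem hx]
      have : ∀ t, kt b g R η x t ≤ ENNReal.ofReal ((4:ℝ) ^ (-b) * ε ^ b) *
          ∑ i ∈ Finset.range 5, kern b (gp R D i) D 0 x t * g t := by
        intro t
        unfold kt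
        split_ifs with hc
        · have := kern_dom hb0 hR D hc.2.2.1 hx.2 (by linarith [hc.2.2.2])
          rw [← Finset.sum_mul, ← mul_assoc, mul_comm]
          exact mul_le_mul_left this _
        · exact zero_le
      refine (lintegral_mono this).trans ?_
      rw [lintegral_const_mul' _ _ ENNReal.ofReal_ne_top, lintegral_finset_sum, ENNReal.ofReal_mul (by positivity),
        mul_assoc, Finset.mul_sum]
      intro i _
      exact ((kern_meas b (gp R D i) D 0).comp (measurable_prodMk_left (x := x))).mul hg
    · rw [Set.indicator_of_notMem hx]
      have : ∀ t, kt b g R η x t = 0 := by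
        intro t
        unfold kt
        rw [if_neg]
        exact fun hc => hx ⟨hc.1, hc.2.1⟩
      simp [this]
  set M := (C * K ^ (-b * max 1 (P / q))) ^ q * E ^ (q / p) with hM
  have hYi : ∀ i ∈ Finset.range 5, ∫⁻ x in Set.Ioo (-R) R, Y i x ^ q * ENNReal.ofReal (w x ^ q) ≤ ENNReal.ofReal M := by
    intro i hi
    have hi4 : i ≤ 4 := by have := Finset.mem_range.mp hi; omega
    have hi4' : (i : ℝ) ≤ 4 := by exact_mod_cast hi4
    have hi0 : (0:ℝ) ≤ i := by positivity
    refine le_trans (lintegral_mono_set ?_) (H K w h g hg E hE hgE (-(5 * R) + ((i : ℝ) - 2) * (2 * R)) ε hε0 D)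
    have : ε * 2 ^ D = 10 * R := by rw [hε]; field_simp
    rw [this]
    intro x hx
    constructor
    · nlinarith [hx.1]
    · nlinarith [hx.2]
  have hvm : Measurable (fun x => ENNReal.ofReal (w x ^ q)) := by have := h.meas; fun_prop
  calc ∫⁻ x, (∫⁻ t, kt b g R η x t) ^ q * ENNReal.ofReal (w x ^ q)
      ≤ ∫⁻ x in Set.Ioo (-R) R, ENNReal.ofReal (((4:ℝ) ^ (-b)) ^ q * 5 ^ (q - 1)) *
          ∑ i ∈ Finset.range 5, Y i x ^ q * ENNReal.ofReal (w x ^ q) := by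
        rw [← lintegral_indicator measurableSet_Ioo]
        refine lintegral_mono fun x => ?_
        refine (mul_le_mul_left (ENNReal.rpow_le_rpow (hpt x) hq0.le) _).trans ?_
        by_cases hx : x ∈ Set.Ioo (-R) R
        · rw [Set.indicator_of_mem hx, Set.indicator_of_mem hx]
          rw [← Finset.sum_mul, ← mul_assoc]
          refine mul_le_mul_left ?_ _
          rw [ENNReal.mul_rpow_of_nonneg _ _ hq0.le, ENNReal.ofReal_rpow_of_pos (by positivity),
            ENNReal.ofReal_mul (by positivity), mul_assoc]
          refine mul_le_mul_right ?_ _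
          have := ENNReal.rpow_sum_le_const_mul_sum_rpow (Finset.range 5) (fun i => Y i x) hq1.le
          simp only [Finset.card_range] at this
          refine this.trans (mul_le_mul_left (le_of_eq ?_) _)
          rw [← ENNReal.ofReal_rpow_of_pos (by norm_num)]
          norm_num
        · rw [Set.indicator_of_notMem hx, Set.indicator_of_notMem hx]
          simp [ENNReal.zero_rpow_of_pos hq0]
    _ = ENNReal.ofReal (((4:ℝ) ^ (-b)) ^ q * 5 ^ (q - 1)) *
          ∑ i ∈ Finset.range 5, ∫⁻ x in Set.Ioo (-R) R, Y i x ^ q * ENNReal.ofReal (w x ^ q) := by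
        rw [lintegral_const_mul' _ _ ENNReal.ofReal_ne_top, lintegral_finset_sum]
        intro i _
        exact ((hYm i).pow_const q).mul hvm
    _ ≤ ENNReal.ofReal (((4:ℝ) ^ (-b)) ^ q * 5 ^ (q - 1)) * (5 * ENNReal.ofReal M) := by
        refine mul_le_mul_right ((Finset.sum_le_sum hYi).trans ?_) _
        simp
    _ = _ := by
        have : (5 : ℝ≥0∞) = ENNReal.ofReal 5 := by norm_num
        have hM0 : 0 ≤ M := by positivity
        rw [this, ← ENNReal.ofReal_mul (by norm_num), ← ENNReal.ofReal_mul (by positivity)]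
        congr 1
        rw [mul_assoc, mul_assoc, Real.mul_rpow (by positivity) (by positivity), Real.mul_rpow (by positivity) (by positivity), hM]
        have : (5:ℝ) ^ (q - 1) = 5 ^ q / 5 := by rw [Real.rpow_sub_one (by norm_num)]
        rw [this]; ring

theorem cw_bound {Q : ℝ} (hcp : Real.HolderConjugate p P)
    (hcq : Real.HolderConjugate q Q) (hpq : p < q) (hκ : κ = q / P) (hs : s = 1 + κ)
    (hb : b * q = -s) (hb0 : b ≤ 0) : ∃ C : ℝ, 0 < C ∧ ∀ (K : ℝ) (w : ℝ → ℝ), CW P q κ s K w →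
    ∀ (g : ℝ → ℝ≥0∞), Measurable g → ∀ E : ℝ, 0 < E →
      ∫⁻ t, g t ^ p * ENNReal.ofReal (w t ^ p) ≤ ENNReal.ofReal E →
        ∫⁻ x, (∫⁻ t in Set.Iio x, g t * ENNReal.ofReal ((x - t) ^ b)) ^ q * ENNReal.ofReal (w x ^ q) ≤
          ENNReal.ofReal ((C * K ^ (-b * max 1 (P / q))) ^ q * E ^ (q / p)) := by
  obtain ⟨C, hC, H⟩ := trunc_bound hcp hcq hpq hκ hs hb hb0
  refine ⟨C, hC, fun K w h g hg E hE hgE => ?_⟩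
  have hq0 := hcq.pos
  have hvm : Measurable (fun x => ENNReal.ofReal (w x ^ q)) := by have := h.meas; fun_prop
  set M := (C * K ^ (-b * max 1 (P / q))) ^ q * E ^ (q / p) with hM
  set T : ℕ → ℝ → ℝ≥0∞ := fun n x => ∫⁻ t, kt b g (n + 1) (1 / ((n:ℝ) + 1)) x t with hT
  have hTm : ∀ n, Measurable (T n) := fun n =>
    Measurable.lintegral_prod_right' (f := fun z : ℝ × ℝ => kt b g (n + 1) (1 / ((n:ℝ) + 1)) z.1 z.2) (kt_meas b hg _ _)
  have hlim : ∀ x, Tendsto (fun n => T n x) atTop (nhds (∫⁻ t in Set.Iio x, g t * ENNReal.ofReal ((x - t) ^ b))) := by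
    intro x
    rw [← lintegral_indicator measurableSet_Iio]
    refine lintegral_tendsto_of_tendsto_of_monotone (fun n =>
      ((kt_meas b hg _ _).comp (measurable_prodMk_left (x := x))).aemeasurable) ?_ ?_
    · refine Eventually.of_forall fun t n m hnm => ?_
      have hnm' : (n : ℝ) ≤ m := by exact_mod_cast hnm
      have h2 : 1 / ((m:ℝ) + 1) ≤ 1 / ((n:ℝ) + 1) := by gcongr
      simp only [kt, Function.comp]
      split_ifs with h1 h3
      · exact le_rfl
      · exact absurd ⟨by linarith [h1.1], by linarith [h1.2.1], by linarith [h1.2.2.1], by linarith [h1.2.2.2]⟩ h3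
      · exact zero_le
      · exact le_rfl
    · refine Eventually.of_forall fun t => ?_
      by_cases htx : t < x
      · refine tendsto_const_nhds.congr' ?_
        have l1 : Tendsto (fun n : ℕ => (n:ℝ) + 1) atTop atTop :=
          tendsto_atTop_add_const_right _ _ tendsto_natCast_atTop_atTop
        have l2 : Tendsto (fun n : ℕ => 1 / ((n:ℝ) + 1)) atTop (nhds 0) := tendsto_one_div_add_atTop_nhds_zero_nat
        filter_upwards [l1.eventually_gt_atTop (max |x| |t|), l2.eventually_lt_const (sub_pos.mpr htx)] with n h1 h2
        have a1 := abs_lt.mp ((le_max_left _ _).trans_lt h1)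
        have a2 := abs_lt.mp ((le_max_right _ _).trans_lt h1)
        rw [Set.indicator_of_mem (show t ∈ Set.Iio x from htx)]
        simp only [kt, Function.comp]
        rw [if_pos ⟨a1.1, a1.2, a2.1, by linarith⟩]
      · refine tendsto_const_nhds.congr' (Eventually.of_forall fun n => ?_)
        rw [Set.indicator_of_notMem (show t ∉ Set.Iio x from htx)]
        simp only [kt, Function.comp]
        rw [if_neg]
        rintro ⟨_, _, _, h4⟩
        have : (0:ℝ) < 1 / ((n:ℝ) + 1) := by positivity
        linarith
  have hlim2 : ∀ x, (∫⁻ t in Set.Iio x, g t * ENNReal.ofReal ((x - t) ^ b)) ^ q * ENNReal.ofReal (w x ^ q) =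
      liminf (fun n => T n x ^ q * ENNReal.ofReal (w x ^ q)) atTop := by
    intro x
    refine (Tendsto.liminf_eq ?_).symm
    exact ENNReal.Tendsto.mul_const ((ENNReal.continuous_rpow_const.tendsto _).comp (hlim x))
      (Or.inr ENNReal.ofReal_ne_top)
  simp only [hlim2]
  refine (lintegral_liminf_le fun n => ((hTm n).pow_const q).mul hvm).trans ?_
  refine liminf_le_of_frequently_le' (Frequently.of_forall fun n => ?_)
  exact H K w h g hg E hE hgE _ _ (by positivity) (by positivity)
end

section
variable {p q P κ s b : ℝ} {w : ℝ → ℝ}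

lemma lint_pos {φ : ℝ → ℝ} (hm : Measurable φ) (hp : ∀ t, 0 < φ t) {x y : ℝ} (hxy : x < y) :
    0 < ∫⁻ t in Set.Ioc x y, ENNReal.ofReal (φ t) := by
  rw [setLIntegral_pos_iff (by fun_prop)]
  have : (Function.support fun t => ENNReal.ofReal (φ t)) = univ := by
    ext t; simp [hp t]
  rw [this]
  simp [hxy]

lemma char_term {X : ℝ≥0∞} (hX : apqMinusChar p q w = X) (x : ℝ) {h : ℝ} (hh : 0 < h) :
    ((ENNReal.ofReal h)⁻¹ * ∫⁻ t in Set.Ioc x (x + h), ENNReal.ofReal (w t ^ q)) *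
      ((ENNReal.ofReal h)⁻¹ * ∫⁻ t in Set.Ioc (x - h) x, ENNReal.ofReal (w t ^ (-(p / (p - 1))))) ^ (q / (p / (p - 1))) ≤ X := by
  have := le_iSup₂_of_le (f := fun (x : ℝ) (h : ℝ) => ⨆ (_ : 0 < h),
    avgIoc (fun t => w t ^ q) x (x + h) *
      avgIoc (fun t => w t ^ (-(p / (p - 1)))) (x - h) x ^ (q / (p / (p - 1)))) x h
      (le_iSup_of_le hh le_rfl)
  rw [← hX]
  refine le_trans (le_of_eq ?_) this
  simp only [avgIoc, lintIoc, add_sub_cancel_left, sub_sub_cancel]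

lemma toCW (hcp : Real.HolderConjugate p P) (hP : P = p / (p - 1)) (hq : 0 < q) (hκ : κ = q / P) (hs : s = 1 + κ)
    (hw : Measurable w) (hpos : ∀ t, 0 < w t) (hX : apqMinusChar p q w ≠ ∞) :
    CW P q κ s (apqMinusChar p q w).toReal w := by
  have hP0 := hcp.symm.pos
  have hκ0 : 0 < κ := by rw [hκ]; positivity
  have hsg : ∀ t, 0 < w t ^ (-P) := fun t => Real.rpow_pos_of_pos (hpos t) _
  have hv : ∀ t, 0 < w t ^ q := fun t => Real.rpow_pos_of_pos (hpos t) _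
  have ms : Measurable (fun t => w t ^ (-P)) := by fun_prop
  have mv : Measurable (fun t => w t ^ q) := by fun_prop
  have ct := fun x {h : ℝ} (hh : 0 < h) => char_term (p := p) (q := q) (w := w) rfl x hh
  rw [← hP, ← hκ] at ct
  set X := apqMinusChar p q w with hXd
  have posV : ∀ x h : ℝ, 0 < h → ((ENNReal.ofReal h)⁻¹ * ∫⁻ t in Set.Ioc x (x + h), ENNReal.ofReal (w t ^ q)) ≠ 0 := by
    intro x h hh
    exact mul_ne_zero (by simp) (lint_pos mv hv (by linarith)).ne'
  have posS : ∀ x h : ℝ, 0 < h → ((ENNReal.ofReal h)⁻¹ * ∫⁻ t in Set.Ioc (x - h) x, ENNReal.ofReal (w t ^ (-P))) ^ κ ≠ 0 := by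
    intro x h hh
    rw [Ne, ENNReal.rpow_eq_zero_iff_of_pos hκ0]
    exact mul_ne_zero (by simp) (lint_pos ms hsg (by linarith)).ne'
  have finV : ∀ x h : ℝ, 0 < h → ∫⁻ t in Set.Ioc x (x + h), ENNReal.ofReal (w t ^ q) ≠ ∞ := by
    intro x h hh hcon
    have := ct x hh
    rw [hcon, ENNReal.mul_top (by simp), ENNReal.top_mul (posS x h hh)] at this
    exact hX (top_le_iff.mp this)
  have finS : ∀ x h : ℝ, 0 < h → ∫⁻ t in Set.Ioc (x - h) x, ENNReal.ofReal (w t ^ (-P)) ≠ ∞ := by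
    intro x h hh hcon
    have := ct x hh
    rw [hcon, ENNReal.mul_top (by simp), ENNReal.top_rpow_of_pos hκ0, ENNReal.mul_top (posV x h hh)] at this
    exact hX (top_le_iff.mp this)
  have ion : ∀ (φ : ℝ → ℝ), Measurable φ → (∀ t, 0 < φ t) → 
      (∀ x h : ℝ, 0 < h → ∫⁻ t in Set.Ioc x (x + h), ENNReal.ofReal (φ t) ≠ ∞) →
      ∀ x y, IntegrableOn φ (Set.Ioc x y) volume := by
    intro φ hm hp hf x y
    rcases lt_or_ge x y with hxy | hxy
    · refine ⟨hm.aestronglyMeasurable, ?_⟩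
      rw [hasFiniteIntegral_iff_ofReal (Eventually.of_forall fun t => (hp t).le)]
      have := hf x (y - x) (by linarith)
      rw [add_sub_cancel] at this
      exact this.lt_top
    · rw [Set.Ioc_eq_empty (not_lt.mpr hxy)]; exact integrableOn_empty
  have iv : ∀ x y, IntervalIntegrable (fun t => w t ^ q) volume x y := fun x y =>
    ⟨ion _ mv hv finV x y, ion _ mv hv finV y x⟩
  have finS' : ∀ x h : ℝ, 0 < h → ∫⁻ t in Set.Ioc x (x + h), ENNReal.ofReal (w t ^ (-P)) ≠ ∞ := by
    intro x h hh
    have := finS (x + h) h hh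
    rwa [add_sub_cancel_right] at this
  have isg : ∀ x y, IntervalIntegrable (fun t => w t ^ (-P)) volume x y := fun x y =>
    ⟨ion _ ms hsg finS' x y, ion _ ms hsg finS' y x⟩
  have nn : ∀ (φ : ℝ → ℝ) (_ : ∀ t, 0 < φ t) (x y : ℝ), x ≤ y → 0 ≤ ∫ t in x..y, φ t := fun φ hφ x y hxy =>
    intervalIntegral.integral_nonneg hxy (fun t _ => (hφ t).le)
  have h1' : ∀ x h : ℝ, 0 < h → (h⁻¹ * ∫ t in x..x + h, w t ^ q) * (h⁻¹ * ∫ t in (x - h)..x, w t ^ (-P)) ^ κ ≤ X.toReal := by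
    intro x h hh
    have := ct x hh
    have n1 := nn _ hv x (x + h) (by linarith)
    have n2 := nn _ hsg (x - h) x (by linarith)
    rw [← ofReal_ii (fun t => (hv t).le) (by linarith) (iv _ _),
      ← ofReal_ii (fun t => (hsg t).le) (by linarith) (isg _ _), ← ENNReal.ofReal_inv_of_pos hh,
      ← ENNReal.ofReal_mul (by positivity), ← ENNReal.ofReal_mul (by positivity),
      ENNReal.ofReal_rpow_of_nonneg (by positivity) hκ0.le, ← ENNReal.ofReal_mul (by positivity)] at this
    exact (ENNReal.ofReal_le_iff_le_toReal hX).mp this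
  refine ⟨hw, hpos, ?_, isg, iv, ?_, ?_⟩
  · -- K ≥ 1
    have li : ∀ (φ : ℝ → ℝ), (∀ x y, IntegrableOn φ (Set.Ioc x y) volume) → LocallyIntegrable φ volume := by
      intro φ hφ x
      exact ⟨Set.Ioc (x - 1) (x + 1), Ioc_mem_nhds (by linarith) (by linarith), hφ _ _⟩
    have d1 := LocallyIntegrable.ae_hasDerivAt_integral (li _ (ion _ mv hv finV))
    have d2 := LocallyIntegrable.ae_hasDerivAt_integral (li _ (ion _ ms hsg finS'))
    obtain ⟨x, hx1, hx2⟩ := (d1.and d2).exists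
    have t1 := (hx1 0).tendsto_slope_zero_right
    have t2 := (hx2 0).tendsto_slope_zero_left
    have t3 : Tendsto (fun h : ℝ => -h) (nhdsWithin 0 (Set.Ioi 0)) (nhdsWithin 0 (Set.Iio 0)) := by
      simpa using tendsto_neg_nhdsGT (a := (0:ℝ))
    have t4 := t2.comp t3
    have t5 := t1.mul (t4.rpow_const (Or.inr hκ0.le))
    have hlim : w x ^ q * (w x ^ (-P)) ^ κ = 1 := by
      rw [← Real.rpow_mul (hpos x).le, ← Real.rpow_add (hpos x), hκ]
      have : q + -P * (q / P) = 0 := by field_simp; ring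
      rw [this, Real.rpow_zero]
    rw [hlim] at t5
    refine le_of_tendsto t5 ?_
    filter_upwards [self_mem_nhdsWithin] with h hh
    have hh' : 0 < h := hh
    have := h1' x h hh'
    simp only [Function.comp, smul_eq_mul]
    rw [intervalIntegral.integral_interval_sub_left (iv _ _) (iv _ _),
      intervalIntegral.integral_interval_sub_left (isg _ _) (isg _ _), intervalIntegral.integral_symm (x + -h) x]
    rw [← sub_eq_add_neg, inv_neg, neg_mul_neg]
    exact this
  · intro x h hh
    have := h1' x h hh
    have n1 := nn _ hv x (x + h) (by linarith)
    have n2 := nn _ hsg (x - h) x (by linarith)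
    rw [Real.mul_rpow (by positivity) n2, Real.inv_rpow hh.le] at this
    rw [hs, Real.rpow_add hh, Real.rpow_one, ← div_le_iff₀ (by positivity)]
    refine le_trans (le_of_eq ?_) this
    field_simp
  · intro x h hh
    have hs1 : 1 < s := by linarith
    have hcs : Real.HolderConjugate s (s / κ) := by
      rw [Real.holderConjugate_iff]
      refine ⟨hs1, ?_⟩
      rw [hs]; field_simp
    have H := ENNReal.lintegral_mul_le_Lp_mul_Lq (volume.restrict (Set.Ioc x (x + h))) hcs
      (f := fun t => ENNReal.ofReal (w t ^ (q / s))) (g := fun t => ENNReal.ofReal (w t ^ (-(q / s))))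
      (by fun_prop) (by fun_prop)
    have e1 : ∀ t, ((fun t => ENNReal.ofReal (w t ^ (q / s))) * (fun t => ENNReal.ofReal (w t ^ (-(q / s))))) t = 1 := by
      intro t
      simp only [Pi.mul_apply]
      rw [← ENNReal.ofReal_mul (Real.rpow_nonneg (hpos t).le _), ← Real.rpow_add (hpos t)]; simp
    have e2 : ∀ t, ENNReal.ofReal (w t ^ (q / s)) ^ s = ENNReal.ofReal (w t ^ q) := by
      intro t
      rw [ENNReal.ofReal_rpow_of_pos (Real.rpow_pos_of_pos (hpos t) _), ← Real.rpow_mul (hpos t).le]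
      congr 2; field_simp
    have e3 : ∀ t, ENNReal.ofReal (w t ^ (-(q / s))) ^ (s / κ) = ENNReal.ofReal (w t ^ (-P)) := by
      intro t
      rw [ENNReal.ofReal_rpow_of_pos (Real.rpow_pos_of_pos (hpos t) _), ← Real.rpow_mul (hpos t).le]
      congr 2; rw [hκ]; field_simp
    simp only [e1, e2, e3] at H
    have n1 := nn _ hv x (x + h) (by linarith)
    have n2 := nn _ hsg x (x + h) (by linarith)
    rw [← ofReal_ii (fun t => (hv t).le) (by linarith) (iv _ _),
      ← ofReal_ii (fun t => (hsg t).le) (by linarith) (isg _ _)] at H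
    simp only [lintegral_const, Measure.restrict_apply MeasurableSet.univ, univ_inter, Real.volume_Ioc,
      add_sub_cancel_left, one_mul] at H
    rw [ENNReal.ofReal_rpow_of_nonneg n1 (by positivity), ENNReal.ofReal_rpow_of_nonneg n2 (by positivity),
      ← ENNReal.ofReal_mul (by positivity), ENNReal.ofReal_le_ofReal_iff (by positivity)] at H
    have H2 := Real.rpow_le_rpow hh.le H hcs.nonneg
    rw [Real.mul_rpow (by positivity) (by positivity), ← Real.rpow_mul n1, ← Real.rpow_mul n2,
      one_div_mul_cancel hcs.pos.ne', Real.rpow_one] at H2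
    refine H2.trans (le_of_eq ?_)
    congr 2
    field_simp

/-- measurable minorant -/
lemma exists_ess (F : ℝ → ℝ≥0∞) : ∃ g : ℝ → ℝ≥0∞, Measurable g ∧ g ≤ F ∧
    ∀ h : ℝ → ℝ≥0∞, Measurable h → h ≤ F → h ≤ᵐ[volume] g := by
  set φ : ℝ≥0∞ → ℝ≥0∞ := fun x => (x⁻¹ + 1)⁻¹ with hφ
  set ψ : ℝ≥0∞ → ℝ≥0∞ := fun y => (y⁻¹ - 1)⁻¹ with hψ
  have hφψ : ∀ x, ψ (φ x) = x := by
    intro x; simp [hφ, hψ]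
  have mφ : Monotone φ := by
    intro x y hxy; simp only [hφ]; gcongr
  have mψ : Monotone ψ := by
    intro x y hxy; simp only [hψ]
    rw [ENNReal.inv_le_inv]
    exact tsub_le_tsub_right (ENNReal.inv_le_inv.mpr hxy) _
  have φ1 : ∀ x, φ x ≤ 1 := by
    intro x; simp only [hφ]; rw [ENNReal.inv_le_one]; exact le_add_self
  obtain ⟨g1, hg1, hle, hint⟩ := exists_measurable_le_lintegral_eq (μ := (volume : Measure ℝ).toFinite) (fun t => φ (F t))
  have mψ' : Measurable ψ := mψ.measurable
  refine ⟨fun t => ψ (g1 t), mψ'.comp hg1, fun t => ?_, fun h hh hhF => ?_⟩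
  · have := mψ (hle t); simp only [hφψ] at this; exact this
  · have mh : Measurable (fun t => φ (h t)) := mφ.measurable.comp hh
    have h1 : g1 ≤ᵐ[(volume : Measure ℝ).toFinite] (fun t => max (g1 t) (φ (h t))) :=
      Eventually.of_forall fun t => le_max_left _ _
    have hfin : ∫⁻ t, g1 t ∂(volume : Measure ℝ).toFinite ≠ ∞ := by
      refine ne_top_of_le_ne_top (measure_ne_top (volume : Measure ℝ).toFinite univ) ?_
      calc _ ≤ ∫⁻ t, 1 ∂(volume : Measure ℝ).toFinite := lintegral_mono fun t => (hle t).trans (φ1 _)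
        _ = _ := by simp
    have h2 := ae_eq_of_ae_le_of_lintegral_le h1 hfin (hg1.max mh).aemeasurable (by
      rw [← hint]
      exact lintegral_mono fun t => max_le (hle t) (mφ (hhF t)))
    have h3 := (absolutelyContinuous_toFinite (volume : Measure ℝ)).ae_le h2
    filter_upwards [h3] with t ht
    have : φ (h t) ≤ g1 t := by rw [ht]; exact le_max_right _ _
    have := mψ this
    rwa [hφψ] at this

lemma ess_int {F g : ℝ → ℝ≥0∞} (hg : ∀ h : ℝ → ℝ≥0∞, Measurable h → h ≤ F → h ≤ᵐ[volume] g)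
    {k : ℝ → ℝ≥0∞} (hk : Measurable k) (hkt : ∀ t, k t ≠ ∞) : ∫⁻ t, F t * k t ≤ ∫⁻ t, g t * k t := by
  obtain ⟨h, hm, hle, hint⟩ := exists_measurable_le_lintegral_eq (μ := (volume : Measure ℝ)) (fun t => F t * k t)
  rw [hint]
  have := hg (fun t => h t / k t) (hm.div hk) (fun t => ENNReal.div_le_of_le_mul (hle t))
  refine lintegral_mono_ae ?_
  filter_upwards [this] with t ht
  by_cases h0 : k t = 0
  · have := hle t; simp only [h0, mul_zero] at this ⊢; exact this
  · exact (ENNReal.div_le_iff h0 (hkt t)).mp ht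

end

lemma char_congr {p q : ℝ} {w w' : ℝ → ℝ} (h : w =ᵐ[volume] w') : apqMinusChar p q w = apqMinusChar p q w' := by
  have : ∀ (r x y : ℝ), avgIoc (fun t => w t ^ r) x y = avgIoc (fun t => w' t ^ r) x y := by
    intro r x y
    unfold avgIoc lintIoc
    congr 1
    refine lintegral_congr_ae (ae_restrict_of_ae ?_)
    filter_upwards [h] with t ht
    rw [ht]
  unfold apqMinusChar
  simp only [this]

lemma lnormW_congr {r p : ℝ} {w w' : ℝ → ℝ} (h : w =ᵐ[volume] w') (g : ℝ → ℝ≥0∞) :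
    lnormW p (fun t => w t ^ r) g = lnormW p (fun t => w' t ^ r) g := by
  unfold lnormW
  congr 1
  refine lintegral_congr_ae ?_
  filter_upwards [h] with t ht
  rw [ht]

theorem upper (p q α : ℝ) (hα : 0 < α) (hα1 : α < 1) (hp : 1 < p) (hpα : p < 1 / α)
    (hq : q = p / (1 - α * p)) :
    ∃ c : ℝ, 0 < c ∧
      ∀ w : ℝ → ℝ, IsWeight w → apqMinusChar p q w ≠ ∞ →
        ∀ f : ℝ → ℝ,
          lnormW q (fun x => w x ^ q) (Ralpha α f) ≤
            ENNReal.ofReal c *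
                apqMinusChar p q w ^ ((1 - α) * max 1 ((p / (p - 1)) / q)) *
              lnormW p (fun x => w x ^ p) (fun x => ENNReal.ofReal |f x|) := by
  have hp0 : 0 < p := by linarith
  have hden : 0 < 1 - α * p := by
    rw [lt_div_iff₀ hα] at hpα; linarith
  have hpq : p < q := by
    rw [hq, lt_div_iff₀ hden]; nlinarith [mul_pos hα hp0]
  have hq0 : 0 < q := by linarith
  set P := p / (p - 1) with hP
  have hcp : Real.HolderConjugate p P := Real.HolderConjugate.conjExponent hp
  have hcq : Real.HolderConjugate q (q / (q - 1)) := Real.HolderConjugate.conjExponent (by linarith)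
  have hP0 := hcp.symm.pos
  have hb : (α - 1) * q = -(1 + q / P) := by
    have h1 : p - 1 ≠ 0 := by linarith
    rw [hP, hq]; field_simp; ring
  obtain ⟨C, hC, H⟩ := cw_bound hcp hcq hpq rfl rfl hb (by linarith)
  refine ⟨C, hC, fun w0 hw0 hX0 f => ?_⟩
  -- representative
  have hae := hw0.2.aestronglyMeasurable
  set w : ℝ → ℝ := fun t => if 0 < hae.mk w0 t then hae.mk w0 t else 1 with hw
  have hmk : Measurable (hae.mk w0) := hae.stronglyMeasurable_mk.measurable
  have hwm : Measurable w := Measurable.ite (measurableSet_lt measurable_const hmk) hmk measurable_const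
  have hwpos : ∀ t, 0 < w t := by
    intro t; simp only [hw]; split_ifs with h
    · exact h
    · exact one_pos
  have hww : w0 =ᵐ[volume] w := by
    filter_upwards [hae.ae_eq_mk, hw0.1] with t h1 h2
    simp only [hw]; rw [← h1, if_pos h2]
  rw [lnormW_congr hww, lnormW_congr hww, char_congr hww]
  rw [char_congr hww] at hX0
  have hcw := toCW hcp hP hq0 rfl rfl hwm hwpos hX0
  set X := apqMinusChar p q w with hXd
  set K := X.toReal with hK
  have hXK : X = ENNReal.ofReal K := (ENNReal.ofReal_toReal hX0).symm
  have hK1 : 1 ≤ K := hcw.hK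
  have hK0 : 0 < K := by linarith
  set e := (1 - α) * max 1 (P / q) with he
  have he' : -(α - 1) * max 1 (P / q) = e := by rw [he]; ring
  rw [he'] at H
  rw [hXK, ENNReal.ofReal_rpow_of_pos hK0, ← ENNReal.ofReal_mul hC.le]
  have hKe : 0 < K ^ e := Real.rpow_pos_of_pos hK0 _
  -- measurable minorant
  obtain ⟨g, hg, hgF, hgess⟩ := exists_ess (fun t => ENNReal.ofReal |f t|)
  have hR : ∀ x, Ralpha α f x ≤ ∫⁻ t in Set.Iio x, g t * ENNReal.ofReal ((x - t) ^ (α - 1)) := by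
    intro x
    have := ess_int hgess (k := (Set.Iio x).indicator fun t => ENNReal.ofReal ((x - t) ^ (α - 1)))
      ((by fun_prop : Measurable fun t => ENNReal.ofReal ((x - t) ^ (α - 1))).indicator measurableSet_Iio) (by
        intro t; by_cases ht : t ∈ Set.Iio x
        · rw [Set.indicator_of_mem ht]; exact ENNReal.ofReal_ne_top
        · rw [Set.indicator_of_notMem ht]; exact ENNReal.zero_ne_top)
    have e1 : ∀ (u : ℝ → ℝ≥0∞) t, u t * (Set.Iio x).indicator (fun t => ENNReal.ofReal ((x - t) ^ (α - 1))) t =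
        (Set.Iio x).indicator (fun t => u t * ENNReal.ofReal ((x - t) ^ (α - 1))) t := by
      intro u t; by_cases ht : t ∈ Set.Iio x
      · rw [Set.indicator_of_mem ht, Set.indicator_of_mem ht]
      · rw [Set.indicator_of_notMem ht, Set.indicator_of_notMem ht, mul_zero]
    have e2 := e1 g
    have e3 := e1 (fun t => ENNReal.ofReal |f t|)
    simp only [e2, e3] at this
    rw [lintegral_indicator measurableSet_Iio, lintegral_indicator measurableSet_Iio] at this
    unfold Ralpha
    refine le_trans (le_of_eq ?_) this
    refine lintegral_congr fun t => ?_
    rw [ENNReal.ofReal_mul (abs_nonneg _)]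
  set E0 := ∫⁻ t, g t ^ p * ENNReal.ofReal (w t ^ p) with hE0
  have hEle : E0 ^ (1 / p) ≤ lnormW p (fun x => w x ^ p) (fun x => ENNReal.ofReal |f x|) := by
    unfold lnormW
    refine ENNReal.rpow_le_rpow (lintegral_mono fun t => ?_) (by positivity)
    exact mul_le_mul_left (ENNReal.rpow_le_rpow (hgF t) hp0.le) _
  refine le_trans ?_ (mul_le_mul_right hEle _)
  have hL : lnormW q (fun x => w x ^ q) (Ralpha α f) ≤ lnormW q (fun x => w x ^ q)
      (fun x => ∫⁻ t in Set.Iio x, g t * ENNReal.ofReal ((x - t) ^ (α - 1))) := by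
    unfold lnormW
    refine ENNReal.rpow_le_rpow (lintegral_mono fun t => ?_) (by positivity)
    exact mul_le_mul_left (ENNReal.rpow_le_rpow (hR t) hq0.le) _
  refine hL.trans ?_
  by_cases hE : E0 = ∞
  · rw [hE, ENNReal.top_rpow_of_pos (by positivity), ENNReal.mul_top]
    · exact le_top
    · simpa using by positivity
  have hfin : ∀ E : ℝ, E0.toReal < E → lnormW q (fun x => w x ^ q)
      (fun x => ∫⁻ t in Set.Iio x, g t * ENNReal.ofReal ((x - t) ^ (α - 1))) ≤ ENNReal.ofReal (C * K ^ e * E ^ (1 / p)) := by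
    intro E hEE
    have hEp : 0 < E := ENNReal.toReal_nonneg.trans_lt hEE
    have := H K w hcw g hg E hEp (by
      rw [← hE0, ← ENNReal.ofReal_toReal hE]; exact ENNReal.ofReal_le_ofReal hEE.le)
    have h2 := ENNReal.rpow_le_rpow this (show 0 ≤ 1 / q by positivity)
    refine h2.trans (le_of_eq ?_)
    rw [ENNReal.ofReal_rpow_of_pos (by positivity)]
    congr 1
    rw [Real.mul_rpow (by positivity) (by positivity), ← Real.rpow_mul (by positivity), ← Real.rpow_mul hEp.le,
      mul_one_div_cancel hq0.ne', Real.rpow_one]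
    congr 2; field_simp
  have hlim : Tendsto (fun E : ℝ => ENNReal.ofReal (C * K ^ e * E ^ (1 / p))) (nhdsWithin E0.toReal (Set.Ioi E0.toReal))
      (nhds (ENNReal.ofReal (C * K ^ e * E0.toReal ^ (1 / p)))) := by
    refine tendsto_nhdsWithin_of_tendsto_nhds ?_
    refine ENNReal.tendsto_ofReal (Tendsto.const_mul _ ?_)
    exact (Real.continuous_rpow_const (by positivity)).tendsto _
  have hfinal := ge_of_tendsto hlim (by
    filter_upwards [self_mem_nhdsWithin] with E hEE using hfin E hEE)
  refine hfinal.trans (le_of_eq ?_)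
  rw [ENNReal.ofReal_mul (by positivity), ← ENNReal.ofReal_rpow_of_nonneg ENNReal.toReal_nonneg (by positivity),
    ENNReal.ofReal_toReal hE]

lemma one_le_char {p q : ℝ} (hp : 1 < p) (hq : 0 < q) {w0 : ℝ → ℝ} (hw0 : IsWeight w0)
    (hX0 : apqMinusChar p q w0 ≠ ∞) : 1 ≤ apqMinusChar p q w0 := by
  set P := p / (p - 1) with hP
  have hcp : Real.HolderConjugate p P := Real.HolderConjugate.conjExponent hp
  have hae := hw0.2.aestronglyMeasurable
  set w : ℝ → ℝ := fun t => if 0 < hae.mk w0 t then hae.mk w0 t else 1 with hw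
  have hmk : Measurable (hae.mk w0) := hae.stronglyMeasurable_mk.measurable
  have hwm : Measurable w := Measurable.ite (measurableSet_lt measurable_const hmk) hmk measurable_const
  have hwpos : ∀ t, 0 < w t := by
    intro t; simp only [hw]; split_ifs with h
    · exact h
    · exact one_pos
  have hww : w0 =ᵐ[volume] w := by
    filter_upwards [hae.ae_eq_mk, hw0.1] with t h1 h2
    simp only [hw]; rw [← h1, if_pos h2]
  rw [char_congr hww] at hX0 ⊢
  have hcw := toCW hcp hP hq rfl rfl hwm hwpos hX0
  have := hcw.hK
  rw [← ENNReal.ofReal_toReal hX0]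
  exact ENNReal.one_le_ofReal.mpr this

lemma neg_int (F : ℝ → ℝ≥0∞) (x y : ℝ) : ∫⁻ t in Set.Ioo (-y) (-x), F (-t) = ∫⁻ t in Set.Ioo x y, F t := by
  have := (Measure.measurePreserving_neg (volume : Measure ℝ)).setLIntegral_comp_preimage_emb
    (MeasurableEquiv.neg ℝ).measurableEmbedding F (Set.Ioo x y)
  rw [← this]
  simp

lemma pw_int {d L : ℝ} (hd : 0 < d) (hL : 0 ≤ L) :
    ∫⁻ t in Set.Ioo 0 L, ENNReal.ofReal (t ^ (d - 1)) = ENNReal.ofReal (L ^ d / d) := by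
  have h1 : IntervalIntegrable (fun t : ℝ => t ^ (d - 1)) volume 0 L :=
    intervalIntegral.intervalIntegrable_rpow' (by linarith)
  have h2 : ∫ t in (0:ℝ)..L, t ^ (d - 1) = L ^ d / d := by
    rw [integral_rpow (Or.inl (by linarith))]
    simp [Real.zero_rpow hd.ne']
  rw [setLIntegral_congr Ioo_ae_eq_Ioc, ← h2, intervalIntegral.integral_of_le hL]
  symm
  refine ofReal_integral_eq_lintegral_ofReal h1.1 ?_
  filter_upwards [ae_restrict_mem measurableSet_Ioc] with t ht
  exact Real.rpow_nonneg ht.1.le _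

lemma pw_int_neg {d L : ℝ} (hd : 0 < d) (hL : 0 ≤ L) :
    ∫⁻ t in Set.Ioo (-L) 0, ENNReal.ofReal (|t| ^ (d - 1)) = ENNReal.ofReal (L ^ d / d) := by
  rw [← pw_int hd hL, ← neg_int _ 0 L, neg_zero]
  refine setLIntegral_congr_fun measurableSet_Ioo fun t ht => ?_
  rw [abs_of_neg ht.2]

lemma pw_sym {d L : ℝ} (hd : 0 < d) (hL : 0 ≤ L) :
    ∫⁻ t in Set.Ioc (-L) L, ENNReal.ofReal (|t| ^ (d - 1)) ≤ ENNReal.ofReal (2 * (L ^ d / d)) := by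
  have e : Set.Ioc (-L) L = Set.Ioc (-L) 0 ∪ Set.Ioc 0 L := (Set.Ioc_union_Ioc_eq_Ioc (by linarith) hL).symm
  rw [e]
  refine (lintegral_union_le _ _ _).trans ?_
  rw [setLIntegral_congr (Ioo_ae_eq_Ioc (a := -L) (b := 0)).symm, setLIntegral_congr (Ioo_ae_eq_Ioc (a := (0:ℝ)) (b := L)).symm,
    pw_int_neg hd hL, two_mul, ENNReal.ofReal_add (by positivity) (by positivity), ← pw_int hd hL]
  refine add_le_add le_rfl (le_of_eq ?_)
  refine setLIntegral_congr_fun measurableSet_Ioo fun t ht => ?_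
  rw [abs_of_pos ht.1]

lemma isWeight_pow {γ : ℝ} (hγ : -1 < γ) : IsWeight (fun t => |t| ^ γ) := by
  constructor
  · have : ∀ᵐ x : ℝ, x ≠ 0 := by simp [ae_iff]
    filter_upwards [this] with x hx
    exact Real.rpow_pos_of_pos (abs_pos.mpr hx) _
  · intro x
    have hL : (0:ℝ) ≤ |x| + 1 := by positivity
    refine ⟨Set.Ioc (-(|x| + 1)) (|x| + 1), Ioc_mem_nhds ?_ ?_, ?_⟩
    · linarith [neg_abs_le x]
    · linarith [le_abs_self x]
    · refine ⟨(by fun_prop : Measurable fun t : ℝ => |t| ^ γ).aestronglyMeasurable, ?_⟩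
      rw [hasFiniteIntegral_iff_ofReal (Eventually.of_forall fun t => Real.rpow_nonneg (abs_nonneg t) _)]
      have := pw_sym (d := γ + 1) (by linarith) hL
      rw [add_sub_cancel_right] at this
      exact this.trans_lt ENNReal.ofReal_lt_top

lemma avg_le {φ : ℝ → ℝ} {x y B : ℝ} (hxy : x < y) (hB : ∀ t ∈ Set.Ioc x y, φ t ≤ B) :
    avgIoc φ x y ≤ ENNReal.ofReal B := by
  unfold avgIoc lintIoc
  calc _ ≤ (ENNReal.ofReal (y - x))⁻¹ * ∫⁻ t in Set.Ioc x y, ENNReal.ofReal B :=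
        mul_le_mul_right (setLIntegral_mono measurable_const fun t ht => ENNReal.ofReal_le_ofReal (hB t ht)) _
    _ = ENNReal.ofReal B := by
        rw [setLIntegral_const, Real.volume_Ioc, mul_comm, mul_assoc, ENNReal.mul_inv_cancel, mul_one]
        · simpa using hxy
        · exact ENNReal.ofReal_ne_top

lemma avg_sing {δ x y h : ℝ} (hδ : 0 < δ) (hδ1 : δ ≤ 1) (hh : 0 < h) (hxy : y - x = h) (h1 : -(3 * h) ≤ x) (h2 : y ≤ 3 * h) :
    avgIoc (fun t => |t| ^ (δ - 1)) x y ≤ ENNReal.ofReal (6 * h ^ (δ - 1) / δ) := by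
  unfold avgIoc lintIoc
  have := (lintegral_mono_set (μ := volume) (f := fun t : ℝ => ENNReal.ofReal (|t| ^ (δ - 1))) (Set.Ioc_subset_Ioc h1 h2)).trans
    (pw_sym hδ (by positivity : 0 ≤ 3 * h))
  rw [hxy]
  refine (mul_le_mul_right this _).trans ?_
  rw [← ENNReal.ofReal_inv_of_pos hh, ← ENNReal.ofReal_mul (by positivity)]
  refine ENNReal.ofReal_le_ofReal ?_
  rw [Real.mul_rpow (by norm_num) hh.le, Real.rpow_sub_one hh.ne']
  have h3 : (3:ℝ) ^ δ ≤ 3 := by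
    calc (3:ℝ) ^ δ ≤ 3 ^ (1:ℝ) := Real.rpow_le_rpow_of_exponent_le (by norm_num) hδ1
      _ = 3 := Real.rpow_one 3
  have hhd : 0 < h ^ δ := Real.rpow_pos_of_pos hh _
  calc h⁻¹ * (2 * (3 ^ δ * h ^ δ / δ)) = 2 * 3 ^ δ * (h ^ δ / h) / δ := by field_simp
    _ ≤ 2 * 3 * (h ^ δ / h) / δ := by gcongr
    _ = _ := by ring

lemma far_bounds {x h t : ℝ} (hh : 0 < h) (hx : 2 * h ≤ |x|) (h1 : x - h ≤ t) (h2 : t ≤ x + h) :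
    |x| / 2 ≤ |t| ∧ |t| ≤ 2 * |x| := by
  rcases abs_cases x with ⟨e, _⟩ | ⟨e, _⟩ <;> rcases abs_cases t with ⟨e', _⟩ | ⟨e', _⟩ <;>
    rw [e] at hx ⊢ <;> rw [e'] <;> constructor <;> linarith

lemma far_sing {δ x t h : ℝ} (hδ : 0 < δ) (hδ1 : δ ≤ 1) (hh : 0 < h) (hx : 2 * h ≤ |x|) (h1 : x - h ≤ t) (h2 : t ≤ x + h) :
    |t| ^ (δ - 1) ≤ 2 * |x| ^ (δ - 1) := by
  have hx0 : 0 < |x| := by linarith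
  have := far_bounds hh hx h1 h2
  calc |t| ^ (δ - 1) ≤ (|x| / 2) ^ (δ - 1) := Real.rpow_le_rpow_of_nonpos (by linarith) this.1 (by linarith)
    _ = |x| ^ (δ - 1) * 2 ^ (1 - δ) := by
        rw [Real.div_rpow hx0.le (by norm_num), div_eq_mul_inv, ← Real.rpow_neg (by norm_num)]; ring_nf
    _ ≤ |x| ^ (δ - 1) * 2 := by
        gcongr
        calc (2:ℝ) ^ (1 - δ) ≤ 2 ^ (1:ℝ) := Real.rpow_le_rpow_of_exponent_le (by norm_num) (by linarith)
          _ = 2 := Real.rpow_one 2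
    _ = _ := by ring

lemma bd_pow {L t m N : ℝ} (hL : 0 < L) (hm : 0 ≤ m) (hmN : m ≤ N) (ht : |t| ≤ 3 * L) : |t| ^ m ≤ 3 ^ N * L ^ m := by
  calc |t| ^ m ≤ (3 * L) ^ m := Real.rpow_le_rpow (abs_nonneg _) ht hm
    _ = 3 ^ m * L ^ m := Real.mul_rpow (by norm_num) hL.le
    _ ≤ 3 ^ N * L ^ m := by
        gcongr
        norm_num

lemma near_bd {x h t : ℝ} (hx : |x| < 2 * h) (h1 : x - h ≤ t) (h2 : t ≤ x + h) : |t| ≤ 3 * h := by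
  rw [abs_lt] at hx; rw [abs_le]; constructor <;> linarith [hx.1, hx.2]

/-- characteristic bound, case A. -/
lemma charA {p q δ : ℝ} (hp : 1 < p) (hq : 0 < q) (hδ : 0 < δ) (hδ1 : δ ≤ 1) :
    apqMinusChar p q (fun t => |t| ^ ((1 - δ) / (p / (p - 1)))) ≤
      ENNReal.ofReal ((3 ^ (q / (p / (p - 1))) * 6 ^ (q / (p / (p - 1)))) * δ ^ (-(q / (p / (p - 1))))) := by
  set P := p / (p - 1) with hP
  have hP0 : 0 < P := by rw [hP]; apply div_pos <;> linarith
  set κ := q / P with hκ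
  have hκ0 : 0 < κ := by positivity
  have e1 : (fun t : ℝ => (|t| ^ ((1 - δ) / P)) ^ q) = fun t => |t| ^ ((1 - δ) * κ) := by
    funext t; rw [← Real.rpow_mul (abs_nonneg _)]; congr 1; rw [hκ]; ring
  have e2 : (fun t : ℝ => (|t| ^ ((1 - δ) / P)) ^ (-P)) = fun t => |t| ^ (δ - 1) := by
    funext t; rw [← Real.rpow_mul (abs_nonneg _)]; congr 1; field_simp; ring
  unfold apqMinusChar
  rw [← hP, ← hκ]
  refine iSup_le fun x => iSup_le fun h => iSup_le fun hh => ?_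
  have hm0 : 0 ≤ (1 - δ) * κ := mul_nonneg (by linarith) hκ0.le
  have hm1 : (1 - δ) * κ ≤ κ := by nlinarith
  simp only [e1, e2]
  have key : ∀ L : ℝ, 0 < L → 3 ^ κ * L ^ ((1 - δ) * κ) * (6 * L ^ (δ - 1) / δ) ^ κ ≤ (3 ^ κ * 6 ^ κ) * δ ^ (-κ) := by
    intro L hL
    rw [Real.div_rpow (by positivity) hδ.le, Real.mul_rpow (by norm_num) (by positivity), ← Real.rpow_mul hL.le,
      Real.rpow_neg hδ.le]
    refine le_of_eq ?_
    have : L ^ ((1 - δ) * κ) * L ^ ((δ - 1) * κ) = 1 := by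
      rw [← Real.rpow_add hL]; ring_nf; simp
    calc _ = 3 ^ κ * 6 ^ κ * (δ ^ κ)⁻¹ * (L ^ ((1 - δ) * κ) * L ^ ((δ - 1) * κ)) := by ring
      _ = _ := by rw [this, mul_one]
  have fin : ∀ L : ℝ, 0 < L → avgIoc (fun t => |t| ^ ((1 - δ) * κ)) x (x + h) ≤ ENNReal.ofReal (3 ^ κ * L ^ ((1 - δ) * κ)) →
      avgIoc (fun t => |t| ^ (δ - 1)) (x - h) x ≤ ENNReal.ofReal (6 * L ^ (δ - 1) / δ) →
      avgIoc (fun t => |t| ^ ((1 - δ) * κ)) x (x + h) * avgIoc (fun t => |t| ^ (δ - 1)) (x - h) x ^ κ ≤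
        ENNReal.ofReal ((3 ^ κ * 6 ^ κ) * δ ^ (-κ)) := by
    intro L hL h1 h2
    refine (mul_le_mul' h1 (ENNReal.rpow_le_rpow h2 hκ0.le)).trans ?_
    rw [ENNReal.ofReal_rpow_of_pos (by positivity), ← ENNReal.ofReal_mul (by positivity)]
    exact ENNReal.ofReal_le_ofReal (key L hL)
  rcases lt_or_ge |x| (2 * h) with hx | hx
  · refine fin h hh (avg_le (by linarith) fun t ht => bd_pow hh hm0 hm1 (near_bd hx (by linarith [ht.1]) ht.2)) ?_
    rw [abs_lt] at hx
    exact avg_sing hδ hδ1 hh (by ring) (by linarith) (by linarith)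
  · have hx0 : 0 < |x| := by linarith
    refine fin |x| hx0 (avg_le (by linarith) fun t ht => bd_pow hx0 hm0 hm1 
      (by linarith [(far_bounds hh hx (by linarith [ht.1]) ht.2).2])) (avg_le (by linarith) fun t ht => ?_)
    refine (far_sing hδ hδ1 hh hx ht.1.le (by linarith [ht.2])).trans ?_
    rw [le_div_iff₀ hδ]
    nlinarith [Real.rpow_pos_of_pos hx0 (δ - 1)]

/-- characteristic bound, case B. -/
lemma charB {p q δ : ℝ} (hp : 1 < p) (hq : 0 < q) (hδ : 0 < δ) (hδ1 : δ ≤ 1) :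
    apqMinusChar p q (fun t => |t| ^ ((δ - 1) / q)) ≤ ENNReal.ofReal (18 * δ ^ (-(1:ℝ))) := by
  set P := p / (p - 1) with hP
  have hP0 : 0 < P := by rw [hP]; apply div_pos <;> linarith
  set κ := q / P with hκ
  have hκ0 : 0 < κ := by positivity
  have e1 : (fun t : ℝ => (|t| ^ ((δ - 1) / q)) ^ q) = fun t => |t| ^ (δ - 1) := by
    funext t; rw [← Real.rpow_mul (abs_nonneg _)]; congr 1; field_simp
  have e2 : (fun t : ℝ => (|t| ^ ((δ - 1) / q)) ^ (-P)) = fun t => |t| ^ ((1 - δ) / κ) := by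
    funext t; rw [← Real.rpow_mul (abs_nonneg _)]; congr 1; rw [hκ]; field_simp; ring
  unfold apqMinusChar
  rw [← hP, ← hκ]
  refine iSup_le fun x => iSup_le fun h => iSup_le fun hh => ?_
  have hm0 : 0 ≤ (1 - δ) / κ := div_nonneg (by linarith) hκ0.le
  have hm1 : (1 - δ) / κ ≤ 1 / κ := by gcongr; linarith
  simp only [e1, e2]
  have key : ∀ L : ℝ, 0 < L → (6 * L ^ (δ - 1) / δ) * (3 ^ (1 / κ) * L ^ ((1 - δ) / κ)) ^ κ ≤ 18 * δ ^ (-(1:ℝ)) := by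
    intro L hL
    rw [Real.mul_rpow (by positivity) (by positivity), ← Real.rpow_mul hL.le, ← Real.rpow_mul (by norm_num),
      one_div_mul_cancel hκ0.ne', div_mul_cancel₀ _ hκ0.ne', Real.rpow_neg hδ.le, Real.rpow_one, Real.rpow_one]
    refine le_of_eq ?_
    have : L ^ (1 - δ) * L ^ (δ - 1) = 1 := by
      rw [← Real.rpow_add hL]; ring_nf; simp
    calc _ = 18 * δ⁻¹ * (L ^ (1 - δ) * L ^ (δ - 1)) := by ring
      _ = _ := by rw [this, mul_one]
  have fin : ∀ L : ℝ, 0 < L → avgIoc (fun t => |t| ^ (δ - 1)) x (x + h) ≤ ENNReal.ofReal (6 * L ^ (δ - 1) / δ) →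
      avgIoc (fun t => |t| ^ ((1 - δ) / κ)) (x - h) x ≤ ENNReal.ofReal (3 ^ (1 / κ) * L ^ ((1 - δ) / κ)) →
      avgIoc (fun t => |t| ^ (δ - 1)) x (x + h) * avgIoc (fun t => |t| ^ ((1 - δ) / κ)) (x - h) x ^ κ ≤
        ENNReal.ofReal (18 * δ ^ (-(1:ℝ))) := by
    intro L hL h1 h2
    refine (mul_le_mul' h1 (ENNReal.rpow_le_rpow h2 hκ0.le)).trans ?_
    rw [ENNReal.ofReal_rpow_of_pos (by positivity), ← ENNReal.ofReal_mul (by positivity)]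
    exact ENNReal.ofReal_le_ofReal (key L hL)
  rcases lt_or_ge |x| (2 * h) with hx | hx
  · refine fin h hh ?_ (avg_le (by linarith) fun t ht => bd_pow hh hm0 hm1 (near_bd hx ht.1.le (by linarith [ht.2])))
    rw [abs_lt] at hx
    exact avg_sing hδ hδ1 hh (by ring) (by linarith) (by linarith)
  · have hx0 : 0 < |x| := by linarith
    refine fin |x| hx0 (avg_le (by linarith) fun t ht => ?_) (avg_le (by linarith) fun t ht => bd_pow hx0 hm0 hm1 
      (by linarith [(far_bounds hh hx ht.1.le (by linarith [ht.2])).2]))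
    refine (far_sing hδ hδ1 hh hx (by linarith [ht.1]) ht.2).trans ?_
    rw [le_div_iff₀ hδ]
    nlinarith [Real.rpow_pos_of_pos hx0 (δ - 1)]

lemma sharp_of {p q α k M A B β : ℝ} (hp : 1 < p) (hq0 : 0 < q) (hpq : 1 / p - 1 / q = α) (hk : 0 < k) (hM : 0 < M)
    (hA : 0 < A) (hB : 0 < B) (hα1 : α < 1) (hβ : k * β < 1 - α)
    (hex : ∀ δ : ℝ, 0 < δ → δ ≤ 1 → ∃ w f : ℝ → ℝ, IsWeight w ∧
      apqMinusChar p q w ≤ ENNReal.ofReal (M * δ ^ (-k)) ∧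
      lnormW p (fun x => w x ^ p) (fun x => ENNReal.ofReal |f x|) ≤ ENNReal.ofReal (A * δ ^ (-(1 / p))) ∧
      ENNReal.ofReal (B * δ ^ (-1 - 1 / q)) ≤ lnormW q (fun x => w x ^ q) (Ralpha α f)) :
    ¬ ∃ c : ℝ, 0 < c ∧
        ∀ w : ℝ → ℝ, IsWeight w → apqMinusChar p q w ≠ ∞ →
          ∀ f : ℝ → ℝ,
            lnormW q (fun x => w x ^ q) (Ralpha α f) ≤
              ENNReal.ofReal c * apqMinusChar p q w ^ β *
                lnormW p (fun x => w x ^ p) (fun x => ENNReal.ofReal |f x|) := by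
  rintro ⟨c, hc, H⟩
  set β' := max β 0 with hβ'
  have hβ0 : 0 ≤ β' := le_max_right _ _
  have hθ : 0 < 1 - α - k * β' := by
    rcases max_choice β 0 with h | h <;> rw [hβ', h] <;> linarith
  have key : ∀ δ : ℝ, 0 < δ → δ ≤ 1 → B ≤ c * M ^ β' * A * δ ^ (1 - α - k * β') := by
    intro δ hδ hδ1
    obtain ⟨w, f, hw, hX, hf, hR⟩ := hex δ hδ hδ1
    have hXt : apqMinusChar p q w ≠ ∞ := ne_top_of_le_ne_top ENNReal.ofReal_ne_top hX
    have h1 := H w hw hXt f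
    have hX1 := one_le_char hp hq0 hw hXt
    have h2 : apqMinusChar p q w ^ β ≤ ENNReal.ofReal ((M * δ ^ (-k)) ^ β') := by
      rw [← ENNReal.ofReal_rpow_of_nonneg (by positivity) hβ0]
      exact (ENNReal.rpow_le_rpow_of_exponent_le hX1 (le_max_left _ _)).trans (ENNReal.rpow_le_rpow hX hβ0)
    have h3 := hR.trans (h1.trans (mul_le_mul' (mul_le_mul' le_rfl h2) hf))
    rw [← ENNReal.ofReal_mul hc.le, ← ENNReal.ofReal_mul (by positivity),
      ENNReal.ofReal_le_ofReal_iff (by positivity)] at h3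
    rw [Real.mul_rpow hM.le (by positivity), ← Real.rpow_mul hδ.le] at h3
    have h4 := mul_le_mul_of_nonneg_right h3 (Real.rpow_nonneg hδ.le (1 + 1 / q))
    have e1 : B * δ ^ (-1 - 1 / q) * δ ^ (1 + 1 / q) = B := by
      rw [mul_assoc, ← Real.rpow_add hδ]; ring_nf; simp
    rw [e1] at h4
    refine h4.trans (le_of_eq ?_)
    have e2 : δ ^ (1 - α - k * β') = δ ^ (-k * β') * δ ^ (-(1 / p)) * δ ^ (1 + 1 / q) := by
      rw [← Real.rpow_add hδ, ← Real.rpow_add hδ, ← hpq]; ring_nf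
    rw [e2]; ring
  have hlim : Tendsto (fun δ : ℝ => c * M ^ β' * A * δ ^ (1 - α - k * β')) (nhdsWithin 0 (Set.Ioi 0)) (nhds 0) := by
    have h0 := ((Real.continuous_rpow_const hθ.le).tendsto (0:ℝ)).const_mul (c * M ^ β' * A)
    rw [Real.zero_rpow hθ.ne', mul_zero] at h0
    exact tendsto_nhdsWithin_of_tendsto_nhds h0
  obtain ⟨δ, h1, h2, h3⟩ := ((hlim.eventually_lt_const hB).and
    (Ioc_mem_nhdsGT (zero_lt_one (α := ℝ)))).exists
  exact absurd (key δ h2 h3) (not_le.mpr h1)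

section
variable {p q α P : ℝ}

lemma sharpA (hα1 : α < 1) (hp : 1 < p) (hq0 : 0 < q) (hP : P = p / (p - 1))
    (hpq : 1 / p - 1 / q = α) {δ : ℝ} (hδ : 0 < δ) (hδ1 : δ ≤ 1) :
    ∃ f : ℝ → ℝ,
      lnormW p (fun x => (|x| ^ ((1 - δ) / P)) ^ p) (fun x => ENNReal.ofReal |f x|) ≤ ENNReal.ofReal (1 * δ ^ (-(1 / p))) ∧
      ENNReal.ofReal ((2 ^ ((α - 1) * q) * (p / q)) ^ (1 / q) * δ ^ (-1 - 1 / q)) ≤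
        lnormW q (fun x => (|x| ^ ((1 - δ) / P)) ^ q) (Ralpha α f) := by
  have hp0 : 0 < p := by linarith
  have hp1 : 0 < p - 1 := by linarith
  have hP0 : 0 < P := by rw [hP]; positivity
  refine ⟨(Set.Ioo (-1) 0).indicator fun t => |t| ^ (δ - 1), ?_, ?_⟩
  · unfold lnormW
    have e : ∫⁻ x : ℝ, ENNReal.ofReal |(Set.Ioo (-1:ℝ) 0).indicator (fun t => |t| ^ (δ - 1)) x| ^ p *
        ENNReal.ofReal ((|x| ^ ((1 - δ) / P)) ^ p) = ENNReal.ofReal (1 / δ) := by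
      have := pw_int_neg (d := δ) hδ zero_le_one
      rw [Real.one_rpow] at this
      rw [← this, ← lintegral_indicator measurableSet_Ioo]
      refine lintegral_congr fun x => ?_
      by_cases hx : x ∈ Set.Ioo (-1:ℝ) 0
      · rw [Set.indicator_of_mem hx, Set.indicator_of_mem hx]
        have hx0 : 0 < |x| := abs_pos.mpr hx.2.ne
        rw [abs_of_nonneg (by positivity), ENNReal.ofReal_rpow_of_pos (by positivity), ← ENNReal.ofReal_mul (by positivity),
          ← Real.rpow_mul hx0.le, ← Real.rpow_mul hx0.le, ← Real.rpow_add hx0]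
        congr 2
        rw [hP]; field_simp; ring
      · rw [Set.indicator_of_notMem hx, Set.indicator_of_notMem hx]
        simp [ENNReal.zero_rpow_of_pos hp0]
    rw [e, ENNReal.ofReal_rpow_of_pos (by positivity), one_mul, one_div, Real.inv_rpow hδ.le, Real.rpow_neg hδ.le]
  · set f : ℝ → ℝ := (Set.Ioo (-1:ℝ) 0).indicator fun t => |t| ^ (δ - 1) with hf
    have hR : ∀ x ∈ Set.Ioo (0:ℝ) 1, ENNReal.ofReal ((2 * x) ^ (α - 1) * (x ^ δ / δ)) ≤ Ralpha α f x := by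
      intro x hx
      have hx0 : 0 < x := hx.1
      rw [ENNReal.ofReal_mul (by positivity), ← pw_int_neg hδ hx0.le, ← lintegral_const_mul' _ _ ENNReal.ofReal_ne_top]
      unfold Ralpha
      refine le_trans ?_ (lintegral_mono_set (s := Set.Ioo (-x) 0) (fun t ht => show t < x by linarith [ht.2]))
      refine setLIntegral_mono' measurableSet_Ioo fun t ht => ?_
      have ht' : t ∈ Set.Ioo (-1:ℝ) 0 := ⟨by linarith [ht.1, hx.2], ht.2⟩
      rw [← ENNReal.ofReal_mul (by positivity), hf, Set.indicator_of_mem ht', abs_of_nonneg (show (0:ℝ) ≤ |t| ^ (δ - 1) by positivity), mul_comm]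
      refine ENNReal.ofReal_le_ofReal (mul_le_mul_of_nonneg_left ?_ (by positivity))
      exact Real.rpow_le_rpow_of_nonpos (by linarith [ht.2]) (by linarith [ht.1]) (by linarith)
    unfold lnormW
    have hint : ENNReal.ofReal (2 ^ ((α - 1) * q) * (p / q) * δ ^ (-q - 1)) ≤
        ∫⁻ x : ℝ, Ralpha α f x ^ q * ENNReal.ofReal ((|x| ^ ((1 - δ) / P)) ^ q) := by
      have hd : 0 < δ * q / p := by positivity
      have e0 := pw_int (d := δ * q / p) hd zero_le_one
      rw [Real.one_rpow] at e0
      have e1 : 2 ^ ((α - 1) * q) * (p / q) * δ ^ (-q - 1) = (2 ^ ((α - 1) * q) * δ ^ (-q)) * (1 / (δ * q / p)) := by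
        rw [Real.rpow_sub_one hδ.ne']; field_simp
      rw [e1, ENNReal.ofReal_mul (by positivity), ← e0, ← lintegral_const_mul' _ _ ENNReal.ofReal_ne_top]
      refine le_trans ?_ (setLIntegral_le_lintegral (Set.Ioo 0 1) _)
      refine setLIntegral_mono' measurableSet_Ioo fun x hx => ?_
      have hx0 : 0 < x := hx.1
      refine le_trans ?_ (mul_le_mul_left (ENNReal.rpow_le_rpow (hR x hx) hq0.le) _)
      rw [ENNReal.ofReal_rpow_of_pos (by positivity), ← ENNReal.ofReal_mul (by positivity), ← ENNReal.ofReal_mul (by positivity)]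
      refine ENNReal.ofReal_le_ofReal (le_of_eq ?_)
      rw [abs_of_pos hx0, Real.mul_rpow (by positivity) (by positivity), Real.div_rpow (by positivity) hδ.le,
        ← Real.rpow_mul (by positivity), ← Real.rpow_mul hx0.le, ← Real.rpow_mul hx0.le, 
        Real.mul_rpow (by norm_num) hx0.le, Real.rpow_neg hδ.le]
      have e2 : x ^ (δ * q / p - 1) = x ^ ((α - 1) * q) * x ^ (δ * q) * x ^ ((1 - δ) / P * q) := by
        rw [← Real.rpow_add hx0, ← Real.rpow_add hx0]
        congr 1
        rw [hP, ← hpq]; field_simp; ring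
      rw [e2]; ring
    have h2 := ENNReal.rpow_le_rpow hint (show 0 ≤ 1 / q by positivity)
    refine le_trans (le_of_eq ?_) h2
    rw [ENNReal.ofReal_rpow_of_pos (by positivity), Real.mul_rpow (x := 2 ^ ((α - 1) * q) * (p / q)) (y := δ ^ (-q - 1)) (by positivity) (by positivity), ← Real.rpow_mul hδ.le]
    congr 3
    field_simp

lemma sharpB (hα1 : α < 1) (hp : 1 < p) (hq0 : 0 < q) 
    (hpq : 1 / p - 1 / q = α) {δ : ℝ} (hδ : 0 < δ) :
    ∃ f : ℝ → ℝ,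
      lnormW p (fun x => (|x| ^ ((δ - 1) / q)) ^ p) (fun x => ENNReal.ofReal |f x|) ≤
        ENNReal.ofReal ((q / p) ^ (1 / p) * δ ^ (-(1 / p))) ∧
      ENNReal.ofReal ((2 ^ ((α - 1) * q) * Real.exp (-1)) ^ (1 / q) * δ ^ (-1 - 1 / q)) ≤
        lnormW q (fun x => (|x| ^ ((δ - 1) / q)) ^ q) (Ralpha α f) := by
  have hp0 : 0 < p := by linarith
  refine ⟨(Set.Ioo (-1) 0).indicator fun t => |t| ^ (-α), ?_, ?_⟩
  · unfold lnormW
    have e : ∫⁻ x : ℝ, ENNReal.ofReal |(Set.Ioo (-1:ℝ) 0).indicator (fun t => |t| ^ (-α)) x| ^ p *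
        ENNReal.ofReal ((|x| ^ ((δ - 1) / q)) ^ p) = ENNReal.ofReal (1 / (δ * p / q)) := by
      have := pw_int_neg (d := δ * p / q) (by positivity) zero_le_one
      rw [Real.one_rpow] at this
      rw [← this, ← lintegral_indicator measurableSet_Ioo]
      refine lintegral_congr fun x => ?_
      by_cases hx : x ∈ Set.Ioo (-1:ℝ) 0
      · rw [Set.indicator_of_mem hx, Set.indicator_of_mem hx]
        have hx0 : 0 < |x| := abs_pos.mpr hx.2.ne
        rw [abs_of_nonneg (by positivity), ENNReal.ofReal_rpow_of_pos (by positivity), ← ENNReal.ofReal_mul (by positivity),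
          ← Real.rpow_mul hx0.le, ← Real.rpow_mul hx0.le, ← Real.rpow_add hx0]
        congr 2
        rw [← hpq]; field_simp; ring
      · rw [Set.indicator_of_notMem hx, Set.indicator_of_notMem hx]
        simp [ENNReal.zero_rpow_of_pos hp0]
    rw [e, ENNReal.ofReal_rpow_of_pos (by positivity), Real.rpow_neg hδ.le, ← Real.inv_rpow hδ.le,
      ← Real.mul_rpow (by positivity) (by positivity)]
    refine le_of_eq ?_
    congr 2; field_simp
  · set f : ℝ → ℝ := (Set.Ioo (-1:ℝ) 0).indicator fun t => |t| ^ (-α) with hf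
    set y := Real.exp (-(1 / δ)) with hy
    have hy0 : 0 < y := Real.exp_pos _
    have hy1 : y ≤ 1 := by rw [hy, Real.exp_le_one_iff]; simp [hδ.le]
    have hlog : ∫⁻ t in Set.Ioo (-1:ℝ) (-y), ENNReal.ofReal (|t|⁻¹) = ENNReal.ofReal (1 / δ) := by
      have h1 : ∫ t in y..1, t⁻¹ = 1 / δ := by
        rw [integral_inv_of_pos hy0 one_pos, one_div, Real.log_inv, hy, Real.log_exp, neg_neg]
      have h2 : IntervalIntegrable (fun t : ℝ => t⁻¹) volume y 1 := by
        rw [intervalIntegrable_inv_iff]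
        right
        rw [Set.uIcc_of_le hy1]
        exact fun h => absurd h.1 (not_le.mpr hy0)
      have h3 := neg_int (fun t => ENNReal.ofReal |t|⁻¹) y 1
      simp only [abs_neg] at h3
      rw [h3, ← h1, intervalIntegral.integral_of_le hy1, ofReal_integral_eq_lintegral_ofReal h2.1,
        setLIntegral_congr Ioo_ae_eq_Ioc]
      · refine setLIntegral_congr_fun measurableSet_Ioc fun t ht => ?_
        rw [abs_of_pos (hy0.trans ht.1)]
      · filter_upwards [ae_restrict_mem measurableSet_Ioc] with t ht
        exact (inv_pos.mpr (hy0.trans ht.1)).le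
    have hR : ∀ x ∈ Set.Ioo (0:ℝ) y, ENNReal.ofReal (2 ^ (α - 1) * (1 / δ)) ≤ Ralpha α f x := by
      intro x hx
      have hx0 : 0 < x := hx.1
      rw [ENNReal.ofReal_mul (by positivity), ← hlog, ← lintegral_const_mul' _ _ ENNReal.ofReal_ne_top]
      unfold Ralpha
      refine le_trans ?_ (lintegral_mono_set (s := Set.Ioo (-1) (-y)) (fun t ht => show t < x by linarith [ht.2]))
      refine setLIntegral_mono' measurableSet_Ioo fun t ht => ?_
      have ht' : t ∈ Set.Ioo (-1:ℝ) 0 := ⟨ht.1, by linarith [ht.2]⟩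
      have ht0 : 0 < |t| := abs_pos.mpr ht'.2.ne
      rw [← ENNReal.ofReal_mul (by positivity), hf, Set.indicator_of_mem ht', abs_of_nonneg (show (0:ℝ) ≤ |t| ^ (-α) by positivity)]
      refine ENNReal.ofReal_le_ofReal ?_
      calc 2 ^ (α - 1) * |t|⁻¹ = |t| ^ (-α) * (2 * |t|) ^ (α - 1) := by
            rw [Real.mul_rpow (by norm_num) ht0.le, mul_left_comm, ← Real.rpow_add ht0]
            have : -α + (α - 1) = -1 := by ring
            rw [this, Real.rpow_neg_one]
        _ ≤ _ := by
            refine mul_le_mul_of_nonneg_left ?_ (by positivity)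
            rw [abs_of_neg ht'.2]
            exact Real.rpow_le_rpow_of_nonpos (by linarith [ht'.2]) (by linarith [ht.2, hx.2]) (by linarith)
    unfold lnormW
    have hint : ENNReal.ofReal (2 ^ ((α - 1) * q) * Real.exp (-1) * δ ^ (-q - 1)) ≤
        ∫⁻ x : ℝ, Ralpha α f x ^ q * ENNReal.ofReal ((|x| ^ ((δ - 1) / q)) ^ q) := by
      have e0 := pw_int (d := δ) hδ hy0.le
      have hyd : y ^ δ = Real.exp (-1) := by
        rw [hy, ← Real.exp_mul]; congr 1; field_simp
      rw [hyd] at e0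
      have e1 : 2 ^ ((α - 1) * q) * Real.exp (-1) * δ ^ (-q - 1) = (2 ^ (α - 1) * (1 / δ)) ^ q * (Real.exp (-1) / δ) := by
        rw [Real.rpow_sub_one hδ.ne', Real.mul_rpow (by positivity) (by positivity), ← Real.rpow_mul (by norm_num), one_div,
          Real.inv_rpow hδ.le, Real.rpow_neg hδ.le]; ring
      rw [e1, ENNReal.ofReal_mul (by positivity), ← e0, ← lintegral_const_mul' _ _ ENNReal.ofReal_ne_top]
      refine le_trans ?_ (setLIntegral_le_lintegral (Set.Ioo 0 y) _)
      refine setLIntegral_mono' measurableSet_Ioo fun x hx => ?_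
      have hx0 : 0 < x := hx.1
      refine le_trans ?_ (mul_le_mul_left (ENNReal.rpow_le_rpow (hR x hx) hq0.le) _)
      rw [ENNReal.ofReal_rpow_of_pos (by positivity)]
      refine le_of_eq ?_
      congr 2
      rw [abs_of_pos hx0, ← Real.rpow_mul hx0.le, div_mul_cancel₀ _ hq0.ne']
    have h2 := ENNReal.rpow_le_rpow hint (show 0 ≤ 1 / q by positivity)
    refine le_trans (le_of_eq ?_) h2
    rw [ENNReal.ofReal_rpow_of_pos (by positivity), Real.mul_rpow (x := 2 ^ ((α - 1) * q) * (Real.exp (-1))) (y := δ ^ (-q - 1)) (by positivity) (by positivity), ← Real.rpow_mul hδ.le]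
    congr 3
    field_simp

theorem lower (p q α : ℝ) (hα : 0 < α) (hα1 : α < 1) (hp : 1 < p) (hpα : p < 1 / α)
    (hq : q = p / (1 - α * p)) (β : ℝ) (hβ : β < (1 - α) * max 1 ((p / (p - 1)) / q)) :
      ¬ ∃ c : ℝ, 0 < c ∧
        ∀ w : ℝ → ℝ, IsWeight w → apqMinusChar p q w ≠ ∞ →
          ∀ f : ℝ → ℝ,
            lnormW q (fun x => w x ^ q) (Ralpha α f) ≤
              ENNReal.ofReal c * apqMinusChar p q w ^ β *
                lnormW p (fun x => w x ^ p) (fun x => ENNReal.ofReal |f x|) := by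
  have hp0 : 0 < p := by linarith
  have hden : 0 < 1 - α * p := by
    rw [lt_div_iff₀ hα] at hpα; linarith
  have hpq' : p < q := by
    rw [hq, lt_div_iff₀ hden]; nlinarith [mul_pos hα hp0]
  have hq0 : 0 < q := by linarith
  have hpq : 1 / p - 1 / q = α := by
    rw [hq]; field_simp; ring
  have hP0 : 0 < p / (p - 1) := div_pos hp0 (by linarith)
  rcases max_choice 1 ((p / (p - 1)) / q) with h | h
  · rw [h, mul_one] at hβ
    refine sharp_of (k := 1) (M := 18) hp hq0 hpq one_pos (by norm_num)
      (show 0 < (q / p) ^ (1 / p) by positivity) (show 0 < (2 ^ ((α - 1) * q) * Real.exp (-1)) ^ (1 / q) by positivity)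
      hα1 (by linarith) fun δ hδ hδ1 => ?_
    obtain ⟨f, h1, h2⟩ := sharpB hα1 hp hq0 hpq hδ
    refine ⟨_, f, isWeight_pow ?_, charB hp hq0 hδ hδ1, h1, h2⟩
    rw [lt_div_iff₀ hq0]; linarith
  · rw [h] at hβ
    refine sharp_of (k := q / (p / (p - 1))) (M := 3 ^ (q / (p / (p - 1))) * 6 ^ (q / (p / (p - 1)))) hp hq0 hpq 
      (by positivity) (by positivity) one_pos
      (show 0 < (2 ^ ((α - 1) * q) * (p / q)) ^ (1 / q) by positivity)
      hα1 ?_ fun δ hδ hδ1 => ?_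
    · have := mul_lt_mul_of_pos_left hβ (show 0 < q / (p / (p - 1)) by positivity)
      refine this.trans_le (le_of_eq ?_)
      generalize p / (p - 1) = P at hP0
      field_simp
    · obtain ⟨f, h1, h2⟩ := sharpA hα1 hp hq0 rfl hpq hδ hδ1
      refine ⟨_, f, isWeight_pow ?_, charA hp hq0 hδ hδ1, h1, h2⟩
      have : 0 ≤ (1 - δ) / (p / (p - 1)) := div_nonneg (by linarith) hP0.le
      linarith
end

/-- Sharp one-weight bound for the Riemann–Liouville operator:
`‖R_α‖_{L^p_{w^p} → L^q_{w^q}} ≤ c ‖w‖_{A_{p,q}^-}^{(1-α)max{1,p'/q}}`, and the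
exponent `(1-α)max{1,p'/q}` cannot be decreased. -/
theorem stmt13 (p q α : ℝ) (hα : 0 < α) (hα1 : α < 1) (hp : 1 < p) (hpα : p < 1 / α)
    (hq : q = p / (1 - α * p)) :
    (∃ c : ℝ, 0 < c ∧
      ∀ w : ℝ → ℝ, IsWeight w → apqMinusChar p q w ≠ ∞ →
        ∀ f : ℝ → ℝ,
          lnormW q (fun x => w x ^ q) (Ralpha α f) ≤
            ENNReal.ofReal c *
                apqMinusChar p q w ^ ((1 - α) * max 1 ((p / (p - 1)) / q)) *
              lnormW p (fun x => w x ^ p) (fun x => ENNReal.ofReal |f x|)) ∧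
    (∀ β : ℝ, β < (1 - α) * max 1 ((p / (p - 1)) / q) →
      ¬ ∃ c : ℝ, 0 < c ∧
        ∀ w : ℝ → ℝ, IsWeight w → apqMinusChar p q w ≠ ∞ →
          ∀ f : ℝ → ℝ,
            lnormW q (fun x => w x ^ q) (Ralpha α f) ≤
              ENNReal.ofReal c * apqMinusChar p q w ^ β *
                lnormW p (fun x => w x ^ p) (fun x => ENNReal.ofReal |f x|)) :=
  ⟨upper p q α hα hα1 hp hpα hq, fun β hβ => lower p q α hα hα1 hp hpα hq β hβ⟩

end
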